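/- arXiv:2403.03301 — 3 statements merged into one kernel-verified Lean document; each statement's English description precedes it below -/
import Mathlib

section
/- Let p be a prime with p \equiv 3 or 7 mod 20, written as p = 2u^2 + 2uv + 3v^2 with integers u, v, chosen so that 2u + v(1+\sqrt{-5}) is a p-adic unit (for a fixed square root of -5 in Z_p). Then \sum_{k=0}^{p-1} \frac{(4k)!}{k!^4} (-1/1024)^k \equiv -\frac{1}{2} (2u + v(1 + \sqrt{-5}))^2 mod p^3 in Z_p. -/
namespace QuarticHypergeometric

open PowerSeries Complex Filter Topology

/-- A complex power series whose evaluation converges absolutely on the open unit disc. -/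
def Conv (φ : ℂ⟦X⟧) : Prop := ∀ q : ℂ, ‖q‖ < 1 → Summable fun n => ‖coeff n φ * q ^ n‖

/-- The sum of a power series. -/
noncomputable def ev (φ : ℂ⟦X⟧) (q : ℂ) : ℂ := ∑' n, coeff n φ * q ^ n

lemma Conv.hasSum {φ : ℂ⟦X⟧} (h : Conv φ) {q : ℂ} (hq : ‖q‖ < 1) :
    HasSum (fun n => coeff n φ * q ^ n) (ev φ q) := (h q hq).of_norm.hasSum

lemma Conv.add {φ ψ : ℂ⟦X⟧} (h : Conv φ) (h' : Conv ψ) : Conv (φ + ψ) := fun q hq => by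
  refine Summable.of_nonneg_of_le (fun _ => norm_nonneg _) (fun n => ?_) ((h q hq).add (h' q hq))
  rw [map_add, add_mul]
  exact norm_add_le _ _

lemma Conv.neg {φ : ℂ⟦X⟧} (h : Conv φ) : Conv (-φ) := fun q hq => by
  simpa using h q hq

lemma Conv.sub {φ ψ : ℂ⟦X⟧} (h : Conv φ) (h' : Conv ψ) : Conv (φ - ψ) := by
  rw [sub_eq_add_neg]; exact h.add h'.neg

lemma coeff_mul_mul_pow (φ ψ : ℂ⟦X⟧) (q : ℂ) (n : ℕ) : coeff n (φ * ψ) * q ^ n =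
    ∑ kl ∈ Finset.HasAntidiagonal.antidiagonal n, coeff kl.1 φ * q ^ kl.1 * (coeff kl.2 ψ * q ^ kl.2) := by
  rw [coeff_mul, Finset.sum_mul]
  refine Finset.sum_congr rfl fun kl hkl => ?_
  rw [← Finset.HasAntidiagonal.mem_antidiagonal.1 hkl, pow_add]; ring

lemma Conv.mul {φ ψ : ℂ⟦X⟧} (h : Conv φ) (h' : Conv ψ) : Conv (φ * ψ) := fun q hq => by
  have := summable_norm_sum_mul_antidiagonal_of_summable_norm
    (f := fun n => coeff n φ * q ^ n) (g := fun n => coeff n ψ * q ^ n) (h q hq) (h' q hq)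
  simpa only [coeff_mul_mul_pow] using this

lemma conv_C (c : ℂ) : Conv (C c) := fun q _ => by
  refine summable_of_ne_finset_zero (s := {0}) fun n hn => ?_
  simp only [Finset.mem_singleton] at hn
  simp [coeff_C, hn]

lemma conv_X : Conv X := fun q _ => by
  refine summable_of_ne_finset_zero (s := {1}) fun n hn => ?_
  simp only [Finset.mem_singleton] at hn
  simp [coeff_X, hn]

lemma conv_one : Conv 1 := by simpa using conv_C 1

lemma conv_zero : Conv 0 := by simpa using conv_C 0

lemma Conv.pow {φ : ℂ⟦X⟧} (h : Conv φ) (n : ℕ) : Conv (φ ^ n) := by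
  induction n with
  | zero => simpa using conv_one
  | succ n ih => rw [pow_succ]; exact ih.mul h

@[simp] lemma ev_C (c q : ℂ) : ev (C c) q = c := by
  rw [ev, tsum_eq_single 0 (fun n hn => by simp [coeff_C, hn])]; simp

@[simp] lemma ev_X (q : ℂ) : ev X q = q := by
  rw [ev, tsum_eq_single 1 (fun n hn => by simp [coeff_X, hn])]; simp

@[simp] lemma ev_one (q : ℂ) : ev 1 q = 1 := by simpa using ev_C 1 q

@[simp] lemma ev_zero_left (q : ℂ) : ev 0 q = 0 := by simpa using ev_C 0 q

lemma ev_zero (φ : ℂ⟦X⟧) : ev φ 0 = constantCoeff φ := by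
  rw [ev, tsum_eq_single 0 (fun n hn => by simp [hn])]; simp

lemma ev_add {φ ψ : ℂ⟦X⟧} (h : Conv φ) (h' : Conv ψ) {q : ℂ} (hq : ‖q‖ < 1) :
    ev (φ + ψ) q = ev φ q + ev ψ q := by
  refine HasSum.tsum_eq ?_
  simpa [add_mul] using (h.hasSum hq).add (h'.hasSum hq)

lemma ev_neg (φ : ℂ⟦X⟧) (q : ℂ) : ev (-φ) q = -ev φ q := by
  simp [ev, tsum_neg]

lemma ev_sub {φ ψ : ℂ⟦X⟧} (h : Conv φ) (h' : Conv ψ) {q : ℂ} (hq : ‖q‖ < 1) :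
    ev (φ - ψ) q = ev φ q - ev ψ q := by
  rw [sub_eq_add_neg, ev_add h h'.neg hq, ev_neg, sub_eq_add_neg]

lemma ev_mul {φ ψ : ℂ⟦X⟧} (h : Conv φ) (h' : Conv ψ) {q : ℂ} (hq : ‖q‖ < 1) :
    ev (φ * ψ) q = ev φ q * ev ψ q := by
  simp only [ev, coeff_mul_mul_pow]
  exact (tsum_mul_tsum_eq_tsum_sum_antidiagonal_of_summable_norm (h q hq) (h' q hq)).symm

lemma ev_pow {φ : ℂ⟦X⟧} (h : Conv φ) {q : ℂ} (hq : ‖q‖ < 1) (n : ℕ) :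
    ev (φ ^ n) q = ev φ q ^ n := by
  induction n with
  | zero => simp
  | succ n ih => rw [pow_succ, ev_mul (h.pow n) h hq, ih, pow_succ]

lemma norm_pow_lt_one {q : ℂ} (hq : ‖q‖ < 1) {m : ℕ} (hm : m ≠ 0) : ‖q ^ m‖ < 1 := by
  rw [norm_pow]; exact pow_lt_one₀ (norm_nonneg _) hq hm

lemma expand_term (φ : ℂ⟦X⟧) {m : ℕ} (hm : m ≠ 0) (q : ℂ) :
    (fun n => coeff n (expand m hm φ) * q ^ n) =
      Function.extend (fun n => m * n) (fun n => coeff n φ * (q ^ m) ^ n) 0 := by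
  have hinj : Function.Injective (fun n : ℕ => m * n) :=
    fun a b h => Nat.eq_of_mul_eq_mul_left (Nat.pos_of_ne_zero hm) h
  funext n
  by_cases h : m ∣ n
  · obtain ⟨k, rfl⟩ := h
    rw [hinj.extend_apply (fun n => coeff n φ * (q ^ m) ^ n), coeff_expand_mul, pow_mul]
  · rw [Function.extend_apply' _ _ _ (fun ⟨k, hk⟩ => h ⟨k, hk.symm⟩),
      coeff_expand_of_not_dvd _ _ _ h]
    simp

lemma conv_expand {φ : ℂ⟦X⟧} (h : Conv φ) {m : ℕ} (hm : m ≠ 0) : Conv (expand m hm φ) := by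
  have hinj : Function.Injective (fun n : ℕ => m * n) :=
    fun a b h => Nat.eq_of_mul_eq_mul_left (Nat.pos_of_ne_zero hm) h
  intro q hq
  refine Summable.norm ?_
  rw [expand_term φ hm q]
  have hs : Summable fun n => coeff n φ * (q ^ m) ^ n := (h _ (norm_pow_lt_one hq hm)).of_norm
  generalize (fun n => coeff n φ * (q ^ m) ^ n) = g at hs
  exact (summable_extend_zero hinj).2 hs

lemma ev_expand (φ : ℂ⟦X⟧) {m : ℕ} (hm : m ≠ 0) (q : ℂ) :
    ev (expand m hm φ) q = ev φ (q ^ m) := by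
  have hinj : Function.Injective (fun n : ℕ => m * n) :=
    fun a b h => Nat.eq_of_mul_eq_mul_left (Nat.pos_of_ne_zero hm) h
  rw [ev, expand_term φ hm q, tsum_extend_zero hinj]
  rfl

/-- The Euler operator `q d/dq`. -/
noncomputable def euler {R : Type*} [CommRing R] (φ : R⟦X⟧) : R⟦X⟧ := X * d⁄dX R φ

lemma coeff_euler {R : Type*} [CommRing R] (φ : R⟦X⟧) (n : ℕ) :
    coeff n (euler φ) = n * coeff n φ := by
  cases n with
  | zero => simp [euler]
  | succ n => rw [euler, coeff_succ_X_mul, coeff_derivative]; push_cast; ring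

lemma euler_add {R : Type*} [CommRing R] (φ ψ : R⟦X⟧) : euler (φ + ψ) = euler φ + euler ψ := by
  simp [euler, mul_add]

lemma euler_sub {R : Type*} [CommRing R] (φ ψ : R⟦X⟧) : euler (φ - ψ) = euler φ - euler ψ := by
  simp [euler, mul_sub]

lemma euler_mul {R : Type*} [CommRing R] (φ ψ : R⟦X⟧) :
    euler (φ * ψ) = φ * euler ψ + ψ * euler φ := by
  simp only [euler, Derivation.leibniz, smul_eq_mul]; ring

lemma euler_pow {R : Type*} [CommRing R] (φ : R⟦X⟧) (n : ℕ) :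
    euler (φ ^ n) = n * φ ^ (n - 1) * euler φ := by
  rw [euler, derivative_pow, euler]; ring

lemma euler_C {R : Type*} [CommRing R] (c : R) : euler (C c) = 0 := by simp [euler]

lemma euler_X {R : Type*} [CommRing R] : euler (X : R⟦X⟧) = X := by simp [euler]

/-- The formal multilinear series attached to a power series. -/
noncomputable def toFMS (φ : ℂ⟦X⟧) : FormalMultilinearSeries ℂ ℂ ℂ :=
  FormalMultilinearSeries.ofScalars ℂ (fun n => coeff n φ)

lemma Conv.one_le_radius {φ : ℂ⟦X⟧} (h : Conv φ) : 1 ≤ (toFMS φ).radius := by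
  refine ENNReal.le_of_forall_nnreal_lt fun r hr => ?_
  refine FormalMultilinearSeries.le_radius_of_summable _ ?_
  have hr1 : (r : ℝ) < 1 := by exact_mod_cast hr
  have := h (r : ℝ) (by simpa using hr1)
  simpa [toFMS, FormalMultilinearSeries.ofScalars_norm] using this

lemma eball_zero_one : Metric.eball (0 : ℂ) 1 = Metric.ball 0 1 := by
  simpa using Metric.eball_ofReal (x := (0 : ℂ)) (ε := 1)

lemma Conv.hasFPowerSeriesOnBall {φ : ℂ⟦X⟧} (h : Conv φ) :
    HasFPowerSeriesOnBall (ev φ) (toFMS φ) 0 1 where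
  r_le := h.one_le_radius
  r_pos := one_pos
  hasSum := by
    intro q hq
    have hq' : ‖q‖ < 1 := by rwa [eball_zero_one, mem_ball_zero_iff] at hq
    simpa [toFMS, FormalMultilinearSeries.ofScalars_apply_eq, mul_comm] using h.hasSum hq'

lemma Conv.ext_of_eventually {φ ψ : ℂ⟦X⟧} (h : Conv φ) (h' : Conv ψ)
    (heq : ∀ᶠ q in 𝓝 0, ev φ q = ev ψ q) : φ = ψ := by
  have := h.hasFPowerSeriesOnBall.hasFPowerSeriesAt.eq_formalMultilinearSeries_of_eventually
    h'.hasFPowerSeriesOnBall.hasFPowerSeriesAt heq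
  rw [toFMS, toFMS, FormalMultilinearSeries.ofScalars_series_eq_iff] at this
  ext n
  exact congrFun this n

lemma Conv.ext {φ ψ : ℂ⟦X⟧} (h : Conv φ) (h' : Conv ψ)
    (heq : ∀ q : ℂ, ‖q‖ < 1 → ev φ q = ev ψ q) : φ = ψ :=
  h.ext_of_eventually h' (by
    filter_upwards [Metric.ball_mem_nhds (0 : ℂ) one_pos] with q hq
    exact heq q (by simpa using hq))

lemma Conv.differentiableOn {φ : ℂ⟦X⟧} (h : Conv φ) :
    DifferentiableOn ℂ (ev φ) (Metric.ball 0 1) := by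
  rw [← eball_zero_one]
  exact h.hasFPowerSeriesOnBall.differentiableOn

lemma exists_conv_of_differentiableOn {G : ℂ → ℂ} (hG : DifferentiableOn ℂ G (Metric.ball 0 1)) :
    ∃ φ, Conv φ ∧ ∀ q : ℂ, ‖q‖ < 1 → ev φ q = G q := by
  have key : ∀ R : NNReal, 0 < R → R < 1 →
      HasFPowerSeriesOnBall G (cauchyPowerSeries G 0 R) 0 R := fun R h0 h1 =>
    (hG.mono (Metric.closedBall_subset_ball (by exact_mod_cast h1))).hasFPowerSeriesOnBall h0
  set P := cauchyPowerSeries G 0 ((1 / 2 : NNReal) : ℝ) with hP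
  have hhalf : (1 / 2 : NNReal) < 1 := by
    rw [← NNReal.coe_lt_coe]; norm_num
  have hsum : ∀ q : ℂ, ‖q‖ < 1 → HasSum (fun n => coeff n (mk fun n => P.coeff n) * q ^ n) (G q) := by
    intro q hq
    obtain ⟨R, hqR, hR1⟩ := exists_between hq
    lift R to NNReal using (norm_nonneg q).trans hqR.le
    have hR0 : 0 < R := by
      rw [← NNReal.coe_pos]; exact (norm_nonneg q).trans_lt hqR
    have h1 := key R hR0 (by exact_mod_cast hR1)
    have h2 := h1.hasFPowerSeriesAt.eq_formalMultilinearSeries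
      (key (1 / 2) (by positivity) hhalf).hasFPowerSeriesAt
    have h3 := h1.hasSum (y := q) (by
      rw [← ENNReal.ofReal_coe_nnreal, Metric.eball_ofReal]
      simpa using hqR)
    rw [h2] at h3
    simpa only [FormalMultilinearSeries.apply_eq_pow_smul_coeff, ← hP, mul_comm, smul_eq_mul, zero_add, coeff_mk] using h3
  exact ⟨mk fun n => P.coeff n, fun q hq => (hsum q hq).summable.norm,
    fun q hq => (hsum q hq).tsum_eq⟩

lemma conv_of_le {φ ψ : ℂ⟦X⟧} (hψ : Conv ψ) (k : ℕ)
    (hle : ∀ n, ‖coeff n φ‖ ≤ (n : ℝ) ^ k * ‖coeff n ψ‖) : Conv φ := by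
  intro q hq
  obtain ⟨r, hqr, hr1⟩ := exists_between hq
  have hr0 : 0 < r := (norm_nonneg q).trans_lt hqr
  have hsum := hψ (r : ℂ) (by simpa [abs_of_pos hr0] using hr1)
  have hgeo : Summable fun n : ℕ => ((n : ℝ) ^ k * (‖q‖ / r) ^ n) :=
    summable_pow_mul_geometric_of_norm_lt_one k
      (by rw [norm_div, norm_norm, Real.norm_of_nonneg hr0.le]; exact (div_lt_one hr0).2 hqr)
  obtain ⟨B, hB⟩ := hsum.tendsto_atTop_zero.bddAbove_range
  have hB' : ∀ n, ‖coeff n ψ‖ * r ^ n ≤ B := fun n => by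
    have := hB ⟨n, rfl⟩
    simpa [abs_of_pos hr0] using this
  refine Summable.of_nonneg_of_le (fun _ => norm_nonneg _) (fun n => ?_) (hgeo.mul_left B)
  have hrn : 0 < r ^ n := pow_pos hr0 n
  calc ‖coeff n φ * q ^ n‖ = ‖coeff n φ‖ * ‖q‖ ^ n := by rw [norm_mul, norm_pow]
    _ ≤ ((n : ℝ) ^ k * ‖coeff n ψ‖) * ‖q‖ ^ n := by gcongr; exact hle n
    _ = (‖coeff n ψ‖ * r ^ n) * ((n : ℝ) ^ k * (‖q‖ / r) ^ n) := by
      rw [div_pow]; field_simp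
    _ ≤ B * ((n : ℝ) ^ k * (‖q‖ / r) ^ n) := by gcongr; exact hB' n

lemma conv_euler {φ : ℂ⟦X⟧} (h : Conv φ) : Conv (euler φ) :=
  conv_of_le h 1 fun n => by simp [coeff_euler]

lemma conv_geom : Conv (mk fun _ => 1) := fun q hq => by
  simpa using summable_geometric_of_lt_one (norm_nonneg q) hq

lemma Conv.hasDerivAt {φ : ℂ⟦X⟧} (h : Conv φ) {q : ℂ} (hq : ‖q‖ < 1) :
    HasDerivAt (ev φ) (∑' n, coeff n φ * (n * q ^ (n - 1))) q := by
  obtain ⟨r, hqr, hr1⟩ := exists_between hq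
  have hr0 : 0 < r := (norm_nonneg q).trans_lt hqr
  have hsum := conv_euler h (r : ℂ) (by simpa [abs_of_pos hr0] using hr1)
  have h0 : Summable fun n => coeff n φ * (0 : ℂ) ^ n := (h 0 (by simp)).of_norm
  unfold ev
  generalize hc : (fun n => coeff n φ) = c
  have hc' : ∀ n, coeff n φ = c n := fun n => congrFun hc n
  simp only [coeff_euler, hc'] at hsum h0 ⊢
  refine hasDerivAt_tsum_of_isPreconnected (g := fun n y => c n * y ^ n)
    (g' := fun n y => c n * (n * y ^ (n - 1))) (u := fun n => ‖n * c n * (r : ℂ) ^ n‖ / r)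
    (t := Metric.ball 0 r) (y₀ := 0) (hsum.div_const r) Metric.isOpen_ball
    (convex_ball _ _).isPreconnected (fun n y _ => (hasDerivAt_pow n y).const_mul _)
    (fun n y hy => ?_) (Metric.mem_ball_self hr0) h0 (by simpa using hqr)
  have hy' : ‖y‖ ≤ r := by simpa using (mem_ball_zero_iff.1 hy).le
  cases n with
  | zero => simp
  | succ n =>
    rw [norm_mul, norm_mul, norm_mul, norm_mul, norm_pow, norm_pow, Complex.norm_real,
      Real.norm_of_nonneg hr0.le, le_div_iff₀ hr0, Nat.add_sub_cancel]
    calc _ = ‖c (n + 1)‖ * ‖((n + 1 : ℕ) : ℂ)‖ * (‖y‖ ^ n * r) := by ring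
      _ ≤ ‖c (n + 1)‖ * ‖((n + 1 : ℕ) : ℂ)‖ * (r ^ n * r) := by gcongr
      _ = _ := by ring

lemma Conv.mul_deriv {φ : ℂ⟦X⟧} {q : ℂ} :
    q * (∑' n, coeff n φ * (n * q ^ (n - 1))) = ev (euler φ) q := by
  rw [ev, ← tsum_mul_left]
  refine tsum_congr fun n => ?_
  rw [coeff_euler]
  cases n with
  | zero => simp
  | succ n => rw [Nat.add_sub_cancel]; ring

end QuarticHypergeometric

namespace QuarticHypergeometric

open PowerSeries Complex Filter Topology

/-- The nome `exp (2πiτ)`. -/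
noncomputable def nome (τ : ℂ) : ℂ := cexp (2 * Real.pi * I * τ)

lemma norm_nome (τ : ℂ) : ‖nome τ‖ = Real.exp (-(2 * Real.pi * τ.im)) := by
  rw [nome, Complex.norm_exp]; simp

lemma norm_nome_lt_one {τ : ℂ} (h : 0 < τ.im) : ‖nome τ‖ < 1 := by
  rw [norm_nome, Real.exp_lt_one_iff]
  have := Real.pi_pos
  nlinarith [mul_pos this h]

lemma nome_nat_mul (m : ℕ) (τ : ℂ) : nome (m * τ) = nome τ ^ m := by
  rw [nome, nome, ← Complex.exp_nat_mul]; ring_nf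

lemma nome_add (τ τ' : ℂ) : nome (τ + τ') = nome τ * nome τ' := by
  rw [nome, nome, nome, ← Complex.exp_add]; ring_nf

lemma nome_add_intCast (τ : ℂ) (n : ℤ) : nome (τ + n) = nome τ := by
  rw [nome_add, nome, nome]
  have : 2 * (Real.pi : ℂ) * I * (n : ℂ) = n * (2 * Real.pi * I) := by ring
  rw [this, Complex.exp_int_mul_two_pi_mul_I, mul_one]

lemma exists_nome_eq {q : ℂ} (h0 : q ≠ 0) (h1 : ‖q‖ < 1) :
    ∃ τ : ℂ, 0 < τ.im ∧ nome τ = q := by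
  have hpi : (2 * Real.pi * I : ℂ) ≠ 0 := Complex.two_pi_I_ne_zero
  have hq : nome (Complex.log q / (2 * Real.pi * I)) = q := by
    rw [nome, mul_div_cancel₀ _ hpi, Complex.exp_log h0]
  refine ⟨_, ?_, hq⟩
  by_contra hneg
  have := norm_nome (Complex.log q / (2 * Real.pi * I))
  rw [hq] at this
  rw [this, Real.exp_lt_one_iff] at h1
  have := Real.pi_pos
  nlinarith

/-- The complex power series attached to an integral one. -/
noncomputable abbrev toC (φ : ℤ⟦X⟧) : ℂ⟦X⟧ := PowerSeries.map (Int.castRingHom ℂ) φ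

lemma toC_injective : Function.Injective toC :=
  PowerSeries.map_injective _ Int.cast_injective

/-- The value of an integral power series at the nome of `τ`. -/
noncomputable def val (φ : ℤ⟦X⟧) (τ : ℂ) : ℂ := ev (toC φ) (nome τ)

/-- An integral power series converging on the open unit disc. -/
def IConv (φ : ℤ⟦X⟧) : Prop := Conv (toC φ)

lemma IConv.add {φ ψ : ℤ⟦X⟧} (h : IConv φ) (h' : IConv ψ) : IConv (φ + ψ) := by
  rw [IConv, toC, map_add]; exact Conv.add h h'

lemma IConv.sub {φ ψ : ℤ⟦X⟧} (h : IConv φ) (h' : IConv ψ) : IConv (φ - ψ) := by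
  rw [IConv, toC, map_sub]; exact Conv.sub h h'

lemma IConv.mul {φ ψ : ℤ⟦X⟧} (h : IConv φ) (h' : IConv ψ) : IConv (φ * ψ) := by
  rw [IConv, toC, map_mul]; exact Conv.mul h h'

lemma IConv.pow {φ : ℤ⟦X⟧} (h : IConv φ) (n : ℕ) : IConv (φ ^ n) := by
  rw [IConv, toC, map_pow]; exact Conv.pow h n

lemma iconv_C (c : ℤ) : IConv (C c) := by
  rw [IConv, toC, map_C]; exact conv_C _

lemma iconv_X : IConv X := by
  rw [IConv, toC, map_X]; exact conv_X

lemma iconv_one : IConv 1 := by simpa using iconv_C 1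

lemma IConv.expand {φ : ℤ⟦X⟧} (h : IConv φ) {m : ℕ} (hm : m ≠ 0) :
    IConv (PowerSeries.expand m hm φ) := by
  rw [IConv, toC, map_expand]; exact conv_expand h hm

lemma map_euler {R S : Type*} [CommRing R] [CommRing S] (f : R →+* S) (φ : R⟦X⟧) :
    PowerSeries.map f (euler φ) = euler (PowerSeries.map f φ) := by
  ext n; simp [coeff_euler]

lemma iconv_euler {φ : ℤ⟦X⟧} (h : IConv φ) : IConv (euler φ) := by
  rw [IConv, toC, map_euler]; exact conv_euler h

section
variable {φ ψ : ℤ⟦X⟧} {τ : ℂ}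

lemma val_add (h : IConv φ) (h' : IConv ψ) (hτ : 0 < τ.im) :
    val (φ + ψ) τ = val φ τ + val ψ τ := by
  rw [val, toC, map_add]; exact ev_add h h' (norm_nome_lt_one hτ)

lemma val_sub (h : IConv φ) (h' : IConv ψ) (hτ : 0 < τ.im) :
    val (φ - ψ) τ = val φ τ - val ψ τ := by
  rw [val, toC, map_sub]; exact ev_sub h h' (norm_nome_lt_one hτ)

lemma val_mul (h : IConv φ) (h' : IConv ψ) (hτ : 0 < τ.im) :
    val (φ * ψ) τ = val φ τ * val ψ τ := by
  rw [val, toC, map_mul]; exact ev_mul h h' (norm_nome_lt_one hτ)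

lemma val_pow (h : IConv φ) (hτ : 0 < τ.im) (n : ℕ) : val (φ ^ n) τ = val φ τ ^ n := by
  rw [val, toC, map_pow]; exact ev_pow h (norm_nome_lt_one hτ) n

lemma val_C (c : ℤ) (τ : ℂ) : val (C c) τ = c := by
  rw [val, toC, map_C, ev_C, eq_intCast]

@[simp] lemma val_one (τ : ℂ) : val 1 τ = 1 := by simp [val, toC]

@[simp] lemma val_X (τ : ℂ) : val X τ = nome τ := by simp [val, toC]

lemma val_expand (φ : ℤ⟦X⟧) {m : ℕ} (hm : m ≠ 0) (τ : ℂ) :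
    val (PowerSeries.expand m hm φ) τ = val φ (m * τ) := by
  rw [val, toC, map_expand, ev_expand, ← nome_nat_mul]; rfl

lemma val_add_intCast (φ : ℤ⟦X⟧) (τ : ℂ) (n : ℤ) : val φ (τ + n) = val φ τ := by
  rw [val, nome_add_intCast, val]

lemma ev_congr_of_nome {f g : ℂ⟦X⟧} (hf : Conv f) (hg : Conv g)
    (heq : ∀ τ : ℂ, 0 < τ.im → ev f (nome τ) = ev g (nome τ)) : f = g := by
  refine hf.ext_of_eventually hg ?_
  have hc : ∀ {k : ℂ⟦X⟧}, Conv k → ContinuousAt (ev k) 0 := fun hk =>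
    (hk.differentiableOn.differentiableAt (Metric.ball_mem_nhds 0 one_pos)).continuousAt
  refine (ContinuousAt.eventuallyEq_nhds_iff_eventuallyEq_nhdsNE (hc hf) (hc hg)).1 ?_
  filter_upwards [self_mem_nhdsWithin,
    mem_nhdsWithin_of_mem_nhds (Metric.ball_mem_nhds (0 : ℂ) one_pos)] with q h0 h1
  obtain ⟨τ, hτ, rfl⟩ := exists_nome_eq (by simpa using h0) (by simpa using h1)
  exact heq τ hτ

lemma IConv.ext (h : IConv φ) (h' : IConv ψ)
    (heq : ∀ τ : ℂ, 0 < τ.im → val φ τ = val ψ τ) : φ = ψ :=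
  toC_injective (ev_congr_of_nome h h' heq)

lemma hasDerivAt_nome (τ : ℂ) : HasDerivAt nome (nome τ * (2 * Real.pi * I)) τ := by
  have := ((hasDerivAt_id τ).const_mul (2 * Real.pi * I : ℂ)).cexp
  rw [mul_one] at this
  exact this

lemma IConv.hasDerivAt_val (h : IConv φ) (hτ : 0 < τ.im) :
    HasDerivAt (val φ) (2 * Real.pi * I * val (euler φ) τ) τ := by
  have := (Conv.hasDerivAt h (norm_nome_lt_one hτ)).comp τ (hasDerivAt_nome τ)
  refine this.congr_deriv ?_
  rw [val, show toC (euler φ) = euler (toC φ) from map_euler _ _, ← Conv.mul_deriv]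
  ring

end

lemma exists_norm_val_le {φ : ℤ⟦X⟧} (h : IConv φ) {c : ℝ} (hc : 0 < c) :
    ∃ B, 0 ≤ B ∧ ∀ τ : ℂ, c ≤ τ.im → ‖val φ τ‖ ≤ B := by
  set r := Real.exp (-(2 * Real.pi * c))
  have hr : r < 1 := by
    rw [Real.exp_lt_one_iff]; have := mul_pos Real.pi_pos hc; nlinarith
  have hr0 : 0 < r := Real.exp_pos _
  have hs := h (r : ℂ) (by simpa [abs_of_pos hr0] using hr)
  refine ⟨∑' n, ‖coeff n (toC φ) * (r : ℂ) ^ n‖, tsum_nonneg fun _ => norm_nonneg _,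
    fun τ hτ => tsum_of_norm_bounded hs.hasSum fun n => ?_⟩
  rw [norm_mul, norm_mul, norm_pow, norm_pow, Complex.norm_real, Real.norm_of_nonneg hr0.le]
  gcongr
  rw [norm_nome]
  have := Real.pi_pos
  exact Real.exp_le_exp.2 (by gcongr)

lemma im_fricke (τ : ℂ) : (-1 / (2 * τ)).im = τ.im / (2 * Complex.normSq τ) := by
  rw [neg_div, one_div, neg_im, Complex.inv_im, Complex.normSq_mul]
  norm_num
  ring

lemma fricke_im_pos {τ : ℂ} (h : 0 < τ.im) : 0 < (-1 / (2 * τ)).im := by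
  rw [im_fricke]
  have : 0 < Complex.normSq τ := Complex.normSq_pos.2 fun h0 => by simp [h0] at h
  positivity

/-- There are no nonzero forms of negative weight. -/
theorem eq_zero_of_neg_weight {φ : ℤ⟦X⟧} (h : IConv φ) {m : ℕ} (hm : m ≠ 0)
    (hW : ∀ τ : ℂ, 0 < τ.im → val φ τ = (-2 * τ ^ 2) ^ m * val φ (-1 / (2 * τ))) : φ = 0 := by
  obtain ⟨B, hB0, hB⟩ := exists_norm_val_le h (c := 2 / 5) (by norm_num)
  set M := B / (2 / 5) ^ m with hM
  have key : ∀ n : ℕ, ∀ τ : ℂ, 0 < τ.im → 2 / 5 * (82 / 100 : ℝ) ^ n ≤ τ.im →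
      ‖val φ τ‖ ≤ M * τ.im ^ m := by
    intro n
    induction n with
    | zero =>
      intro τ h0 hτ
      have hτ' : 2 / 5 ≤ τ.im := by simpa using hτ
      calc ‖val φ τ‖ ≤ B := hB τ hτ'
        _ = M * (2 / 5) ^ m := by rw [hM]; field_simp
        _ ≤ M * τ.im ^ m := by gcongr
    | succ n ih =>
      intro τ h0 hτ
      rcases le_or_gt (2 / 5) τ.im with h1 | h1
      · calc ‖val φ τ‖ ≤ B := hB τ h1
          _ = M * (2 / 5) ^ m := by rw [hM]; field_simp
          _ ≤ M * τ.im ^ m := by gcongr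
      set σ := τ + ((-round τ.re : ℤ) : ℂ) with hσ
      have hσim : σ.im = τ.im := by simp [hσ]
      have hσre : |σ.re| ≤ 1 / 2 := by
        have := abs_sub_round τ.re
        simpa [hσ, sub_eq_add_neg] using this
      have hsq : Complex.normSq σ ≤ 41 / 100 := by
        rw [Complex.normSq_apply, hσim]
        have := abs_le.1 hσre
        nlinarith
      have hsq0 : 0 < Complex.normSq σ :=
        Complex.normSq_pos.2 fun h => by rw [h] at hσim; simp at hσim; linarith
      have hW1 := hW σ (by rwa [hσim])
      have him := im_fricke σ
      have hpos := fricke_im_pos (τ := σ) (by rwa [hσim])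
      have hih := ih (-1 / (2 * σ)) hpos (by
        rw [him, hσim, le_div_iff₀ (by positivity)]
        have : (0 : ℝ) < (82 / 100) ^ n := by positivity
        rw [pow_succ] at hτ
        nlinarith)
      rw [← val_add_intCast φ τ (-round τ.re), ← hσ, hW1, norm_mul, norm_pow, norm_mul, norm_pow]
      calc (‖(-2 : ℂ)‖ * ‖σ‖ ^ 2) ^ m * ‖val φ (-1 / (2 * σ))‖
          ≤ (‖(-2 : ℂ)‖ * ‖σ‖ ^ 2) ^ m * (M * (-1 / (2 * σ)).im ^ m) := by gcongr
        _ = M * τ.im ^ m := by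
          rw [him, hσim, ← Complex.normSq_eq_norm_sq, div_pow, mul_comm M, mul_comm M, ← mul_assoc]
          congr 1
          simp only [norm_neg, Complex.norm_ofNat]
          field_simp
  have key' : ∀ τ : ℂ, 0 < τ.im → ‖val φ τ‖ ≤ M * τ.im ^ m := by
    intro τ hτ
    obtain ⟨n, hn⟩ := exists_pow_lt_of_lt_one (show 0 < τ.im by exact hτ)
      (show (82 / 100 : ℝ) < 1 by norm_num)
    refine key n τ hτ ?_
    have : (0 : ℝ) < (82 / 100) ^ n := by positivity
    nlinarith
  have hzero : ∀ q : ℂ, ‖q‖ < 1 → ev (toC φ) q = 0 := by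
    intro q hq
    have hbound : ∀ r : ℝ, ‖q‖ < r → r < 1 →
        ‖ev (toC φ) q‖ ≤ M * (-Real.log r / (2 * Real.pi)) ^ m := by
      intro r hqr hr1
      have hr0 : 0 < r := (norm_nonneg q).trans_lt hqr
      refine Complex.norm_le_of_forall_mem_frontier_norm_le (U := Metric.ball 0 r)
        Metric.isBounded_ball ?_ (fun z hz => ?_) (subset_closure (by simpa using hqr))
      · refine (h.differentiableOn.mono ?_).diffContOnCl
        rw [closure_ball _ hr0.ne']
        exact Metric.closedBall_subset_ball hr1
      · rw [frontier_ball _ hr0.ne', mem_sphere_zero_iff_norm] at hz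
        obtain ⟨τ, hτ, rfl⟩ := exists_nome_eq (q := z)
          (fun h0 => by rw [h0, norm_zero] at hz; exact hr0.ne hz) (by rw [hz]; exact hr1)
        have : -Real.log r / (2 * Real.pi) = τ.im := by
          rw [← hz, norm_nome, Real.log_exp]
          have := Real.pi_pos
          field_simp
        rw [this]
        exact key' τ hτ
    have hlim : Tendsto (fun r : ℝ => M * (-Real.log r / (2 * Real.pi)) ^ m) (𝓝[<] 1) (𝓝 0) := by
      have hc : ContinuousAt (fun r : ℝ => M * (-Real.log r / (2 * Real.pi)) ^ m) 1 := by
        have : ContinuousAt Real.log 1 := Real.continuousAt_log one_ne_zero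
        fun_prop
      have := hc.tendsto
      simp only [Real.log_one, neg_zero, zero_div, zero_pow hm, mul_zero] at this
      exact this.mono_left nhdsWithin_le_nhds
    have := ge_of_tendsto hlim (b := ‖ev (toC φ) q‖) (by
      filter_upwards [Ioo_mem_nhdsLT hq] with r hr using hbound r hr.1 hr.2)
    simpa using this
  refine toC_injective ?_
  rw [show toC 0 = 0 from map_zero _]
  exact Conv.ext h conv_zero fun q hq => by rw [hzero q hq, ev_zero_left]

/-- Weight-`k` covariance under the Fricke involution `τ ↦ -1/(2τ)`. -/
structure IsForm (k : ℕ) (φ : ℤ⟦X⟧) : Prop where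
  conv : IConv φ
  fricke : ∀ τ : ℂ, 0 < τ.im → val φ (-1 / (2 * τ)) = (-2 * τ ^ 2) ^ k * val φ τ

lemma IsForm.add {k : ℕ} {φ ψ : ℤ⟦X⟧} (h : IsForm k φ) (h' : IsForm k ψ) : IsForm k (φ + ψ) :=
  ⟨h.conv.add h'.conv, fun τ hτ => by
    rw [val_add h.conv h'.conv hτ, val_add h.conv h'.conv (fricke_im_pos hτ), h.fricke τ hτ,
      h'.fricke τ hτ, mul_add]⟩

lemma IsForm.sub {k : ℕ} {φ ψ : ℤ⟦X⟧} (h : IsForm k φ) (h' : IsForm k ψ) : IsForm k (φ - ψ) :=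
  ⟨h.conv.sub h'.conv, fun τ hτ => by
    rw [val_sub h.conv h'.conv hτ, val_sub h.conv h'.conv (fricke_im_pos hτ), h.fricke τ hτ,
      h'.fricke τ hτ, mul_sub]⟩

lemma IsForm.mul {k l : ℕ} {φ ψ : ℤ⟦X⟧} (h : IsForm k φ) (h' : IsForm l ψ) :
    IsForm (k + l) (φ * ψ) :=
  ⟨h.conv.mul h'.conv, fun τ hτ => by
    rw [val_mul h.conv h'.conv hτ, val_mul h.conv h'.conv (fricke_im_pos hτ), h.fricke τ hτ,
      h'.fricke τ hτ, pow_add]; ring⟩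

lemma isForm_C (c : ℤ) : IsForm 0 (C c) := ⟨iconv_C c, fun τ _ => by rw [val_C, val_C, pow_zero, one_mul]⟩

lemma IsForm.C_mul {k : ℕ} {φ : ℤ⟦X⟧} (h : IsForm k φ) (c : ℤ) : IsForm k (C c * φ) := by
  simpa using (isForm_C c).mul h

lemma IsForm.pow {k : ℕ} {φ : ℤ⟦X⟧} (h : IsForm k φ) (n : ℕ) : IsForm (n * k) (φ ^ n) := by
  induction n with
  | zero => simpa using isForm_C 1
  | succ n ih => rw [pow_succ, Nat.succ_mul]; exact ih.mul h

end QuarticHypergeometric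

namespace QuarticHypergeometric

open PowerSeries Complex Filter Topology

/-- The `q`-expansion of the Eisenstein series `E₂`. -/
noncomputable def e2Series : ℤ⟦X⟧ :=
  mk fun n => if n = 0 then 1 else -24 * (ArithmeticFunction.sigma 1 n : ℤ)

lemma iconv_e2Series : IConv e2Series := by
  have hσ : Conv (mk fun n => (ArithmeticFunction.sigma 1 n : ℂ)) := by
    refine conv_of_le conv_geom 2 fun n => ?_
    simp only [coeff_mk, norm_one, mul_one, Complex.norm_natCast]
    exact_mod_cast ArithmeticFunction.sigma_le_pow_succ 1 n
  have h := conv_one.sub ((conv_C 24).mul hσ)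
  refine (congrArg Conv (PowerSeries.ext fun n => ?_)).mp h
  rcases eq_or_ne n 0 with rfl | hn
  · simp [e2Series]
  · simp [e2Series, hn, coeff_one]

lemma val_e2Series (z : UpperHalfPlane) : val e2Series z = EisensteinSeries.E2 z := by
  refine (HasSum.tsum_eq ?_)
  have := EisensteinSeries.hasSum_qExpansion_E2 (z := z)
  convert this using 2 with n
  · simp only [toC, coeff_map, e2Series, coeff_mk, smul_eq_mul, nome]
    split_ifs <;> simp

lemma val_e2Series_mobius {a b c d : ℤ} (h : a * d - b * c = 1) {τ : ℂ} (hτ : 0 < τ.im) :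
    val e2Series ((a * τ + b) / (c * τ + d)) =
      (c * τ + d) ^ 2 * val e2Series τ + 6 * c / (Real.pi * I) * (c * τ + d) := by
  set z : UpperHalfPlane := ⟨τ, hτ⟩ with hz
  set g : Matrix.SpecialLinearGroup (Fin 2) ℤ :=
    ⟨!![a, b; c, d], by rw [Matrix.det_fin_two_of]; exact h⟩ with hg
  have h1 := congrFun (EisensteinSeries.E2_slash_action g) z
  have hgz : ((g • z : UpperHalfPlane) : ℂ) = (a * τ + b) / (c * τ + d) := by
    rw [UpperHalfPlane.specialLinearGroup_apply]
    simp [hg, hz]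
  have hden : UpperHalfPlane.denom g z = c * τ + d := by
    rw [ModularGroup.denom_apply]; simp [hg, hz]
  have hden0 : (c * τ + d : ℂ) ≠ 0 := by
    rw [← hden]; exact UpperHalfPlane.denom_ne_zero _ _
  rw [ModularForm.SL_slash_apply, ← val_e2Series, hgz, hden, Pi.sub_apply, Pi.smul_apply,
    ← val_e2Series, EisensteinSeries.D2, hden, riemannZeta_two] at h1
  have hzτ : (z : ℂ) = τ := rfl
  rw [hzτ] at h1
  have hc : ((g 1 0 : ℤ) : ℂ) = c := by simp [hg]
  rw [hc, zpow_neg, ← div_eq_mul_inv, div_eq_iff (zpow_ne_zero _ hden0)] at h1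
  rw [h1]
  have hpi : (Real.pi : ℂ) ≠ 0 := by exact_mod_cast Real.pi_ne_zero
  have hI : (I : ℂ) ≠ 0 := I_ne_zero
  rw [smul_eq_mul]
  field_simp
  linear_combination (-6 * c) * Complex.I_sq

/-- The weight-2 Eisenstein series `2 E₂(2τ) - E₂(τ)` of level `Γ₀(2)`. -/
noncomputable def theta : ℤ⟦X⟧ := C 2 * PowerSeries.expand 2 two_ne_zero e2Series - e2Series

lemma iconv_theta : IConv theta :=
  ((iconv_C 2).mul (iconv_e2Series.expand two_ne_zero)).sub iconv_e2Series

lemma constantCoeff_theta : constantCoeff theta = 1 := by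
  rw [theta, map_sub, map_mul, constantCoeff_expand, constantCoeff_C]
  simp [e2Series]

lemma two_mul_im_pos {τ : ℂ} (hτ : 0 < τ.im) : 0 < (2 * τ).im := by simpa using hτ

lemma val_theta {τ : ℂ} (hτ : 0 < τ.im) :
    val theta τ = 2 * val e2Series (2 * τ) - val e2Series τ := by
  have h2 := iconv_e2Series.expand two_ne_zero
  rw [theta, val_sub ((iconv_C 2).mul h2) iconv_e2Series hτ, val_mul (iconv_C 2) h2 hτ, val_C,
    val_expand]
  norm_num

/-- Covariance of `theta` under all Atkin-Lehner matrices of determinant 2. -/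
lemma val_theta_atkinLehner {a b c d : ℤ} (h : 2 * a * d - b * c = 1) {τ σ : ℂ} (hσ : 0 < σ.im)
    (hτ : 0 < τ.im) (hτσ : τ = (2 * a * σ + b) / (2 * (c * σ + d))) :
    val theta τ = -2 * (c * σ + d) ^ 2 * val theta σ := by
  have h1 := val_e2Series_mobius (a := a) (b := b) (c := c) (d := 2 * d) (by linarith)
    (two_mul_im_pos hσ)
  have h2 := val_e2Series_mobius (a := 2 * a) (b := b) (c := c) (d := d) h hσ
  have e1 : (a * (2 * σ) + b) / (c * (2 * σ) + (2 * d : ℤ)) = τ := by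
    rw [hτσ]; push_cast; ring_nf
  have e2 : ((2 * a : ℤ) * σ + b) / (c * σ + d) = 2 * τ := by
    rw [hτσ]; push_cast; rw [← mul_div_assoc, mul_div_mul_left _ _ two_ne_zero]
  rw [e1] at h1
  rw [e2] at h2
  rw [val_theta hτ, val_theta hσ, h1, h2]
  push_cast
  ring

lemma isForm_theta : IsForm 1 theta :=
  ⟨iconv_theta, fun τ hτ => by
    rw [val_theta_atkinLehner (a := 0) (b := -1) (c := 1) (d := 0) (by norm_num) hτ
      (fricke_im_pos hτ) (by push_cast; ring_nf)]
    push_cast; ring⟩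

end QuarticHypergeometric

namespace QuarticHypergeometric

open PowerSeries Complex Filter Topology

/-- The weighted `ℓ¹`-norm of the coefficients of a power series. -/
noncomputable def absSum (φ : ℂ⟦X⟧) (r : ℝ) : ℝ := ∑' n, ‖coeff n φ‖ * r ^ n

lemma Conv.summable_abs {φ : ℂ⟦X⟧} (h : Conv φ) {r : ℝ} (h0 : 0 ≤ r) (h1 : r < 1) :
    Summable fun n => ‖coeff n φ‖ * r ^ n := by
  simpa [abs_of_nonneg h0] using h (r : ℂ) (by simpa [abs_of_nonneg h0] using h1)

lemma absSum_nonneg (φ : ℂ⟦X⟧) {r : ℝ} (h0 : 0 ≤ r) : 0 ≤ absSum φ r :=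
  tsum_nonneg fun _ => by positivity

lemma absSum_mul_le {φ ψ : ℂ⟦X⟧} (h : Conv φ) (h' : Conv ψ) {r : ℝ} (h0 : 0 ≤ r) (h1 : r < 1) :
    absSum (φ * ψ) r ≤ absSum φ r * absSum ψ r := by
  have e : ∀ {k : ℂ⟦X⟧}, Conv k → Summable fun n => ‖‖coeff n k‖ * r ^ n‖ := fun hk =>
    (hk.summable_abs h0 h1).norm
  have hs := summable_norm_sum_mul_antidiagonal_of_summable_norm (e h) (e h')
  rw [absSum, absSum, absSum, tsum_mul_tsum_eq_tsum_sum_antidiagonal_of_summable_norm (e h) (e h')]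
  refine Summable.tsum_le_tsum (fun n => ?_) ((h.mul h').summable_abs h0 h1) hs.of_norm
  rw [coeff_mul]
  calc _ ≤ (∑ kl ∈ Finset.HasAntidiagonal.antidiagonal n, ‖coeff kl.1 φ * coeff kl.2 ψ‖) * r ^ n := by
        gcongr; exact norm_sum_le _ _
    _ = _ := by
        rw [Finset.sum_mul]
        refine Finset.sum_congr rfl fun kl hkl => ?_
        rw [← Finset.HasAntidiagonal.mem_antidiagonal.1 hkl, pow_add, norm_mul]; ring

lemma absSum_one_sub_X_pow_le {r : ℝ} (h0 : 0 ≤ r) (h1 : r < 1) (m : ℕ) :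
    absSum (1 - X ^ m) r ≤ 1 + r ^ m := by
  have h : ∀ n, ‖coeff n (1 - X ^ m : ℂ⟦X⟧)‖ * r ^ n ≤
      (if n = 0 then 1 else 0) + (if n = m then r ^ m else 0) := by
    intro n
    rw [map_sub, coeff_one, coeff_X_pow]
    have : 0 ≤ r ^ m := by positivity
    by_cases hn : n = 0 <;> by_cases hm : n = m <;> simp [hn, hm] <;> split_ifs <;>
      simp_all <;> positivity
  have s1 : HasSum (fun n : ℕ => if n = 0 then (1 : ℝ) else 0) 1 := hasSum_ite_eq 0 1
  have s2 : HasSum (fun n : ℕ => if n = m then r ^ m else 0) (r ^ m) := hasSum_ite_eq m _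
  have := ((conv_one.sub (conv_X.pow m)).summable_abs h0 h1).tsum_le_tsum h (s1.add s2).summable
  rwa [(s1.add s2).tsum_eq] at this

lemma conv_prod_one_sub (s : Finset ℕ) : Conv (∏ n ∈ s, (1 - X ^ (n + 1))) := by
  induction s using Finset.induction_on with
  | empty => simpa using conv_one
  | insert a s ha ih =>
    rw [Finset.prod_insert ha]
    exact (conv_one.sub (conv_X.pow _)).mul ih

lemma ev_prod_one_sub (s : Finset ℕ) {q : ℂ} (hq : ‖q‖ < 1) :
    ev (∏ n ∈ s, (1 - X ^ (n + 1))) q = ∏ n ∈ s, (1 - q ^ (n + 1)) := by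
  induction s using Finset.induction_on with
  | empty => simp
  | insert a s ha ih =>
    have h := conv_one.sub (conv_X.pow (a + 1))
    rw [Finset.prod_insert ha, Finset.prod_insert ha, ev_mul h (conv_prod_one_sub s) hq, ih,
      ev_sub conv_one (conv_X.pow _) hq, ev_pow conv_X hq, ev_one, ev_X]

lemma absSum_prod_one_sub_le {r : ℝ} (h0 : 0 ≤ r) (h1 : r < 1) (s : Finset ℕ) :
    absSum (∏ n ∈ s, (1 - X ^ (n + 1))) r ≤ Real.exp (∑ n ∈ s, r ^ (n + 1)) := by
  induction s using Finset.induction_on with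
  | empty =>
    have e : absSum 1 r = 1 := by
      rw [absSum, tsum_eq_single 0 fun n hn => by simp [coeff_one, hn]]
      simp
    simp [e]
  | insert a s ha ih =>
    rw [Finset.prod_insert ha, Finset.sum_insert ha, Real.exp_add]
    refine (absSum_mul_le (conv_one.sub (conv_X.pow _)) (conv_prod_one_sub s) h0 h1).trans ?_
    refine mul_le_mul ?_ ih (absSum_nonneg _ h0) (Real.exp_pos _).le
    refine (absSum_one_sub_X_pow_le h0 h1 _).trans ?_
    rw [add_comm]; exact Real.add_one_le_exp _

lemma iconv_pentagonalSeries : IConv (pentagonalSeries ℤ) := by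
  refine conv_of_le conv_geom 0 fun n => ?_
  simp only [toC, coeff_map, coeff_mk, pow_zero, one_mul, norm_one, pentagonalSeries]
  split_ifs with h
  · rcases Int.units_eq_one_or (Int.negOnePow h.choose) with h | h <;> rw [h] <;> simp
  · simp

/-- The pentagonal number theorem, analytically. -/
lemma ev_pentagonalSeries {q : ℂ} (hq : ‖q‖ < 1) :
    ev (toC (pentagonalSeries ℤ)) q = ∏' n, (1 - q ^ (n + 1)) := by
  obtain ⟨r, hqr, hr1⟩ := exists_between hq
  have hr0 : 0 < r := (norm_nonneg q).trans_lt hqr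
  have hgeo : Summable fun n : ℕ => r ^ (n + 1) :=
    (summable_nat_add_iff 1).2 (summable_geometric_of_lt_one hr0.le hr1)
  set B := Real.exp (∑' n : ℕ, r ^ (n + 1))
  have hbound : ∀ (s : Finset ℕ) (k : ℕ),
      ‖coeff k (∏ n ∈ s, (1 - X ^ (n + 1)) : ℂ⟦X⟧) * q ^ k‖ ≤ B * (‖q‖ / r) ^ k := by
    intro s k
    have h1 : ‖coeff k (∏ n ∈ s, (1 - X ^ (n + 1)) : ℂ⟦X⟧)‖ * r ^ k ≤ B :=
      calc _ ≤ absSum (∏ n ∈ s, (1 - X ^ (n + 1))) r :=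
            ((conv_prod_one_sub s).summable_abs hr0.le hr1).le_tsum k
              fun j _ => by positivity
        _ ≤ _ := absSum_prod_one_sub_le hr0.le hr1 s
        _ ≤ B := Real.exp_le_exp.2 (hgeo.sum_le_tsum s fun j _ => by positivity)
    rw [norm_mul, norm_pow]
    calc _ = (‖coeff k (∏ n ∈ s, (1 - X ^ (n + 1)) : ℂ⟦X⟧)‖ * r ^ k) * (‖q‖ / r) ^ k := by
          rw [div_pow]; field_simp
      _ ≤ _ := by gcongr
  have hlim : Tendsto (fun s : Finset ℕ => ev (∏ n ∈ s, (1 - X ^ (n + 1))) q) atTop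
      (𝓝 (ev (toC (pentagonalSeries ℤ)) q)) := by
    refine tendsto_tsum_of_dominated_convergence (bound := fun k => B * (‖q‖ / r) ^ k)
      ((summable_geometric_of_lt_one (by positivity) ((div_lt_one hr0).2 hqr)).mul_left B)
      (fun k => ?_) (Eventually.of_forall fun s k => hbound s k)
    refine tendsto_const_nhds.congr' ?_
    filter_upwards [coeff_prod_one_sub_X_pow_eventually_eq ℤ k] with s hs
    rw [toC, coeff_map, ← hs, ← coeff_map, map_prod]
    simp
  refine tendsto_nhds_unique hlim ?_
  simp only [ev_prod_one_sub _ hq]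
  exact (ModularForm.multipliable_one_sub_pow hq).hasProd

lemma val_pentagonalSeries {τ : ℂ} (hτ : 0 < τ.im) :
    val (pentagonalSeries ℤ) τ = ∏' n, (1 - ModularForm.eta_q n τ) := by
  rw [val, ev_pentagonalSeries (norm_nome_lt_one hτ)]
  simp only [ModularForm.eta_q_eq_pow]
  rfl

/-- The product `∏ (1 - q^n)⁸ (1 - q^(2n))⁸`. -/
noncomputable def deltaUnit : ℤ⟦X⟧ :=
  (pentagonalSeries ℤ * PowerSeries.expand 2 two_ne_zero (pentagonalSeries ℤ)) ^ 8

/-- The `q`-expansion of `(η(τ)η(2τ))⁸`. -/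
noncomputable def delta : ℤ⟦X⟧ := X * deltaUnit

lemma iconv_deltaUnit : IConv deltaUnit :=
  (iconv_pentagonalSeries.mul (iconv_pentagonalSeries.expand two_ne_zero)).pow 8

lemma iconv_delta : IConv delta := iconv_X.mul iconv_deltaUnit

lemma constantCoeff_deltaUnit : constantCoeff deltaUnit = 1 := by
  have h : constantCoeff (pentagonalSeries ℤ) = 1 := by
    simpa [pentagonal] using coeff_pentagonalSeries_pentagonal ℤ 0
  rw [deltaUnit, map_pow, map_mul, constantCoeff_expand, h]
  norm_num

lemma val_delta {τ : ℂ} (hτ : 0 < τ.im) :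
    val delta τ = ModularForm.eta τ ^ 8 * ModularForm.eta (2 * τ) ^ 8 := by
  have h := iconv_pentagonalSeries
  have h2 := h.expand two_ne_zero
  rw [delta, val_mul iconv_X iconv_deltaUnit hτ, val_X, deltaUnit, val_pow (h.mul h2) hτ,
    val_mul h h2 hτ, val_expand, Nat.cast_two, val_pentagonalSeries hτ,
    val_pentagonalSeries (two_mul_im_pos hτ), ModularForm.eta, ModularForm.eta]
  have : nome τ = Function.Periodic.qParam 24 τ ^ 8 * Function.Periodic.qParam 24 (2 * τ) ^ 8 := by
    simp only [Function.Periodic.qParam, nome, ← Complex.exp_nat_mul, ← Complex.exp_add]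
    congr 1
    push_cast
    ring
  rw [this]
  ring

lemma eta_neg_inv_pow_eight {τ : ℂ} (hτ : 0 < τ.im) :
    ModularForm.eta (-1 / τ) ^ 8 = τ ^ 4 * ModularForm.eta τ ^ 8 := by
  have hs : ∀ z : ℂ, Complex.sqrt z ^ 8 = z ^ 4 := fun z => by
    have : Complex.sqrt z ^ 2 = z := by
      simp only [Complex.sqrt, ← Complex.cpow_nat_mul]; norm_num
    rw [show 8 = 2 * 4 from rfl, pow_mul, this]
  have := ModularForm.eta_comp_eq_csqrt_I_inv hτ
  simp only [Function.comp, Pi.smul_apply, Pi.mul_apply, smul_eq_mul] at this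
  rw [this, mul_pow, mul_pow, inv_pow, hs, hs, Complex.I_pow_four]
  ring

lemma val_delta_ne_zero {τ : ℂ} (hτ : 0 < τ.im) : val delta τ ≠ 0 := by
  rw [val_delta hτ]
  exact mul_ne_zero (pow_ne_zero _ (ModularForm.eta_ne_zero hτ))
    (pow_ne_zero _ (ModularForm.eta_ne_zero (two_mul_im_pos hτ)))

lemma isForm_delta : IsForm 4 delta :=
  ⟨iconv_delta, fun τ hτ => by
    have h0 : τ ≠ 0 := fun h => by simp [h] at hτ
    rw [val_delta (fricke_im_pos hτ), val_delta hτ, eta_neg_inv_pow_eight (two_mul_im_pos hτ),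
      show 2 * (-1 / (2 * τ)) = -1 / τ by field_simp, eta_neg_inv_pow_eight hτ]
    ring⟩

/-- The inverse of `deltaUnit`. -/
noncomputable def deltaUnitInv : ℤ⟦X⟧ := PowerSeries.invOfUnit deltaUnit 1

lemma deltaUnit_mul_inv : deltaUnit * deltaUnitInv = 1 :=
  PowerSeries.mul_invOfUnit _ _ (by rw [constantCoeff_deltaUnit]; rfl)

lemma iconv_deltaUnitInv : IConv deltaUnitInv := by
  have hu := iconv_deltaUnit
  have hne : ∀ q : ℂ, ‖q‖ < 1 → ev (toC deltaUnit) q ≠ 0 := by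
    intro q hq
    rcases eq_or_ne q 0 with rfl | h0
    · rw [ev_zero, toC, ← coeff_zero_eq_constantCoeff_apply, coeff_map,
        coeff_zero_eq_constantCoeff_apply, constantCoeff_deltaUnit]
      simp
    · obtain ⟨τ, hτ, rfl⟩ := exists_nome_eq h0 hq
      have := val_delta_ne_zero hτ
      rw [delta, val_mul iconv_X hu hτ] at this
      exact right_ne_zero_of_mul this
  obtain ⟨φ, hφ, hev⟩ := exists_conv_of_differentiableOn
    (G := fun q => (ev (toC deltaUnit) q)⁻¹)
    (hu.differentiableOn.inv fun q hq => hne q (by simpa using hq))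
  have h1 : toC deltaUnit * φ = 1 := (Conv.mul hu hφ).ext conv_one fun q hq => by
    rw [ev_mul hu hφ hq, hev q hq, ev_one, mul_inv_cancel₀ (hne q hq)]
  have h2 : toC deltaUnit * toC deltaUnitInv = 1 := by
    rw [toC, toC, ← map_mul, deltaUnit_mul_inv, map_one]
  have : toC deltaUnitInv = φ := by
    calc toC deltaUnitInv = toC deltaUnitInv * (toC deltaUnit * φ) := by rw [h1, mul_one]
      _ = (toC deltaUnit * toC deltaUnitInv) * φ := by ring
      _ = φ := by rw [h2, one_mul]
  rw [IConv, this]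
  exact hφ

end QuarticHypergeometric

namespace QuarticHypergeometric

open PowerSeries Complex Filter Topology

lemma conv_of_X_mul {φ : ℂ⟦X⟧} (h : Conv (X * φ)) : Conv φ := by
  intro q hq
  obtain ⟨r, hqr, hr1⟩ := exists_between hq
  have hr0 : 0 < r := (norm_nonneg q).trans_lt hqr
  have hs := (summable_nat_add_iff 1).2 (h.summable_abs hr0.le hr1)
  simp only [coeff_succ_X_mul] at hs
  refine Summable.of_nonneg_of_le (fun _ => norm_nonneg _) (fun n => ?_) (hs.mul_right r⁻¹)
  rw [norm_mul, norm_pow, pow_succ, mul_assoc, mul_assoc, mul_inv_cancel₀ hr0.ne', mul_one]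
  gcongr

/-- A form with vanishing constant term is divisible by `delta`. -/
lemma IsForm.exists_delta_mul {k : ℕ} {φ : ℤ⟦X⟧} (h : IsForm k φ) (h0 : constantCoeff φ = 0) :
    ∃ ψ, IConv ψ ∧ φ = delta * ψ := by
  obtain ⟨χ, rfl⟩ := X_dvd_iff.2 h0
  have hχ : IConv χ := conv_of_X_mul (by
    have := h.conv; rwa [IConv, toC, map_mul, map_X] at this)
  refine ⟨deltaUnitInv * χ, iconv_deltaUnitInv.mul hχ, ?_⟩
  rw [delta]
  linear_combination (-X * χ) * deltaUnit_mul_inv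

lemma fricke_factor_ne_zero {τ : ℂ} (hτ : 0 < τ.im) : (-2 * τ ^ 2 : ℂ) ≠ 0 := by
  have h0 : τ ≠ 0 := fun h => by simp [h] at hτ
  simp [h0]

/-- Every form is a polynomial in `theta` and `delta`. -/
theorem IsForm.exists_coeffs {k : ℕ} {φ : ℤ⟦X⟧} (h : IsForm k φ) :
    ∃ c : ℕ → ℤ, φ = ∑ i ∈ Finset.range (k / 4 + 1), C (c i) * theta ^ (k - 4 * i) * delta ^ i := by
  induction k using Nat.strong_induction_on generalizing φ with
  | _ k ih =>
    have hth : IsForm k (theta ^ k) := by simpa using isForm_theta.pow k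
    have hψ := h.sub (hth.C_mul (constantCoeff φ))
    obtain ⟨ψ, hcψ, hψeq⟩ := hψ.exists_delta_mul (by
      rw [map_sub, map_mul, map_pow, constantCoeff_theta, constantCoeff_C]; ring)
    have hval : ∀ τ : ℂ, 0 < τ.im →
        (-2 * τ ^ 2) ^ 4 * val ψ (-1 / (2 * τ)) = (-2 * τ ^ 2) ^ k * val ψ τ := by
      intro τ hτ
      have h1 := hψ.fricke τ hτ
      rw [hψeq, val_mul iconv_delta hcψ hτ, val_mul iconv_delta hcψ (fricke_im_pos hτ),
        isForm_delta.fricke τ hτ] at h1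
      have h2 := val_delta_ne_zero hτ
      refine mul_left_cancel₀ h2 ?_
      linear_combination h1
    rcases lt_or_ge k 4 with hk | hk
    · have hzero : ψ = 0 := eq_zero_of_neg_weight hcψ (m := 4 - k) (by omega) fun τ hτ => by
        refine mul_left_cancel₀ (pow_ne_zero k (fricke_factor_ne_zero hτ)) ?_
        rw [← hval τ hτ, ← mul_assoc, ← pow_add, Nat.add_sub_cancel' hk.le]
      refine ⟨fun _ => constantCoeff φ, ?_⟩
      rw [hzero, mul_zero, sub_eq_zero] at hψeq
      rw [Nat.div_eq_of_lt hk]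
      simpa using hψeq
    · have hform : IsForm (k - 4) ψ := ⟨hcψ, fun τ hτ => by
        refine mul_left_cancel₀ (pow_ne_zero 4 (fricke_factor_ne_zero hτ)) ?_
        rw [hval τ hτ, ← mul_assoc, ← pow_add, Nat.add_sub_cancel' hk]⟩
      obtain ⟨c, hc⟩ := ih (k - 4) (by omega) hform
      obtain ⟨a, ha⟩ : ∃ a, a = constantCoeff φ := ⟨_, rfl⟩
      rw [← ha] at hψeq
      refine ⟨fun i => if i = 0 then a else c (i - 1), ?_⟩
      rw [Finset.sum_range_succ', show k / 4 = (k - 4) / 4 + 1 by omega, eq_add_of_sub_eq hψeq, hc,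
        Finset.mul_sum]
      congr 1
      · refine Finset.sum_congr rfl fun i _ => ?_
        beta_reduce
        rw [if_neg (show ¬ i + 1 = 0 by omega), Nat.add_sub_cancel, show k - 4 - 4 * i = k - 4 * (i + 1) by omega]
        ring
      · beta_reduce
        rw [if_pos rfl]; simp

end QuarticHypergeometric

namespace QuarticHypergeometric

open PowerSeries Complex Filter Topology

/-- The logarithmic derivative of `delta`. -/
noncomputable def logDeriv : ℤ⟦X⟧ := 1 + euler deltaUnit * deltaUnitInv

lemma iconv_logDeriv : IConv logDeriv :=
  iconv_one.add ((iconv_euler iconv_deltaUnit).mul iconv_deltaUnitInv)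

lemma delta_mul_logDeriv : delta * logDeriv = euler delta := by
  rw [delta, euler_mul, euler_X, logDeriv]
  linear_combination (X * euler deltaUnit) * deltaUnit_mul_inv

lemma hasDerivAt_fricke {τ : ℂ} (hτ : τ ≠ 0) :
    HasDerivAt (fun z : ℂ => -1 / (2 * z)) (1 / (2 * τ ^ 2)) τ := by
  have := ((hasDerivAt_id τ).const_mul (2 : ℂ)).inv (by simpa using hτ)
  refine (this.const_mul (-1 : ℂ)).congr_deriv ?_ |>.congr_of_eventuallyEq ?_
  · simp only [id]; field_simp
  · filter_upwards with z
    simp [div_eq_mul_inv]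

lemma ne_zero_of_im_pos {τ : ℂ} (hτ : 0 < τ.im) : τ ≠ 0 := fun h => by simp [h] at hτ

lemma eventually_im_pos {τ : ℂ} (hτ : 0 < τ.im) : ∀ᶠ z : ℂ in 𝓝 τ, 0 < z.im :=
  (isOpen_lt continuous_const Complex.continuous_im).mem_nhds hτ

/-- Differentiating a transformation law under the Fricke involution. -/
lemma val_euler_fricke {φ : ℤ⟦X⟧} (hφ : IConv φ) {g : ℂ → ℂ} {g' τ : ℂ} (hτ : 0 < τ.im)
    (hg : ∀ z : ℂ, 0 < z.im → val φ (-1 / (2 * z)) = g z) (hg' : HasDerivAt g g' τ) :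
    val (euler φ) (-1 / (2 * τ)) = 2 * τ ^ 2 * (g' / (2 * Real.pi * I)) := by
  have hτ0 := ne_zero_of_im_pos hτ
  have h1 := (hφ.hasDerivAt_val (fricke_im_pos hτ)).comp τ (hasDerivAt_fricke hτ0)
  have h2 : HasDerivAt g (2 * Real.pi * I * val (euler φ) (-1 / (2 * τ)) * (1 / (2 * τ ^ 2))) τ := by
    refine h1.congr_of_eventuallyEq ?_
    filter_upwards [eventually_im_pos hτ] with z hz using (hg z hz).symm
  rw [hg'.unique h2]
  have hpi : (Real.pi : ℂ) ≠ 0 := by exact_mod_cast Real.pi_ne_zero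
  field_simp

lemma IsForm.val_euler_fricke {k : ℕ} {φ : ℤ⟦X⟧} (h : IsForm k φ) {τ : ℂ} (hτ : 0 < τ.im) :
    val (euler φ) (-1 / (2 * τ)) = (-2 * τ ^ 2) ^ k *
      (2 * τ ^ 2 * val (euler φ) τ + 2 * k * τ / (Real.pi * I) * val φ τ) := by
  have hτ0 := ne_zero_of_im_pos hτ
  have hpi : (Real.pi : ℂ) ≠ 0 := by exact_mod_cast Real.pi_ne_zero
  have hd := ((((hasDerivAt_id τ).pow 2).const_mul (-2 : ℂ)).pow k).mul (h.conv.hasDerivAt_val hτ)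
  rw [QuarticHypergeometric.val_euler_fricke h.conv hτ h.fricke hd]
  rcases k with _ | k
  · simp
  · simp only [id, Pi.pow_apply, Nat.add_sub_cancel]
    push_cast
    field_simp
    ring

lemma logDeriv_fricke {τ : ℂ} (hτ : 0 < τ.im) :
    val logDeriv (-1 / (2 * τ)) = 2 * τ ^ 2 * val logDeriv τ + 8 * τ / (Real.pi * I) := by
  have h1 := isForm_delta.val_euler_fricke hτ
  rw [← delta_mul_logDeriv, val_mul iconv_delta iconv_logDeriv hτ,
    val_mul iconv_delta iconv_logDeriv (fricke_im_pos hτ), isForm_delta.fricke τ hτ] at h1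
  refine mul_left_cancel₀ (mul_ne_zero (pow_ne_zero 4 (fricke_factor_ne_zero hτ))
    (val_delta_ne_zero hτ)) (h1.trans ?_)
  push_cast
  ring

lemma isForm_logDeriv_sq_sub : IsForm 2 (logDeriv ^ 2 - C 8 * euler logDeriv) := by
  have hc := iconv_logDeriv
  have he := iconv_euler hc
  have hpi : (Real.pi : ℂ) ≠ 0 := by exact_mod_cast Real.pi_ne_zero
  refine ⟨(hc.pow 2).sub ((iconv_C 8).mul he), fun τ hτ => ?_⟩
  have hf := fricke_im_pos hτ
  have hd : HasDerivAt (fun z : ℂ => 2 * z ^ 2 * val logDeriv z + 8 * z / (Real.pi * I))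
      (4 * τ * val logDeriv τ + 2 * τ ^ 2 * (2 * Real.pi * I * val (euler logDeriv) τ)
        + 8 / (Real.pi * I)) τ := by
    have := ((((hasDerivAt_id τ).pow 2).const_mul (2 : ℂ)).mul (hc.hasDerivAt_val hτ)).add
      (((hasDerivAt_id τ).const_mul (8 : ℂ)).div_const (Real.pi * I))
    refine this.congr_deriv ?_
    simp only [id, Pi.pow_apply]
    ring
  rw [val_sub (hc.pow 2) ((iconv_C 8).mul he) hτ, val_sub (hc.pow 2) ((iconv_C 8).mul he) hf,
    val_mul (iconv_C 8) he hτ, val_mul (iconv_C 8) he hf, val_pow hc hτ, val_pow hc hf, val_C, val_C,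
    logDeriv_fricke hτ, val_euler_fricke hc hτ (fun z hz => logDeriv_fricke hz) hd]
  push_cast
  field_simp
  ring

/-- The Serre derivative of `theta`, up to a factor. -/
noncomputable def kappa : ℤ⟦X⟧ := theta * logDeriv - C 4 * euler theta

lemma iconv_kappa : IConv kappa :=
  (iconv_theta.mul iconv_logDeriv).sub ((iconv_C 4).mul (iconv_euler iconv_theta))

lemma isForm_kappa_sq : IsForm 4 (kappa ^ 2) := by
  have hc := iconv_logDeriv
  have he := iconv_euler iconv_theta
  have hpi : (Real.pi : ℂ) ≠ 0 := by exact_mod_cast Real.pi_ne_zero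
  refine ⟨iconv_kappa.pow 2, fun τ hτ => ?_⟩
  have hf := fricke_im_pos hτ
  have h : ∀ {z : ℂ}, 0 < z.im →
      val kappa z = val theta z * val logDeriv z - 4 * val (euler theta) z := by
    intro z hz
    rw [kappa, val_sub (iconv_theta.mul hc) ((iconv_C 4).mul he) hz, val_mul iconv_theta hc hz,
      val_mul (iconv_C 4) he hz, val_C]
    push_cast; rfl
  rw [val_pow iconv_kappa hτ, val_pow iconv_kappa hf, h hτ, h hf, logDeriv_fricke hτ,
    isForm_theta.fricke τ hτ, isForm_theta.val_euler_fricke hτ]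
  push_cast
  ring

lemma constantCoeff_euler {R : Type*} [CommRing R] (φ : R⟦X⟧) : constantCoeff (euler φ) = 0 := by
  rw [← coeff_zero_eq_constantCoeff_apply, coeff_euler]; simp

lemma coeff_one_euler {R : Type*} [CommRing R] (φ : R⟦X⟧) : coeff 1 (euler φ) = coeff 1 φ := by
  rw [coeff_euler]; simp

lemma coeff_one_mul' {R : Type*} [CommRing R] (φ ψ : R⟦X⟧) :
    coeff 1 (φ * ψ) = constantCoeff φ * coeff 1 ψ + coeff 1 φ * constantCoeff ψ := by
  rw [coeff_mul, Finset.Nat.antidiagonal_succ]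
  simp

lemma coeff_one_theta : coeff 1 theta = 24 := by
  rw [theta, map_sub, ← smul_eq_C_mul, map_smul, coeff_expand_of_not_dvd _ _ _ (by norm_num)]
  simp [e2Series]

lemma constantCoeff_delta : constantCoeff delta = 0 := by rw [delta]; simp

lemma coeff_one_delta : coeff 1 delta = 1 := by
  rw [delta, coeff_one_mul']; simp [constantCoeff_deltaUnit]

lemma constantCoeff_logDeriv : constantCoeff logDeriv = 1 := by
  simp [logDeriv, constantCoeff_euler]

lemma constantCoeff_kappa : constantCoeff kappa = 1 := by
  simp [kappa, constantCoeff_euler, constantCoeff_theta, constantCoeff_logDeriv]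

lemma logDeriv_sq_sub : logDeriv ^ 2 - 8 * euler logDeriv = theta ^ 2 := by
  obtain ⟨c, hc⟩ := isForm_logDeriv_sq_sub.exists_coeffs
  simp only [Nat.reduceDiv, zero_add, Finset.sum_range_one, mul_zero, Nat.sub_zero, pow_zero,
    mul_one] at hc
  have h0 := congrArg constantCoeff hc
  simp [constantCoeff_logDeriv, constantCoeff_euler, constantCoeff_theta] at h0
  rw [← h0] at hc
  simpa using hc

lemma coeff_one_logDeriv : coeff 1 logDeriv = -8 := by
  have h := congrArg (coeff 1) logDeriv_sq_sub
  rw [show (8 : ℤ⟦X⟧) = C 8 by simp, map_sub, sq, sq, coeff_one_mul', coeff_one_mul',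
    coeff_one_mul', coeff_one_euler, coeff_one_theta, constantCoeff_logDeriv,
    constantCoeff_theta, constantCoeff_euler, constantCoeff_C] at h
  omega

lemma coeff_one_kappa : coeff 1 kappa = -80 := by
  rw [kappa, map_sub, coeff_one_mul', coeff_one_mul', coeff_one_logDeriv, coeff_one_theta,
    coeff_one_euler, coeff_one_theta, constantCoeff_C, constantCoeff_euler, constantCoeff_theta,
    constantCoeff_logDeriv]
  norm_num

lemma kappa_sq : kappa ^ 2 = theta ^ 4 - 256 * delta := by
  obtain ⟨c, hc⟩ := isForm_kappa_sq.exists_coeffs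
  simp only [Nat.reduceDiv, Nat.reduceAdd, Finset.sum_range_succ, Finset.range_zero,
    Finset.sum_empty, zero_add, mul_zero, Nat.sub_zero, pow_zero, mul_one, Nat.sub_self, pow_one] at hc
  have h0 := congrArg constantCoeff hc
  have h1 := congrArg (coeff 1) hc
  simp [constantCoeff_kappa, constantCoeff_theta, constantCoeff_delta] at h0
  have h4 : theta ^ 4 = (theta * theta) * (theta * theta) := by ring
  rw [h4, sq] at h1
  simp only [map_add, coeff_one_mul', coeff_one_kappa, coeff_one_theta, coeff_one_delta,
    constantCoeff_kappa, constantCoeff_theta, constantCoeff_delta, constantCoeff_C, map_mul,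
    coeff_C, ← h0] at h1
  norm_num at h1
  have h2 : c 1 = -256 := by linarith
  rw [h2, ← h0] at hc
  simp only [map_one, map_neg, map_ofNat] at hc
  linear_combination hc

end QuarticHypergeometric

namespace QuarticHypergeometric

open PowerSeries Complex Filter Topology

noncomputable def thetaInv : ℤ⟦X⟧ := PowerSeries.invOfUnit theta 1

noncomputable def kappaInv : ℤ⟦X⟧ := PowerSeries.invOfUnit kappa 1

lemma theta_mul_inv : theta * thetaInv = 1 :=
  PowerSeries.mul_invOfUnit _ _ (by rw [constantCoeff_theta]; rfl)

lemma kappa_mul_inv : kappa * kappaInv = 1 :=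
  PowerSeries.mul_invOfUnit _ _ (by rw [constantCoeff_kappa]; rfl)

/-- The Hauptmodul `delta / theta ^ 4`. -/
noncomputable def hauptmodul : ℤ⟦X⟧ := delta * thetaInv ^ 4

lemma hauptmodul_mul : hauptmodul * theta ^ 4 = delta := by
  have h : (theta * thetaInv) ^ 4 = 1 := by rw [theta_mul_inv, one_pow]
  rw [hauptmodul]
  linear_combination delta * h

lemma constantCoeff_thetaInv : constantCoeff thetaInv = 1 := by
  simpa [constantCoeff_theta] using congrArg constantCoeff theta_mul_inv

lemma constantCoeff_kappaInv : constantCoeff kappaInv = 1 := by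
  simpa [constantCoeff_kappa] using congrArg constantCoeff kappa_mul_inv

lemma constantCoeff_hauptmodul : constantCoeff hauptmodul = 0 := by
  simp [hauptmodul, constantCoeff_delta]

lemma coeff_one_hauptmodul : coeff 1 hauptmodul = 1 := by
  rw [hauptmodul, coeff_one_mul']
  simp [constantCoeff_delta, coeff_one_delta, constantCoeff_thetaInv]

/-- The derivation `t d/dt`, where `t` is the Hauptmodul. -/
noncomputable def dlog (φ : ℤ⟦X⟧) : ℤ⟦X⟧ := theta * kappaInv * euler φ

lemma dlog_add (φ ψ : ℤ⟦X⟧) : dlog (φ + ψ) = dlog φ + dlog ψ := by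
  rw [dlog, euler_add]; simp only [dlog]; ring

lemma dlog_sub (φ ψ : ℤ⟦X⟧) : dlog (φ - ψ) = dlog φ - dlog ψ := by
  rw [dlog, euler_sub]; simp only [dlog]; ring

lemma dlog_mul (φ ψ : ℤ⟦X⟧) : dlog (φ * ψ) = φ * dlog ψ + ψ * dlog φ := by
  rw [dlog, euler_mul]; simp only [dlog]; ring

lemma dlog_C (c : ℤ) : dlog (C c) = 0 := by rw [dlog, euler_C, mul_zero]

lemma dlog_ofNat (n : ℕ) [n.AtLeastTwo] : dlog (ofNat(n) : ℤ⟦X⟧) = 0 := by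
  rw [← map_ofNat C n, dlog_C]

lemma dlog_one : dlog 1 = 0 := by rw [← map_one C, dlog_C]

lemma dlog_pow (φ : ℤ⟦X⟧) (n : ℕ) : dlog (φ ^ n) = n * φ ^ (n - 1) * dlog φ := by
  rw [dlog, euler_pow]; simp only [dlog]; ring

lemma natCast_ne_zero {n : ℕ} (hn : n ≠ 0) : (n : ℤ⟦X⟧) ≠ 0 := fun h => by
  have h' := congrArg constantCoeff h
  rw [map_natCast, map_zero] at h'
  exact hn (by exact_mod_cast h')

lemma theta_ne_zero : theta ≠ 0 := fun h => by simpa [h] using constantCoeff_theta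

lemma euler_hauptmodul : theta * euler hauptmodul = hauptmodul * kappa := by
  have h := congrArg euler hauptmodul_mul
  rw [euler_mul, euler_pow, ← delta_mul_logDeriv, ← hauptmodul_mul] at h
  refine mul_left_cancel₀ (pow_ne_zero 3 theta_ne_zero) ?_
  rw [kappa, show (C 4 : ℤ⟦X⟧) = 4 from map_ofNat C 4]
  push_cast at h
  linear_combination h

lemma dlog_hauptmodul : dlog hauptmodul = hauptmodul := by
  rw [dlog]
  linear_combination kappaInv * euler_hauptmodul + hauptmodul * kappa_mul_inv

/-- The Picard–Fuchs operator. -/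
noncomputable def picardFuchs (φ : ℤ⟦X⟧) : ℤ⟦X⟧ :=
  dlog (dlog (dlog φ)) - 8 * hauptmodul *
    (32 * dlog (dlog (dlog φ)) + 48 * dlog (dlog φ) + 22 * dlog φ + 3 * φ)

lemma kappa_sq' : kappa ^ 2 = theta ^ 4 * (1 - 256 * hauptmodul) := by
  rw [kappa_sq]; linear_combination 256 * hauptmodul_mul

lemma picardFuchs_theta : picardFuchs theta = 0 := by
  have hy : theta ≠ 0 := theta_ne_zero
  have hyi := theta_mul_inv
  have hKi := kappa_mul_inv
  have hK2 := kappa_sq'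
  have hQ := logDeriv_sq_sub
  obtain ⟨S, hS⟩ : ∃ S, S = kappa * thetaInv ^ 2 := ⟨_, rfl⟩
  have hSK : kappa = S * theta ^ 2 := by
    have : (theta * thetaInv) ^ 2 = 1 := by rw [hyi, one_pow]
    rw [hS]; linear_combination (-kappa) * this
  have hS2 : S ^ 2 = 1 - 256 * hauptmodul := by
    refine mul_left_cancel₀ (pow_ne_zero 4 hy) ?_
    rw [← hK2, hSK]; ring
  have hD : ∀ φ, euler φ = S * theta * dlog φ := by
    intro φ
    refine mul_left_cancel₀ hy ?_
    rw [dlog]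
    linear_combination (-theta * euler φ) * hKi + kappaInv * theta * euler φ * hSK
  have hP : logDeriv = S * (4 * dlog theta + theta) := by
    refine mul_left_cancel₀ hy ?_
    have : kappa = theta * logDeriv - 4 * euler theta := by rw [kappa]; simp
    rw [hSK, hD theta] at this
    linear_combination -this
  have ht := dlog_hauptmodul
  have hdS : S * dlog S = -128 * hauptmodul := by
    have := congrArg dlog hS2
    rw [dlog_pow, dlog_sub, dlog_mul, dlog_one, dlog_ofNat, ht] at this
    simp only [Nat.add_one_sub_one, pow_one] at this
    push_cast at this
    refine mul_left_cancel₀ (natCast_ne_zero two_ne_zero) ?_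
    linear_combination this
  have hSdP : S * dlog logDeriv = -128 * hauptmodul * (4 * dlog theta + theta)
      + (1 - 256 * hauptmodul) * (4 * dlog (dlog theta) + dlog theta) := by
    rw [hP, dlog_mul, dlog_add, dlog_mul, dlog_ofNat]
    linear_combination (4 * dlog (dlog theta) + dlog theta) * hS2 + (4 * dlog theta + theta) * hdS
  rw [hD logDeriv] at hQ
  set t := hauptmodul
  set y := theta
  set y1 := dlog y
  set y2 := dlog y1 with hy2
  have hquad : 2 * (1 - 256 * t) * y * y2 = (1 - 256 * t) * y1 ^ 2 + 256 * t * y * y1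
      + 48 * t * y ^ 2 := by
    refine mul_left_cancel₀ (natCast_ne_zero (show 16 ≠ 0 by norm_num)) ?_
    have hP2 : logDeriv ^ 2 = (1 - 256 * t) * (4 * y1 + y) ^ 2 := by
      rw [hP]; linear_combination (4 * y1 + y) ^ 2 * hS2
    linear_combination hP2 - hQ - 8 * y * hSdP
  have hcub := congrArg dlog hquad
  simp only [dlog_add, dlog_mul, dlog_sub, dlog_pow, dlog_one, dlog_ofNat, ht,
    Nat.add_one_sub_one, pow_one, Nat.cast_ofNat] at hcub
  change 2 * (1 - 256 * t) * y * dlog y2 + _ = _ at hcub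
  refine mul_left_cancel₀ (mul_ne_zero (natCast_ne_zero two_ne_zero) hy) ?_
  rw [picardFuchs]
  linear_combination hcub

/-- The coefficients of the hypergeometric series. -/
def hypCoeff (k : ℕ) : ℕ := (4 * k).choose k * (3 * k).choose k * (2 * k).choose k

lemma hypCoeff_mul (k : ℕ) : hypCoeff k * k.factorial ^ 4 = (4 * k).factorial := by
  have h2 := Nat.choose_mul_factorial_mul_factorial (show k ≤ 2 * k by omega)
  have h3 := Nat.choose_mul_factorial_mul_factorial (show k ≤ 3 * k by omega)
  have h4 := Nat.choose_mul_factorial_mul_factorial (show k ≤ 4 * k by omega)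
  rw [show 2 * k - k = k by omega] at h2
  rw [show 3 * k - k = 2 * k by omega, ← h2] at h3
  rw [show 4 * k - k = 3 * k by omega, ← h3] at h4
  rw [← h4, hypCoeff]
  ring

lemma hypCoeff_succ (k : ℕ) : (k + 1) ^ 3 * hypCoeff (k + 1) =
    8 * (4 * k + 1) * (2 * k + 1) * (4 * k + 3) * hypCoeff k := by
  have h := hypCoeff_mul (k + 1)
  rw [show 4 * (k + 1) = 4 * k + 3 + 1 by ring, Nat.factorial_succ (4 * k + 3), Nat.factorial_succ (4 * k + 2),
    Nat.factorial_succ (4 * k + 1), Nat.factorial_succ (4 * k), ← hypCoeff_mul k,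
    Nat.factorial_succ k] at h
  refine Nat.eq_of_mul_eq_mul_right (show 0 < (k + 1) * k.factorial ^ 4 by positivity) ?_
  linear_combination h

lemma dlog_term (c : ℤ) (k : ℕ) : dlog (C c * hauptmodul ^ k) = C (k * c) * hauptmodul ^ k := by
  rw [dlog_mul, dlog_C, dlog_pow, dlog_hauptmodul]
  rcases k with _ | k
  · simp
  · simp; ring

lemma picardFuchs_add (φ ψ : ℤ⟦X⟧) : picardFuchs (φ + ψ) = picardFuchs φ + picardFuchs ψ := by
  simp only [picardFuchs, dlog_add]; ring

lemma picardFuchs_sub (φ ψ : ℤ⟦X⟧) : picardFuchs (φ - ψ) = picardFuchs φ - picardFuchs ψ := by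
  simp only [picardFuchs, dlog_sub]; ring

/-- The truncated hypergeometric series at the Hauptmodul. -/
noncomputable def hypTrunc (N : ℕ) : ℤ⟦X⟧ :=
  ∑ k ∈ Finset.range N, C (hypCoeff k : ℤ) * hauptmodul ^ k

lemma picardFuchs_hypTrunc (N : ℕ) :
    picardFuchs (hypTrunc N) = C (-(N ^ 3 * hypCoeff N : ℤ)) * hauptmodul ^ N := by
  induction N with
  | zero =>
    rw [hypTrunc, Finset.range_zero, Finset.sum_empty, picardFuchs, ← map_zero C, dlog_C]
    simp [dlog, euler]
  | succ N ih =>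
    have h : ((N : ℤ) + 1) ^ 3 * hypCoeff (N + 1) =
        8 * (4 * N + 1) * (2 * N + 1) * (4 * N + 3) * hypCoeff N := by
      exact_mod_cast hypCoeff_succ N
    rw [hypTrunc, Finset.sum_range_succ, picardFuchs_add, ← hypTrunc, ih, picardFuchs]
    simp only [dlog_term]
    push_cast
    rw [h]
    simp only [map_neg, map_mul, map_add, map_pow, map_ofNat, map_one, map_natCast]
    ring

lemma dlog_X_pow_mul (m : ℕ) (φ : ℤ⟦X⟧) :
    ∃ ψ, dlog (X ^ m * φ) = X ^ m * ψ ∧ constantCoeff ψ = m * constantCoeff φ := by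
  refine ⟨theta * kappaInv * (m * φ + euler φ), ?_, ?_⟩
  · rw [dlog, euler_mul, euler_pow, euler_X]
    rcases m with _ | m
    · simp
    · rw [Nat.add_sub_cancel]; ring
  · simp [constantCoeff_theta, constantCoeff_kappaInv, constantCoeff_euler]

lemma picardFuchs_X_pow_mul (m : ℕ) (φ : ℤ⟦X⟧) :
    ∃ ψ, picardFuchs (X ^ m * φ) = X ^ m * ψ ∧ constantCoeff ψ = m ^ 3 * constantCoeff φ := by
  obtain ⟨ψ1, h1, h1'⟩ := dlog_X_pow_mul m φ
  obtain ⟨ψ2, h2, h2'⟩ := dlog_X_pow_mul m ψ1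
  obtain ⟨ψ3, h3, h3'⟩ := dlog_X_pow_mul m ψ2
  refine ⟨ψ3 - 8 * hauptmodul * (32 * ψ3 + 48 * ψ2 + 22 * ψ1 + 3 * φ), ?_, ?_⟩
  · rw [picardFuchs, h1, h2, h3]; ring
  · simp only [map_sub, map_mul, constantCoeff_hauptmodul, h1', h2', h3']; ring

/-- Modulo `q ^ N`, the form `theta` is the truncated hypergeometric series in the Hauptmodul. -/
theorem X_pow_dvd_theta_sub_hypTrunc (N : ℕ) : X ^ N ∣ theta - hypTrunc N := by
  rcases Nat.eq_zero_or_pos N with rfl | hN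
  · simp
  have ht : X ∣ hauptmodul := X_dvd_iff.2 constantCoeff_hauptmodul
  have hL : X ^ N ∣ picardFuchs (theta - hypTrunc N) := by
    rw [picardFuchs_sub, picardFuchs_theta, picardFuchs_hypTrunc, zero_sub, dvd_neg]
    exact (pow_dvd_pow_of_dvd ht N).mul_left _
  suffices ∀ m, 1 ≤ m → m ≤ N → X ^ m ∣ theta - hypTrunc N from this N hN le_rfl
  intro m hm
  induction m, hm using Nat.le_induction with
  | base =>
    intro _
    rw [pow_one, X_dvd_iff, map_sub, constantCoeff_theta, hypTrunc, map_sum,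
      Finset.sum_eq_single_of_mem 0 (Finset.mem_range.2 hN)]
    · simp [hypCoeff]
    · intro k _ hk
      simp [constantCoeff_hauptmodul, hk]
  | succ m hm ih =>
    intro hmN
    obtain ⟨φ, hφ⟩ := ih (by omega)
    obtain ⟨ψ, hψ, hψ'⟩ := picardFuchs_X_pow_mul m φ
    rw [hφ, hψ] at hL
    have h1 : X ^ (m + 1) ∣ X ^ m * ψ := (pow_dvd_pow X hmN).trans hL
    rw [pow_succ, mul_dvd_mul_iff_left (pow_ne_zero m X_ne_zero), X_dvd_iff, hψ'] at h1
    have h2 : constantCoeff φ = 0 := by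
      rcases mul_eq_zero.1 h1 with h | h
      · simp at h; omega
      · exact h
    rw [hφ, pow_succ]
    exact mul_dvd_mul_left _ (X_dvd_iff.2 h2)

end QuarticHypergeometric

namespace QuarticHypergeometric

open PowerSeries Complex Filter Topology

section Dissection

variable {R S : Type*} [CommRing R] [CommRing S] {p : ℕ}

/-- The part of a power series supported on exponents congruent to `i` modulo `p`. -/
noncomputable def dissect (p i : ℕ) (φ : R⟦X⟧) : R⟦X⟧ := mk fun n => coeff (p * n + i) φ

lemma sum_dissect (hp : p ≠ 0) (φ : R⟦X⟧) :
    ∑ i ∈ Finset.range p, X ^ i * PowerSeries.expand p hp (dissect p i φ) = φ := by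
  ext n
  rw [map_sum, Finset.sum_eq_single_of_mem (n % p)
    (Finset.mem_range.2 (Nat.mod_lt _ (Nat.pos_of_ne_zero hp)))]
  · rw [coeff_X_pow_mul', if_pos (Nat.mod_le _ _), show n - n % p = p * (n / p) by
      have := Nat.div_add_mod n p; omega, coeff_expand_mul, dissect, coeff_mk, Nat.div_add_mod]
  · intro i hi hin
    rw [coeff_X_pow_mul']
    split_ifs with h
    · refine coeff_expand_of_not_dvd _ _ _ fun ⟨m, hm⟩ => hin ?_
      rw [show n = i + p * m by omega, Nat.add_mul_mod_self_left,
        Nat.mod_eq_of_lt (Finset.mem_range.1 hi)]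
    · rfl

/-- The polynomial over power series in `X ^ p` representing `φ`. -/
noncomputable def dissectPoly (p : ℕ) (φ : R⟦X⟧) : Polynomial R⟦X⟧ :=
  ∑ i ∈ Finset.range p, Polynomial.C (dissect p i φ) * Polynomial.X ^ i

lemma natDegree_dissectPoly_le (φ : R⟦X⟧) : (dissectPoly p φ).natDegree ≤ p :=
  Polynomial.natDegree_sum_le_of_forall_le _ _ fun _ hi =>
    (Polynomial.natDegree_C_mul_X_pow_le _ _).trans (Finset.mem_range.1 hi).le

/-- The norm of `1 + φ T` from power series in `X` to power series in `X ^ p`. -/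
noncomputable def normPoly (p : ℕ) (φ : R⟦X⟧) : Polynomial R⟦X⟧ :=
  Polynomial.resultant (Polynomial.X ^ p - Polynomial.C (Polynomial.C X))
    (1 + Polynomial.C Polynomial.X * (dissectPoly p φ).map Polynomial.C) p p

lemma map_normPoly [Nontrivial S] (φ : R⟦X⟧) (f : R⟦X⟧ →+* S) (x : ℕ → S)
    (hx : ∏ i ∈ Finset.range p, (Polynomial.X - Polynomial.C (x i)) =
      Polynomial.X ^ p - Polynomial.C (f X)) :
    (normPoly p φ).map f =
      ∏ i ∈ Finset.range p, (1 + Polynomial.C ((dissectPoly p φ).eval₂ f (x i)) * Polynomial.X) := by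
  rw [← Polynomial.coe_mapRingHom, normPoly, ← Polynomial.resultant_map_map]
  have h1 : (Polynomial.X ^ p - Polynomial.C (Polynomial.C X) : Polynomial (Polynomial R⟦X⟧)).map
      (Polynomial.mapRingHom f) =
      ∏ i ∈ Finset.range p, (Polynomial.X - Polynomial.C (Polynomial.C (x i))) := by
    have := congrArg (Polynomial.map Polynomial.C) hx
    rw [Polynomial.map_prod] at this
    simp only [Polynomial.map_sub, Polynomial.map_X, Polynomial.map_C, Polynomial.map_pow] at this ⊢
    rw [this]; simp
  have hdeg : (∏ i ∈ Finset.range p,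
      (Polynomial.X - Polynomial.C (Polynomial.C (x i)))).natDegree = p := by
    rw [Polynomial.natDegree_prod_of_monic _ _ fun i _ => Polynomial.monic_X_sub_C _]
    simp
  set g := (1 + Polynomial.C Polynomial.X * (dissectPoly p φ).map Polynomial.C :
    Polynomial (Polynomial R⟦X⟧)).map (Polynomial.mapRingHom f) with hg
  have hgdeg : g.natDegree ≤ p := by
    refine Polynomial.natDegree_map_le.trans ?_
    refine Polynomial.natDegree_add_le_of_degree_le (by simp) ?_
    refine (Polynomial.natDegree_C_mul_le _ _).trans ?_
    exact Polynomial.natDegree_map_le.trans (natDegree_dissectPoly_le φ)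
  have h2 := Polynomial.resultant_prod_left (Finset.range p)
    (fun i => (Polynomial.X - Polynomial.C (Polynomial.C (x i)))) g p (by simp) hgdeg
  rw [hdeg] at h2
  rw [h1, h2]
  refine Finset.prod_congr rfl fun i _ => ?_
  rw [Polynomial.natDegree_X_sub_C, Polynomial.resultant_X_sub_C_left _ _ _ hgdeg, hg]
  simp only [Polynomial.map_add, Polynomial.map_one, Polynomial.map_mul, Polynomial.map_C,
    Polynomial.coe_mapRingHom, Polynomial.map_X, Polynomial.eval_add, Polynomial.eval_one,
    Polynomial.eval_mul, Polynomial.eval_C, Polynomial.map_map]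
  rw [mul_comm]
  congr 2
  rw [dissectPoly, Polynomial.eval₂_finsetSum, Polynomial.map_sum, Polynomial.eval_finsetSum,
    map_sum]
  refine Finset.sum_congr rfl fun i _ => ?_
  simp

end Dissection

section

variable (p : ℕ) [hp : Fact p.Prime]

lemma eval₂_dissectPoly {S : Type*} [CommRing S] (f : ℤ →+* S) (φ : ℤ⟦X⟧) (c : S) (hc : c ^ p = 1) :
    (dissectPoly p φ).eval₂ ((PowerSeries.expand p hp.out.ne_zero).toRingHom.comp
      (PowerSeries.map f)) (C c * X) = rescale c (PowerSeries.map f φ) := by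
  conv_rhs => rw [← sum_dissect hp.out.ne_zero φ]
  rw [dissectPoly, Polynomial.eval₂_finsetSum, map_sum, map_sum]
  refine Finset.sum_congr rfl fun i _ => ?_
  rw [Polynomial.eval₂_mul, Polynomial.eval₂_C, Polynomial.eval₂_X_pow, map_mul, map_mul, map_pow,
    map_pow, map_X, rescale_X, mul_comm]
  congr 1
  rw [map_expand]
  ext n
  simp only [RingHom.comp_apply]
  rw [coeff_rescale]
  change coeff n (PowerSeries.expand p hp.out.ne_zero (PowerSeries.map f (dissect p i φ))) = _
  by_cases h : p ∣ n
  · obtain ⟨m, rfl⟩ := h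
    rw [pow_mul, hc, one_pow, one_mul]
  · rw [coeff_expand_of_not_dvd _ _ _ h, mul_zero]

/-- The elementary symmetric functions of the conjugates of `theta`. -/
noncomputable def thetaSymm (k : ℕ) : ℤ⟦X⟧ := (normPoly p theta).coeff k

/-- A primitive `p`-th root of unity. -/
noncomputable def rootOfUnity : ℂ := cexp (2 * Real.pi * I / p)

lemma isPrimitiveRoot_rootOfUnity : IsPrimitiveRoot (rootOfUnity p) p :=
  Complex.isPrimitiveRoot_exp p hp.out.ne_zero

lemma map_normPoly_theta :
    (normPoly p theta).map ((PowerSeries.expand p hp.out.ne_zero).toRingHom.comp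
      (PowerSeries.map (Int.castRingHom ℂ))) =
    ∏ i ∈ Finset.range p,
      (1 + Polynomial.C (rescale (rootOfUnity p ^ i) (toC theta)) * Polynomial.X) := by
  have hζ := isPrimitiveRoot_rootOfUnity p
  have hζ' : IsPrimitiveRoot (C (rootOfUnity p)) p := hζ.map_of_injective C_injective
  rw [map_normPoly theta _ (fun i => C (rootOfUnity p ^ i) * X)]
  · refine Finset.prod_congr rfl fun i _ => ?_
    rw [eval₂_dissectPoly p _ _ _ (by rw [← pow_mul, mul_comm, pow_mul, hζ.pow_eq_one, one_pow])]
  · have := X_pow_sub_C_eq_prod hζ' hp.out.pos (α := X) (a := X ^ p) rfl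
    simp only [map_pow] at this ⊢
    rw [← this]
    simp

end

end QuarticHypergeometric

namespace QuarticHypergeometric

open PowerSeries Complex Filter Topology

lemma Conv.rescale {φ : ℂ⟦X⟧} (h : Conv φ) {c : ℂ} (hc : ‖c‖ = 1) :
    Conv (PowerSeries.rescale c φ) := by
  intro q hq
  have := h q hq
  simpa [coeff_rescale, norm_mul, norm_pow, hc] using this

lemma ev_rescale (φ : ℂ⟦X⟧) (c q : ℂ) : ev (PowerSeries.rescale c φ) q = ev φ (c * q) := by
  simp only [ev, coeff_rescale]
  exact tsum_congr fun n => by ring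

lemma conv_coeff_prod {φ : ℕ → ℂ⟦X⟧} (h : ∀ i, Conv (φ i)) (n k : ℕ) :
    Conv ((∏ i ∈ Finset.range n, (1 + Polynomial.C (φ i) * Polynomial.X)).coeff k) ∧
    ∀ q : ℂ, ‖q‖ < 1 →
      ev ((∏ i ∈ Finset.range n, (1 + Polynomial.C (φ i) * Polynomial.X)).coeff k) q =
      (∏ i ∈ Finset.range n, (1 + Polynomial.C (ev (φ i) q) * Polynomial.X)).coeff k := by
  induction n generalizing k with
  | zero =>
    simp only [Finset.range_zero, Finset.prod_empty, Polynomial.coeff_one]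
    split_ifs
    · exact ⟨conv_one, fun q _ => ev_one q⟩
    · exact ⟨conv_zero, fun q _ => by simp [ev]⟩
  | succ n ih =>
    simp only [Finset.prod_range_succ, mul_add, mul_one, ← mul_assoc]
    rcases k with _ | k
    · simpa using ih 0
    · simp only [Polynomial.coeff_add, Polynomial.coeff_mul_X, Polynomial.coeff_mul_C]
      refine ⟨(ih (k + 1)).1.add ((ih k).1.mul (h n)), fun q hq => ?_⟩
      rw [ev_add (ih (k + 1)).1 ((ih k).1.mul (h n)) hq, ev_mul (ih k).1 (h n) hq,
        (ih (k + 1)).2 q hq, (ih k).2 q hq]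

lemma conv_of_expand {φ : ℂ⟦X⟧} {m : ℕ} (hm : m ≠ 0) (h : Conv (PowerSeries.expand m hm φ)) :
    Conv φ := by
  intro q hq
  obtain ⟨r, hr, hrq⟩ : ∃ r : ℝ, 0 ≤ r ∧ r ^ m = ‖q‖ :=
    ⟨‖q‖ ^ ((m : ℝ)⁻¹), by positivity, Real.rpow_inv_natCast_pow (norm_nonneg q) hm⟩
  have hr1 : r < 1 := by
    by_contra hcon
    exact absurd (one_le_pow₀ (n := m) (not_lt.1 hcon)) (by rw [hrq]; exact not_le.2 hq)
  have hs := (h.summable_abs hr hr1).comp_injective (fun a b hab => Nat.eq_of_mul_eq_mul_left (Nat.pos_of_ne_zero hm) hab : Function.Injective fun n : ℕ => m * n)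
  refine hs.congr fun n => ?_
  simp only [Function.comp, coeff_expand_mul]
  rw [norm_mul, norm_pow, pow_mul, hrq]

variable (p : ℕ) [hp : Fact p.Prime]

lemma expand_thetaSymm (k : ℕ) :
    PowerSeries.expand p hp.out.ne_zero (toC (thetaSymm p k)) =
      (∏ i ∈ Finset.range p, (1 + Polynomial.C (rescale (rootOfUnity p ^ i) (toC theta)) *
        Polynomial.X)).coeff k := by
  rw [← map_normPoly_theta, Polynomial.coeff_map]; rfl

lemma norm_rootOfUnity_pow (i : ℕ) : ‖rootOfUnity p ^ i‖ = 1 := by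
  rw [norm_pow, (isPrimitiveRoot_rootOfUnity p).norm'_eq_one hp.out.ne_zero, one_pow]

lemma iconv_thetaSymm (k : ℕ) : IConv (thetaSymm p k) := by
  refine conv_of_expand hp.out.ne_zero ?_
  rw [expand_thetaSymm]
  exact (conv_coeff_prod (fun i => Conv.rescale iconv_theta (norm_rootOfUnity_pow p i)) p k).1

lemma nome_add_div (τ : ℂ) (i : ℕ) : nome ((τ + i) / p) = rootOfUnity p ^ i * nome (τ / p) := by
  have : (p : ℂ) ≠ 0 := by exact_mod_cast hp.out.ne_zero
  rw [nome, nome, rootOfUnity, ← Complex.exp_nat_mul, ← Complex.exp_add]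
  congr 1
  field_simp
  ring

lemma div_im_pos {τ : ℂ} (hτ : 0 < τ.im) : 0 < (τ / p).im := by
  have : (0 : ℝ) < p := by exact_mod_cast hp.out.pos
  rw [Complex.div_natCast_im]; positivity

lemma val_thetaSymm {τ : ℂ} (hτ : 0 < τ.im) (k : ℕ) :
    val (thetaSymm p k) τ = (∏ i ∈ Finset.range p,
      (1 + Polynomial.C (val theta ((τ + i) / p)) * Polynomial.X)).coeff k := by
  have hp0 : (p : ℂ) ≠ 0 := by exact_mod_cast hp.out.ne_zero
  have hq := norm_nome_lt_one (div_im_pos p hτ)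
  have h1 : nome τ = nome (τ / p) ^ p := by
    rw [← nome_nat_mul, mul_div_cancel₀ _ hp0]
  rw [val, h1, ← ev_expand _ hp.out.ne_zero, expand_thetaSymm, (conv_coeff_prod
    (fun i => Conv.rescale iconv_theta (norm_rootOfUnity_pow p i)) p k).2 _ hq]
  congr 1
  refine Finset.prod_congr rfl fun i _ => ?_
  rw [ev_rescale, ← nome_add_div]; rfl

lemma expand_injective {R : Type*} [CommRing R] {m : ℕ} (hm : m ≠ 0) :
    Function.Injective (PowerSeries.expand m hm : R⟦X⟧ →ₐ[R] R⟦X⟧) := fun φ ψ h => by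
  ext n
  simpa [coeff_expand_mul] using congrArg (coeff (m * n)) h

lemma thetaSymm_zero : thetaSymm p 0 = 1 := by
  refine toC_injective (expand_injective hp.out.ne_zero ?_)
  rw [expand_thetaSymm, Polynomial.coeff_zero_prod]
  simp

lemma thetaSymm_eq_zero {k : ℕ} (hk : p < k) : thetaSymm p k = 0 := by
  refine toC_injective (expand_injective hp.out.ne_zero ?_)
  rw [expand_thetaSymm, Polynomial.coeff_eq_zero_of_natDegree_lt]
  · simp
  · refine (Polynomial.natDegree_prod_le _ _).trans_lt (lt_of_le_of_lt (Finset.sum_le_card_nsmul _ _ 1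
      fun i _ => ?_) (by simpa using hk))
    refine Polynomial.natDegree_add_le_of_degree_le (by simp) ((Polynomial.natDegree_C_mul_le _ _).trans
      Polynomial.natDegree_X_le)

lemma expand_map_zmod (φ : ℤ⟦X⟧) :
    PowerSeries.expand p hp.out.ne_zero (PowerSeries.map (Int.castRingHom (ZMod p)) φ) =
      (PowerSeries.map (Int.castRingHom (ZMod p)) φ) ^ p := by
  generalize PowerSeries.map (Int.castRingHom (ZMod p)) φ = ψ
  ext n
  have h1 : coeff n (ψ ^ p) = (trunc (n + 1) ψ ^ p).coeff n := by
    have h := congrArg (Polynomial.coeff · n) (trunc_trunc_pow ψ (n + 1) p)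
    simp only [coeff_trunc, Nat.lt_succ_self, if_true] at h
    rw [← h, ← Polynomial.coe_pow, Polynomial.coeff_coe]
  rw [h1, ← ZMod.expand_card, Polynomial.coeff_expand hp.out.pos, coeff_expand, coeff_trunc,
    if_pos (Nat.lt_succ_of_le (Nat.div_le_self n p))]

lemma map_thetaSymm_zmod (k : ℕ) :
    PowerSeries.map (Int.castRingHom (ZMod p)) (thetaSymm p k) =
      if k = 0 then 1 else if k = p then PowerSeries.map (Int.castRingHom (ZMod p)) theta else 0 := by
  have : CharP (ZMod p)⟦X⟧ p := charP_of_injective_ringHom C_injective p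
  have h := map_normPoly theta ((PowerSeries.expand p hp.out.ne_zero).toRingHom.comp
      (PowerSeries.map (Int.castRingHom (ZMod p)))) (fun _ => X) (p := p) (by
    rw [Finset.prod_const, Finset.card_range, sub_pow_char, ← map_pow]
    simp)
  have h1 := eval₂_dissectPoly p (Int.castRingHom (ZMod p)) theta 1 (one_pow p)
  rw [map_one, one_mul, rescale_one, RingHom.id_apply] at h1
  rw [Finset.prod_const, Finset.card_range, add_pow_char, h1, one_pow, mul_pow, ← map_pow,
    ← expand_map_zmod] at h
  have h2 := congrArg (Polynomial.coeff · k) h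
  simp only [Polynomial.coeff_map, Polynomial.coeff_add, Polynomial.coeff_one,
    Polynomial.coeff_C_mul, Polynomial.coeff_X_pow] at h2
  refine expand_injective hp.out.ne_zero (h2.trans ?_)
  have := hp.out.ne_zero
  split_ifs <;> simp_all

end QuarticHypergeometric

namespace QuarticHypergeometric

open PowerSeries Complex Filter Topology

variable (p : ℕ) [hp : Fact p.Prime]

/-- The conjugates of `p ^ 2 * theta (p * τ)` under the modular correspondence of degree `p`. -/
noncomputable def conjugate (τ : ℂ) : Option (ZMod p) → ℂ
  | none => p ^ 2 * val theta (p * τ)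
  | some j => val theta ((τ + j.val) / p)

/-- The action of the Fricke involution on the conjugates. -/
def frickePerm : Option (ZMod p) → Option (ZMod p)
  | none => some 0
  | some j => if j = 0 then none else some (-(2 * j)⁻¹)

variable {p}

lemma two_ne_zero_zmod (hp2 : p ≠ 2) : (2 : ZMod p) ≠ 0 := by
  have : ((2 : ℕ) : ZMod p) ≠ 0 := fun h => hp2
    ((Nat.prime_dvd_prime_iff_eq hp.out Nat.prime_two).1 ((ZMod.natCast_eq_zero_iff 2 p).1 h))
  exact_mod_cast this

lemma involutive_frickePerm (hp2 : p ≠ 2) : Function.Involutive (frickePerm p) := by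
  have h2 := two_ne_zero_zmod hp2
  rintro (_ | j)
  · simp [frickePerm]
  · by_cases hj : j = 0
    · simp [frickePerm, hj]
    · have : -(2 * j)⁻¹ ≠ 0 := by simp [h2, hj]
      simp only [frickePerm, if_neg hj, if_neg this, Option.some.injEq]
      field_simp

lemma mul_im_pos {τ : ℂ} (hτ : 0 < τ.im) : 0 < (p * τ).im := by
  have : (0 : ℝ) < p := by exact_mod_cast hp.out.pos
  simpa using mul_pos this hτ

lemma add_div_im_pos {τ : ℂ} (hτ : 0 < τ.im) (j : ℕ) : 0 < ((τ + j) / p).im :=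
  div_im_pos p (by simpa using hτ)

lemma conjugate_fricke (hp2 : p ≠ 2) {τ : ℂ} (hτ : 0 < τ.im) (o : Option (ZMod p)) :
    conjugate p (-1 / (2 * τ)) (frickePerm p o) = -2 * τ ^ 2 * conjugate p τ o := by
  have hp0 : (p : ℂ) ≠ 0 := by exact_mod_cast hp.out.ne_zero
  have hτ0 := ne_zero_of_im_pos hτ
  rcases o with _ | j
  · have h := isForm_theta.fricke (p * τ) (mul_im_pos hτ)
    simp only [frickePerm, conjugate, ZMod.val_zero]
    rw [show (-1 / (2 * τ) + ((0 : ℕ) : ℂ)) / p = -1 / (2 * (p * τ)) by field_simp; simp, h]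
    ring
  · by_cases hj : j = 0
    · have h := isForm_theta.fricke (τ / p) (div_im_pos p hτ)
      simp only [frickePerm, conjugate, hj, if_true, ZMod.val_zero]
      rw [show p * (-1 / (2 * τ)) = -1 / (2 * (τ / p)) by field_simp, h, Nat.cast_zero, add_zero]
      field_simp
    · simp only [frickePerm, conjugate, if_neg hj]
      have h2 := two_ne_zero_zmod hp2
      obtain ⟨m, hm⟩ : (p : ℤ) ∣ 2 * j.val * (-(2 * j)⁻¹ : ZMod p).val + 1 := by
        rw [← ZMod.intCast_zmod_eq_zero_iff_dvd]
        push_cast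
        rw [ZMod.natCast_zmod_val, ZMod.natCast_zmod_val]
        field_simp
        ring
      set j' := (-(2 * j)⁻¹ : ZMod p).val
      have hmc : (2 * j.val * j' + 1 : ℂ) = p * m := by exact_mod_cast hm
      have h := val_theta_atkinLehner (a := j') (b := -m) (c := p) (d := -j.val)
        (by linear_combination -hm) (add_div_im_pos (p := p) hτ j.val)
        (add_div_im_pos (p := p) (fricke_im_pos hτ) j') (by
          push_cast
          rw [mul_div_cancel₀ _ hp0, add_neg_cancel_right]
          field_simp
          linear_combination -hmc)
      rw [h]
      push_cast
      rw [mul_div_cancel₀ _ hp0, add_neg_cancel_right]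

lemma prod_zmod_val {M : Type*} [CommMonoid M] (f : ℕ → M) :
    ∏ j : ZMod p, f j.val = ∏ i ∈ Finset.range p, f i :=
  Finset.prod_nbij' ZMod.val Nat.cast (fun j _ => Finset.mem_range.2 (ZMod.val_lt j))
    (fun _ _ => Finset.mem_univ _) (fun j _ => ZMod.natCast_zmod_val j)
    (fun _ hi => ZMod.val_cast_of_lt (Finset.mem_range.1 hi)) fun _ _ => rfl

variable (p)

/-- The polynomial whose coefficients are the elementary symmetric functions of the conjugates. -/
noncomputable def modularPoly : Polynomial ℤ⟦X⟧ :=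
  (1 + Polynomial.C (C ((p : ℤ) ^ 2) * PowerSeries.expand p hp.out.ne_zero theta) * Polynomial.X) *
    normPoly p theta

lemma coeff_modularPoly_zero : (modularPoly p).coeff 0 = 1 := by
  rw [modularPoly, Polynomial.mul_coeff_zero, ← thetaSymm, thetaSymm_zero]
  simp

lemma coeff_modularPoly_succ (k : ℕ) : (modularPoly p).coeff (k + 1) = thetaSymm p (k + 1) +
    C ((p : ℤ) ^ 2) * PowerSeries.expand p hp.out.ne_zero theta * thetaSymm p k := by
  rw [modularPoly, add_mul, one_mul, mul_assoc, Polynomial.X_mul, Polynomial.coeff_add,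
    Polynomial.coeff_C_mul, Polynomial.coeff_mul_X]
  rfl

lemma iconv_expand_theta : IConv (C ((p : ℤ) ^ 2) * PowerSeries.expand p hp.out.ne_zero theta) :=
  (iconv_C _).mul (iconv_theta.expand _)

lemma iconv_coeff_modularPoly (k : ℕ) : IConv ((modularPoly p).coeff k) := by
  rcases k with _ | k
  · rw [coeff_modularPoly_zero]; exact iconv_one
  · rw [coeff_modularPoly_succ]
    exact (iconv_thetaSymm p _).add ((iconv_expand_theta p).mul (iconv_thetaSymm p k))

lemma val_coeff_modularPoly {τ : ℂ} (hτ : 0 < τ.im) (k : ℕ) :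
    val ((modularPoly p).coeff k) τ =
      (∏ o, (1 + Polynomial.C (conjugate p τ o) * Polynomial.X)).coeff k := by
  rw [Fintype.prod_option]
  simp only [conjugate]
  rw [prod_zmod_val fun i => 1 + Polynomial.C (val theta ((τ + i) / p)) * Polynomial.X]
  rcases k with _ | k
  · rw [coeff_modularPoly_zero, Polynomial.mul_coeff_zero, Polynomial.coeff_zero_prod]
    simp
  · rw [coeff_modularPoly_succ, add_mul, one_mul, mul_assoc (Polynomial.C _), Polynomial.X_mul,
      Polynomial.coeff_add, ← mul_assoc (Polynomial.C _), Polynomial.coeff_mul_X, Polynomial.coeff_C_mul, ← val_thetaSymm p hτ, ← val_thetaSymm p hτ,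
      val_add (iconv_thetaSymm p _) ((iconv_expand_theta p).mul (iconv_thetaSymm p k)) hτ,
      val_mul (iconv_expand_theta p) (iconv_thetaSymm p k) hτ,
      val_mul (iconv_C _) (iconv_theta.expand _) hτ, val_C, val_expand]
    push_cast; rfl

variable {p}

lemma isForm_coeff_modularPoly (hp2 : p ≠ 2) (k : ℕ) : IsForm k ((modularPoly p).coeff k) := by
  refine ⟨iconv_coeff_modularPoly p k, fun τ hτ => ?_⟩
  rw [val_coeff_modularPoly p hτ, val_coeff_modularPoly p (fricke_im_pos hτ),
    ← Equiv.prod_comp (involutive_frickePerm hp2).toPerm]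
  simp only [Function.Involutive.coe_toPerm, conjugate_fricke hp2 hτ]
  set a := -2 * τ ^ 2
  have h : ∏ o, (1 + Polynomial.C (a * conjugate p τ o) * Polynomial.X) =
      (∏ o, (1 + Polynomial.C (conjugate p τ o) * Polynomial.X)).comp
        (Polynomial.C a * Polynomial.X) := by
    rw [Polynomial.prod_comp]
    refine Finset.prod_congr rfl fun o _ => ?_
    simp; ring
  rw [h, Polynomial.comp_C_mul_X_coeff, mul_comm]

/-- The form `expand p theta * thetaSymm p p` of weight `p + 1`. -/
lemma isForm_expand_mul_thetaSymm (hp2 : p ≠ 2) :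
    IsForm (p + 1) (PowerSeries.expand p hp.out.ne_zero theta * thetaSymm p p) := by
  have h := isForm_coeff_modularPoly hp2 (p + 1)
  rw [coeff_modularPoly_succ, thetaSymm_eq_zero p (Nat.lt_succ_self p), zero_add, mul_assoc] at h
  have hc := (iconv_theta.expand hp.out.ne_zero).mul (iconv_thetaSymm p p)
  refine ⟨hc, fun τ hτ => ?_⟩
  have h1 := h.fricke τ hτ
  rw [val_mul (iconv_C _) hc hτ, val_mul (iconv_C _) hc (fricke_im_pos hτ), val_C, val_C] at h1
  have hp0 : (((p : ℤ) ^ 2 : ℤ) : ℂ) ≠ 0 := by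
    have := hp.out.ne_zero
    exact_mod_cast pow_ne_zero 2 this
  refine mul_left_cancel₀ hp0 ?_
  linear_combination h1

end QuarticHypergeometric

namespace QuarticHypergeometric

open PowerSeries Complex Filter Topology

lemma IsForm.exists_polynomial {k : ℕ} {φ : ℤ⟦X⟧} (h : IsForm k φ) :
    ∃ ε : Polynomial ℤ, ε.natDegree ≤ k / 4 ∧ φ = theta ^ k * Polynomial.aeval hauptmodul ε := by
  obtain ⟨c, hc⟩ := h.exists_coeffs
  refine ⟨∑ i ∈ Finset.range (k / 4 + 1), Polynomial.C (c i) * Polynomial.X ^ i, ?_, ?_⟩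
  · refine Polynomial.natDegree_sum_le_of_forall_le _ _ fun i hi => ?_
    exact (Polynomial.natDegree_C_mul_X_pow_le _ _).trans
      (Nat.lt_succ_iff.1 (Finset.mem_range.1 hi))
  · rw [hc, map_sum, Finset.mul_sum]
    refine Finset.sum_congr rfl fun i hi => ?_
    have hi' := Finset.mem_range.1 hi
    rw [map_mul, Polynomial.aeval_C, map_pow, Polynomial.aeval_X, ← hauptmodul_mul,
      show theta ^ k = theta ^ (k - 4 * i) * theta ^ (4 * i) by
        rw [← pow_add]; congr 1; omega]
    change C (c i) * _ * _ = _ * (C (c i) * _)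
    ring

lemma coeff_eq_zero_of_X_pow_dvd_aeval {R : Type*} [CommRing R] {t u : R⟦X⟧} (ht : t = X * u)
    (hu : constantCoeff u = 1) {Q : Polynomial R} {N : ℕ} (h : X ^ N ∣ Polynomial.aeval t Q)
    (m : ℕ) (hm : m < N) : Q.coeff m = 0 := by
  induction m using Nat.strong_induction_on with
  | _ m ih =>
    obtain ⟨Q', rfl⟩ := Polynomial.X_pow_dvd_iff.2 fun i hi => ih i hi (hi.trans hm)
    have h1 := X_pow_dvd_iff.1 h m hm
    rw [map_mul, map_pow, Polynomial.aeval_X, ht, mul_pow, mul_assoc, coeff_X_pow_mul', if_pos le_rfl,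
      Nat.sub_self, coeff_zero_eq_constantCoeff_apply, map_mul, map_pow, hu, one_pow, one_mul,
      ← ht] at h1
    have ht0 : constantCoeff t = 0 := by rw [ht]; simp
    have h2 : constantCoeff (Polynomial.aeval t Q') = Q'.coeff 0 := by
      rw [Polynomial.aeval_def, Polynomial.hom_eval₂, ht0, Polynomial.eval₂_at_zero]
      change constantCoeff (C (Q'.coeff 0)) = _
      rw [constantCoeff_C]
    simpa [Polynomial.coeff_X_pow_mul'] using h2.symm.trans h1

lemma exists_hauptmodul_eq : ∃ u, hauptmodul = X * u ∧ constantCoeff u = 1 := by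
  obtain ⟨u, hu⟩ := X_dvd_iff.2 constantCoeff_hauptmodul
  refine ⟨u, hu, ?_⟩
  have := coeff_one_hauptmodul
  rwa [hu, coeff_one_mul', constantCoeff_X, zero_mul, zero_add, coeff_one_X, one_mul] at this

lemma dvd_coeff_of_aeval_hauptmodul {n : ℕ} {Q : Polynomial ℤ} {N : ℕ} {α β : ℤ⟦X⟧}
    (h : Polynomial.aeval hauptmodul Q = C (n : ℤ) * α + X ^ N * β) (m : ℕ) (hm : m < N) :
    (n : ℤ) ∣ Q.coeff m := by
  obtain ⟨u, hu, hu'⟩ := exists_hauptmodul_eq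
  set f := Int.castRingHom (ZMod n)
  have h1 : X ^ N ∣ Polynomial.aeval (PowerSeries.map f hauptmodul) (Q.map f) := by
    have h2 := congrArg (PowerSeries.map f) h
    rw [map_add, map_mul, map_mul, map_pow, map_X, map_C, map_natCast, CharP.cast_eq_zero, map_zero,
      zero_mul, zero_add] at h2
    refine ⟨_, Eq.trans ?_ h2⟩
    rw [Polynomial.aeval_def, Polynomial.eval₂_map, Polynomial.aeval_def, Polynomial.hom_eval₂]
    congr 1
    exact RingHom.ext_int _ _
  have h3 := coeff_eq_zero_of_X_pow_dvd_aeval (u := PowerSeries.map f u)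
    (by rw [hu, map_mul, map_X]) (by
      rw [← coeff_zero_eq_constantCoeff_apply, coeff_map, coeff_zero_eq_constantCoeff_apply, hu',
        map_one]) h1 m hm
  rw [Polynomial.coeff_map] at h3
  exact (ZMod.intCast_zmod_eq_zero_iff_dvd _ _).1 h3

lemma C_dvd_of_aeval_hauptmodul {n : ℕ} {Q : Polynomial ℤ} {N : ℕ} {α β : ℤ⟦X⟧}
    (h : Polynomial.aeval hauptmodul Q = C (n : ℤ) * α + X ^ N * β) (hQ : Q.natDegree < N) :
    Polynomial.C (n : ℤ) ∣ Q := by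
  refine Polynomial.C_dvd_iff_dvd_coeff _ _ |>.2 fun m => ?_
  rcases lt_or_ge m N with hm | hm
  · exact dvd_coeff_of_aeval_hauptmodul h m hm
  · rw [Polynomial.coeff_eq_zero_of_natDegree_lt (hQ.trans_le hm)]; exact dvd_zero _

lemma C_dvd_of_map_eq {n : ℕ} {φ ψ : ℤ⟦X⟧}
    (h : PowerSeries.map (Int.castRingHom (ZMod n)) φ = PowerSeries.map (Int.castRingHom (ZMod n)) ψ) :
    ∃ α, φ - ψ = C (n : ℤ) * α := by
  have hc : ∀ k, (n : ℤ) ∣ coeff k (φ - ψ) := fun k => by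
    have := congrArg (coeff k) h
    rw [coeff_map, coeff_map] at this
    rw [← ZMod.intCast_zmod_eq_zero_iff_dvd, map_sub, Int.cast_sub]
    exact sub_eq_zero.2 this
  choose c hc using hc
  exact ⟨mk c, by ext k; rw [coeff_C_mul, coeff_mk, hc]⟩

/-- The truncated hypergeometric polynomial. -/
noncomputable def hypPoly (N : ℕ) : Polynomial ℤ :=
  ∑ k ∈ Finset.range N, Polynomial.C (hypCoeff k : ℤ) * Polynomial.X ^ k

lemma aeval_hypPoly (N : ℕ) : Polynomial.aeval hauptmodul (hypPoly N) = hypTrunc N := by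
  rw [hypPoly, map_sum, hypTrunc]
  refine Finset.sum_congr rfl fun k _ => ?_
  rw [map_mul, Polynomial.aeval_C, map_pow, Polynomial.aeval_X]; rfl

lemma natDegree_hypPoly_lt {N : ℕ} (hN : 0 < N) : (hypPoly N).natDegree < N := by
  refine lt_of_le_of_lt (Polynomial.natDegree_sum_le_of_forall_le (n := N - 1) _ _ fun i hi => ?_)
    (Nat.sub_one_lt hN.ne')
  have := Finset.mem_range.1 hi
  exact (Polynomial.natDegree_C_mul_X_pow_le _ _).trans (by omega)

lemma aeval_eq_of_form {k : ℕ} {φ : ℤ⟦X⟧} {ε : Polynomial ℤ}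
    (h : φ = theta ^ k * Polynomial.aeval hauptmodul ε) :
    Polynomial.aeval hauptmodul ε = thetaInv ^ k * φ := by
  have h1 : (theta * thetaInv) ^ k = 1 := by rw [theta_mul_inv, one_pow]
  rw [mul_pow] at h1
  rw [h]
  linear_combination -(Polynomial.aeval hauptmodul ε) * h1

variable {p : ℕ} [hp : Fact p.Prime]

lemma exists_thetaSymm_eq {k : ℕ} (hk : k ≠ 0) (hkp : k ≠ p) :
    ∃ α, thetaSymm p k = C (p : ℤ) * α := by
  have h := map_thetaSymm_zmod p k
  rw [if_neg hk, if_neg hkp] at h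
  obtain ⟨α, hα⟩ := C_dvd_of_map_eq (φ := thetaSymm p k) (ψ := 0) (h.trans (map_zero _).symm)
  exact ⟨α, by rw [← hα, sub_zero]⟩

lemma expand_theta_eq : ∃ β, PowerSeries.expand p hp.out.ne_zero theta = 1 + X ^ p * β := by
  obtain ⟨χ, hχ⟩ := X_dvd_iff.2 (show constantCoeff (theta - 1) = 0 by simp [constantCoeff_theta])
  refine ⟨PowerSeries.expand p hp.out.ne_zero χ, ?_⟩
  rw [eq_add_of_sub_eq hχ, map_add, map_mul, map_one, expand_X, add_comm]

/-- The congruence for the truncated hypergeometric polynomial coming from the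
modular equation of degree `p`. -/
theorem exists_modular_congruence (hp2 : p ≠ 2) : ∃ a b e a' r : Polynomial ℤ,
    (modularPoly p).coeff (p + 1) =
      C ((p : ℤ) ^ 2) * (theta ^ (p + 1) * Polynomial.aeval hauptmodul a) ∧
    (modularPoly p).coeff p = theta ^ p * Polynomial.aeval hauptmodul b ∧
    (modularPoly p).coeff (p - 1) =
      theta ^ (p - 1) * Polynomial.aeval hauptmodul (Polynomial.C (p : ℤ) * e) ∧
    a = 1 + Polynomial.C (p : ℤ) * a' ∧
    a * hypPoly p = b + Polynomial.C (p : ℤ) ^ 3 * r := by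
  have hp3 : 3 ≤ p := by have := hp.out.two_le; omega
  obtain ⟨q, rfl⟩ : ∃ q, p = q + 2 := ⟨p - 2, by omega⟩
  set p := q + 2 with hpq
  obtain ⟨a, hadeg, ha⟩ := (isForm_expand_mul_thetaSymm hp2).exists_polynomial
  obtain ⟨b, hbdeg, hb⟩ := (isForm_coeff_modularPoly hp2 p).exists_polynomial
  obtain ⟨e0, hedeg, he⟩ := (isForm_coeff_modularPoly hp2 (q + 1)).exists_polynomial
  obtain ⟨α1, hα1⟩ := exists_thetaSymm_eq (p := p) (k := q + 1) (by omega) (by omega)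
  set ex := PowerSeries.expand p hp.out.ne_zero theta with hex
  have hE : (modularPoly p).coeff p = thetaSymm p p + C ((p : ℤ) ^ 2) * ex * thetaSymm p (q + 1) :=
    coeff_modularPoly_succ p (q + 1)
  obtain ⟨e, rfl⟩ : Polynomial.C (p : ℤ) ∣ e0 := by
    refine C_dvd_of_aeval_hauptmodul (N := e0.natDegree + 1) (β := 0)
      (α := thetaInv ^ (q + 1) * (α1 + C (p : ℤ) * ex * thetaSymm p q)) ?_ (Nat.lt_succ_self _)
    rw [aeval_eq_of_form he, coeff_modularPoly_succ, hα1, map_pow]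
    ring
  obtain ⟨a', ha'⟩ : Polynomial.C (p : ℤ) ∣ a - 1 := by
    obtain ⟨α, hα⟩ := C_dvd_of_map_eq (n := p) (φ := ex * thetaSymm p p) (ψ := theta ^ (p + 1)) (by
      rw [map_mul, hex, map_expand, expand_map_zmod, map_thetaSymm_zmod, if_neg hp.out.ne_zero,
        if_pos rfl, ← pow_succ, map_pow])
    refine C_dvd_of_aeval_hauptmodul (N := (a - 1).natDegree + 1) (β := 0)
      (α := thetaInv ^ (p + 1) * α) ?_ (Nat.lt_succ_self _)
    have h1 : (theta * thetaInv) ^ (p + 1) = 1 := by rw [theta_mul_inv, one_pow]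
    rw [mul_pow] at h1
    rw [map_sub, map_one, aeval_eq_of_form ha]
    linear_combination thetaInv ^ (p + 1) * hα + h1
  have ha1 : a = 1 + Polynomial.C (p : ℤ) * a' := by linear_combination ha'
  have hpZ : (p : ℤ) ≠ 0 := by exact_mod_cast hp.out.ne_zero
  have ha'deg : a'.natDegree ≤ (p + 1) / 4 := by
    rw [← Polynomial.natDegree_C_mul hpZ, ← ha']
    exact (Polynomial.natDegree_sub_le _ _).trans (max_le hadeg (by simp))
  obtain ⟨β1, hβ1⟩ := expand_theta_eq (p := p)
  rw [← hex] at hβ1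
  obtain ⟨β2, hβ2⟩ := X_pow_dvd_theta_sub_hypTrunc p
  set w := 1 - Polynomial.C (p : ℤ) * a' + (Polynomial.C (p : ℤ) * a') ^ 2 with hw
  have haw : a * w = 1 + Polynomial.C (p : ℤ) ^ 3 * a' ^ 3 := by rw [ha1, hw]; ring
  have hCA : ∀ z : ℤ, Polynomial.aeval hauptmodul (Polynomial.C z) = C z := fun z =>
    Polynomial.aeval_C _ _
  obtain ⟨r, hr⟩ : Polynomial.C ((p ^ 3 : ℕ) : ℤ) ∣ hypPoly p - b * w := by
    obtain ⟨α, β, hαβ⟩ : ∃ α β, Polynomial.aeval hauptmodul (a * hypPoly p - b) =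
        C ((p : ℤ) ^ 3) * α + X ^ p * β := by
      have h1 : (theta * thetaInv) ^ p = 1 := by rw [theta_mul_inv, one_pow]
      rw [mul_pow] at h1
      have ha2 : theta * Polynomial.aeval hauptmodul a = thetaInv ^ p * (ex * thetaSymm p p) := by
        rw [ha, pow_succ]; linear_combination (-theta * Polynomial.aeval hauptmodul a) * h1
      rw [map_sub, map_mul, aeval_hypPoly, aeval_eq_of_form hb]
      refine ⟨-(thetaInv ^ p * ex * α1) * ex, - β2 * Polynomial.aeval hauptmodul a
        + β1 * thetaInv ^ p * (thetaSymm p p + C ((p : ℤ) ^ 2) * ex * thetaSymm p (q + 1)), ?_⟩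
      rw [hE, hα1, map_pow, map_pow]
      linear_combination ha2 - Polynomial.aeval hauptmodul a * hβ2 + thetaInv ^ p *
        (thetaSymm p p + C (p : ℤ) ^ 2 * ex * (C (p : ℤ) * α1)) * hβ1
    refine C_dvd_of_aeval_hauptmodul (N := p) (β := Polynomial.aeval hauptmodul w * β)
      (α := Polynomial.aeval hauptmodul w * α -
        Polynomial.aeval hauptmodul (a' ^ 3 * hypPoly p)) ?_ ?_
    · have : hypPoly p - b * w = w * (a * hypPoly p - b)
          - Polynomial.C ((p : ℤ) ^ 3) * (a' ^ 3 * hypPoly p) := by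
        rw [map_pow]; linear_combination -hypPoly p * haw
      rw [this, map_sub, map_mul, map_mul _ (Polynomial.C _), hαβ, hCA]
      push_cast
      ring
    · have hwdeg : w.natDegree ≤ 2 * ((p + 1) / 4) := by
        have h1 : (Polynomial.C (p : ℤ) * a').natDegree ≤ (p + 1) / 4 :=
          (Polynomial.natDegree_C_mul_le _ _).trans ha'deg
        refine Polynomial.natDegree_add_le_of_degree_le
          ((Polynomial.natDegree_sub_le _ _).trans (max_le (by simp) (h1.trans (by omega)))) ?_
        exact (Polynomial.natDegree_pow_le).trans (Nat.mul_le_mul_left 2 h1)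
      refine (Polynomial.natDegree_sub_le _ _).trans_lt (max_lt (natDegree_hypPoly_lt (by omega)) ?_)
      refine (Polynomial.natDegree_mul_le).trans_lt ?_
      omega
  refine ⟨a, b, e, a', b * a' ^ 3 + a * r, ?_, hb, ?_, ha1, ?_⟩
  · rw [coeff_modularPoly_succ, thetaSymm_eq_zero p (Nat.lt_succ_self p), zero_add, mul_assoc, ← ha]
  · exact he
  · push_cast at hr
    rw [map_pow] at hr
    linear_combination a * hr + b * haw

end QuarticHypergeometric

namespace QuarticHypergeometric

open PowerSeries Complex Filter Topology

lemma IConv.sum {ι : Type*} (s : Finset ι) {f : ι → ℤ⟦X⟧} (h : ∀ i ∈ s, IConv (f i)) :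
    IConv (∑ i ∈ s, f i) := by
  classical
  induction s using Finset.induction_on with
  | empty => simpa using iconv_C 0
  | insert a s ha ih =>
    rw [Finset.sum_insert ha]
    exact (h a (Finset.mem_insert_self a s)).add
      (ih fun i hi => h i (Finset.mem_insert_of_mem hi))

lemma val_sum {ι : Type*} (s : Finset ι) {f : ι → ℤ⟦X⟧} (h : ∀ i ∈ s, IConv (f i)) {τ : ℂ}
    (hτ : 0 < τ.im) : val (∑ i ∈ s, f i) τ = ∑ i ∈ s, val (f i) τ := by
  classical
  induction s using Finset.induction_on with
  | empty => simpa using val_C 0 τ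
  | insert a s ha ih =>
    rw [Finset.sum_insert ha, Finset.sum_insert ha, val_add (h a (Finset.mem_insert_self a s))
      (IConv.sum s fun i hi => h i (Finset.mem_insert_of_mem hi)) hτ,
      ih fun i hi => h i (Finset.mem_insert_of_mem hi)]

lemma val_eq_of_polynomial {k : ℕ} {φ : ℤ⟦X⟧} {ε : Polynomial ℤ} (hφ : IConv φ)
    (h : φ = theta ^ k * Polynomial.aeval hauptmodul ε) {τ : ℂ} (hτ : 0 < τ.im)
    (h0 : val theta τ ≠ 0) :
    val φ τ = val theta τ ^ k * Polynomial.aeval (val delta τ / val theta τ ^ 4) ε := by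
  set M := ε.natDegree
  have h1 : theta ^ (4 * M) * φ =
      ∑ i ∈ Finset.range (M + 1), C (ε.coeff i) * (theta ^ (k + 4 * (M - i)) * delta ^ i) := by
    rw [h, Polynomial.aeval_eq_sum_range, Finset.mul_sum, Finset.mul_sum]
    refine Finset.sum_congr rfl fun i hi => ?_
    have hi' := Finset.mem_range.1 hi
    rw [← hauptmodul_mul, show theta ^ (4 * M) = theta ^ (4 * (M - i)) * theta ^ (4 * i) by
      rw [← pow_add]; congr 1; omega, smul_eq_C_mul]
    ring
  have hT : ∀ i ∈ Finset.range (M + 1),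
      IConv (C (ε.coeff i) * (theta ^ (k + 4 * (M - i)) * delta ^ i)) := fun i _ =>
    (iconv_C _).mul ((iconv_theta.pow _).mul (iconv_delta.pow _))
  have h2 := congrArg (val · τ) h1
  rw [val_mul (iconv_theta.pow _) hφ hτ, val_pow iconv_theta hτ, val_sum _ hT hτ] at h2
  refine mul_left_cancel₀ (pow_ne_zero (4 * M) h0) (h2.trans ?_)
  rw [Polynomial.aeval_eq_sum_range, Finset.mul_sum, Finset.mul_sum]
  refine Finset.sum_congr rfl fun i hi => ?_
  have hi' := Finset.mem_range.1 hi
  rw [val_mul (iconv_C _) ((iconv_theta.pow _).mul (iconv_delta.pow _)) hτ, val_C,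
    val_mul (iconv_theta.pow _) (iconv_delta.pow _) hτ, val_pow iconv_theta hτ,
    val_pow iconv_delta hτ, zsmul_eq_mul, div_pow, ← pow_mul,
    show val theta τ ^ (4 * M) = val theta τ ^ (4 * (M - i)) * val theta τ ^ (4 * i) by
      rw [← pow_add]; congr 1; omega]
  field_simp
  ring

lemma sum_coeff_prod_one_add_eq_zero {ι R : Type*} [CommRing R] [DecidableEq ι] (s : Finset ι)
    (c : ι → R) {o : ι} (ho : o ∈ s) :
    ∑ k ∈ Finset.range (s.card + 1), (-1) ^ k * c o ^ (s.card - k) *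
      (∏ i ∈ s, (1 + Polynomial.C (c i) * Polynomial.X)).coeff k = 0 := by
  set Q := ∏ i ∈ s.erase o, (1 + Polynomial.C (c i) * Polynomial.X) with hQ
  have hQdeg : Q.natDegree < s.card := by
    refine (Polynomial.natDegree_prod_le _ _).trans_lt ?_
    refine (Finset.sum_le_card_nsmul _ _ 1 fun i _ => ?_).trans_lt ?_
    · exact (Polynomial.natDegree_add_le _ _).trans
        (max_le (by simp) ((Polynomial.natDegree_C_mul_le _ _).trans Polynomial.natDegree_X_le))
    · rw [smul_eq_mul, mul_one, Finset.card_erase_of_mem ho]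
      exact Nat.sub_one_lt (Finset.card_pos.2 ⟨o, ho⟩).ne'
  rw [← Finset.mul_prod_erase s _ ho, ← hQ]
  have key : ∀ m ≤ s.card, ∑ k ∈ Finset.range (m + 1), (-1) ^ k * c o ^ (s.card - k) *
      ((1 + Polynomial.C (c o) * Polynomial.X) * Q).coeff k =
      (-1) ^ m * c o ^ (s.card - m) * Q.coeff m := by
    intro m hm
    induction m with
    | zero => simp [Polynomial.mul_coeff_zero]
    | succ m ih =>
      rw [Finset.sum_range_succ, ih (by omega), add_mul, one_mul, Polynomial.coeff_add,
        mul_assoc (Polynomial.C _), Polynomial.coeff_C_mul, Polynomial.coeff_X_mul,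
        show s.card - m = s.card - (m + 1) + 1 by omega]
      ring
  rw [key _ le_rfl, Polynomial.coeff_eq_zero_of_natDegree_lt hQdeg, mul_zero]

/-- The point of discriminant `-20` fixed by the form `2 x ^ 2 - 2 x y + 3 y ^ 2`. -/
noncomputable def cmPoint : ℂ := (1 + √5 * I) / 2

lemma sqrt_five_mul_I_sq : ((√5 : ℝ) * I : ℂ) ^ 2 = -5 := by
  rw [mul_pow, I_sq, ← ofReal_pow, Real.sq_sqrt (by norm_num)]
  norm_num

lemma cmPoint_im_pos : 0 < cmPoint.im := by
  simp [cmPoint]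

lemma two_mul_cmPoint_sq : 2 * cmPoint ^ 2 = 2 * cmPoint - 3 := by
  rw [cmPoint]
  linear_combination (1 / 2 : ℂ) * sqrt_five_mul_I_sq

variable {p : ℕ} [hp : Fact p.Prime]

lemma sum_val_coeff_modularPoly {τ : ℂ} (hτ : 0 < τ.im) (o : Option (ZMod p)) :
    ∑ k ∈ Finset.range (p + 2), (-1) ^ k * conjugate p τ o ^ (p + 1 - k) *
      val ((modularPoly p).coeff k) τ = 0 := by
  classical
  have h := sum_coeff_prod_one_add_eq_zero Finset.univ (conjugate p τ) (Finset.mem_univ o)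
  rw [Finset.card_univ, Fintype.card_option, ZMod.card] at h
  rw [← h]
  exact Finset.sum_congr rfl fun k _ => by rw [val_coeff_modularPoly p hτ k]

lemma exists_conjugate_cmPoint (hp2 : p ≠ 2) {u v : ℤ}
    (huv : (p : ℤ) = 2 * u ^ 2 + 2 * u * v + 3 * v ^ 2) :
    ∃ o, (2 * u + 2 * v * cmPoint) ^ 2 * conjugate p cmPoint o =
      -2 * p ^ 2 * val theta cmPoint := by
  have hpZ : Prime (p : ℤ) := Nat.prime_iff_prime_int.1 hp.out
  have hp0 : (p : ℂ) ≠ 0 := by exact_mod_cast hp.out.ne_zero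
  have hv : ¬ (p : ℤ) ∣ v := by
    rintro ⟨m, rfl⟩
    have h2 : (p : ℤ) ∣ 2 * u ^ 2 := ⟨1 - 2 * u * m - 3 * p * m ^ 2, by linear_combination -huv⟩
    obtain ⟨l, rfl⟩ : (p : ℤ) ∣ u := by
      refine hpZ.dvd_of_dvd_pow ((hpZ.dvd_or_dvd h2).resolve_left fun h => hp2 ?_)
      exact (Nat.prime_dvd_prime_iff_eq hp.out Nat.prime_two).1 (by exact_mod_cast h)
    have h3 : (p : ℤ) * (2 * l ^ 2 + 2 * l * m + 3 * m ^ 2) = 1 :=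
      mul_left_cancel₀ hpZ.ne_zero (by linear_combination -huv)
    exact hpZ.not_isUnit (.of_mul_eq_one _ h3)
  have hv' : (v : ZMod p) ≠ 0 := by rwa [Ne, ZMod.intCast_zmod_eq_zero_iff_dvd]
  set j := ((u : ZMod p) / v).val with hj
  obtain ⟨d, hd⟩ : (p : ℤ) ∣ u - v * j := by
    rw [← ZMod.intCast_zmod_eq_zero_iff_dvd]
    push_cast
    rw [hj, ZMod.natCast_zmod_val, mul_div_cancel₀ _ hv', sub_self]
  obtain ⟨b, hb⟩ : (p : ℤ) ∣ (2 * u + 2 * v) * j + 3 * v := by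
    refine (hpZ.dvd_or_dvd (a := v) ⟨1 - (2 * u + 2 * v) * d, ?_⟩).resolve_left hv
    linear_combination -huv - (2 * u + 2 * v) * hd
  have hdC : (u - v * j : ℂ) = p * d := by exact_mod_cast hd
  have hbC : ((2 * u + 2 * v) * j + 3 * v : ℂ) = p * b := by exact_mod_cast hb
  have huvC : (p : ℂ) = 2 * u ^ 2 + 2 * u * v + 3 * v ^ 2 := by exact_mod_cast huv
  have hdet : 2 * (u + v) * d - (-b) * v = 1 := by
    refine mul_left_cancel₀ hpZ.ne_zero ?_
    linear_combination -(2 * (u + v)) * hd - v * hb - huv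
  have hpi : (2 * u + 2 * v * cmPoint : ℂ) ≠ 0 := by
    intro h
    have := congrArg Complex.im h
    have hv0 : v ≠ 0 := fun h => hv (h ▸ dvd_zero _)
    simp [cmPoint, hv0] at this
  have hden : (v * ((cmPoint + j) / p) + d : ℂ) = (2 * u + 2 * v * cmPoint) / (2 * p) := by
    field_simp
    linear_combination -hdC
  have h := val_theta_atkinLehner (a := u + v) (b := -b) (c := v) (d := d)
    (σ := (cmPoint + j) / p) (τ := cmPoint) hdet (add_div_im_pos (p := p) cmPoint_im_pos j)
    cmPoint_im_pos (by
      rw [hden, eq_div_iff (mul_ne_zero two_ne_zero (div_ne_zero hpi (mul_ne_zero two_ne_zero hp0)))]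
      push_cast
      field_simp
      linear_combination v * two_mul_cmPoint_sq - hbC)
  refine ⟨some (u / v), ?_⟩
  rw [hden] at h
  simp only [conjugate, ← hj, h]
  field_simp

lemma sum_modular_eq_zero (hp2 : p ≠ 2) {u v : ℤ}
    (huv : (p : ℤ) = 2 * u ^ 2 + 2 * u * v + 3 * v ^ 2) (h0 : val theta cmPoint ≠ 0)
    {ε : ℕ → Polynomial ℤ}
    (hε : ∀ k, (modularPoly p).coeff k = theta ^ k * Polynomial.aeval hauptmodul (ε k)) :
    ∑ k ∈ Finset.range (p + 2), (-1) ^ k * (-2 * p ^ 2 : ℂ) ^ (p + 1 - k) *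
      (2 * u + 2 * v * cmPoint) ^ (2 * k) *
      Polynomial.aeval (val delta cmPoint / val theta cmPoint ^ 4) (ε k) = 0 := by
  obtain ⟨o, ho⟩ := exists_conjugate_cmPoint hp2 huv
  have h := sum_val_coeff_modularPoly cmPoint_im_pos o
  refine mul_left_cancel₀ (pow_ne_zero (p + 1) h0) ?_
  rw [mul_zero, ← mul_zero ((2 * u + 2 * v * cmPoint) ^ (2 * (p + 1)) : ℂ), ← h, Finset.mul_sum,
    Finset.mul_sum]
  refine Finset.sum_congr rfl fun k hk => ?_
  have hk' := Finset.mem_range.1 hk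
  rw [val_eq_of_polynomial (iconv_coeff_modularPoly p k) (hε k) cmPoint_im_pos h0]
  obtain ⟨l, hl⟩ : ∃ l, p + 1 = k + l := ⟨p + 1 - k, by omega⟩
  rw [hl, Nat.add_sub_cancel_left, mul_add, pow_add, pow_add]
  have h3 := congrArg (· ^ l) ho
  simp only [mul_pow] at h3
  rw [← pow_mul] at h3
  simp only [mul_pow]
  linear_combination -(-1) ^ k * (2 * u + 2 * v * cmPoint) ^ (2 * k) * val theta cmPoint ^ k *
    Polynomial.aeval (val delta cmPoint / val theta cmPoint ^ 4) (ε k) * h3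

end QuarticHypergeometric

namespace QuarticHypergeometric

open PowerSeries Complex Filter Topology

lemma coeff_two_theta : coeff 2 theta = 24 := by
  rw [theta, map_sub, ← smul_eq_C_mul, map_smul, show coeff 2 (PowerSeries.expand 2 two_ne_zero
    e2Series) = coeff 1 e2Series from coeff_expand_mul 2 two_ne_zero _ 1]
  have : ArithmeticFunction.sigma 1 2 = 3 := by decide
  simp [e2Series, this]

lemma coeff_three_theta : coeff 3 theta = 96 := by
  rw [theta, map_sub, ← smul_eq_C_mul, map_smul, coeff_expand_of_not_dvd _ _ _ (by norm_num)]
  have : ArithmeticFunction.sigma 1 3 = 4 := by decide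
  simp [e2Series, this]

lemma constantCoeff_thetaSymm (p : ℕ) [hp : Fact p.Prime] (k : ℕ) :
    constantCoeff (thetaSymm p k) = p.choose k := by
  have h := congrArg constantCoeff (expand_thetaSymm p k)
  rw [constantCoeff_expand] at h
  have h2 : ((constantCoeff (thetaSymm p k) : ℤ) : ℂ) = constantCoeff (toC (thetaSymm p k)) := by
    rw [← coeff_zero_eq_constantCoeff_apply, ← coeff_zero_eq_constantCoeff_apply, toC, coeff_map]
    rfl
  have h3 : (∏ i ∈ Finset.range p, (1 + Polynomial.C (rescale (rootOfUnity p ^ i) (toC theta)) *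
      Polynomial.X)).map constantCoeff = (1 + Polynomial.X) ^ p := by
    rw [Polynomial.map_prod, Finset.prod_congr rfl fun i _ => ?_, Finset.prod_const,
      Finset.card_range]
    have : constantCoeff (rescale (rootOfUnity p ^ i) (toC theta)) = 1 := by
      rw [← coeff_zero_eq_constantCoeff_apply, coeff_rescale]
      simp [toC, constantCoeff_theta]
    simp [this]
  rw [← h2, ← Polynomial.coeff_map, h3, Polynomial.coeff_one_add_X_pow] at h
  exact_mod_cast h

lemma coeff_one_thetaSymm_three : coeff 1 (thetaSymm 3 3) = 12384 := by
  have h := congrArg (coeff 3) (expand_thetaSymm 3 3)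
  rw [show coeff 3 (PowerSeries.expand 3 Nat.prime_three.ne_zero (toC (thetaSymm 3 3))) =
    coeff 1 (toC (thetaSymm 3 3)) from coeff_expand_mul 3 _ _ 1] at h
  have h2 : ((coeff 1 (thetaSymm 3 3) : ℤ) : ℂ) = coeff 1 (toC (thetaSymm 3 3)) := by simp [toC]
  set ζ := rootOfUnity 3
  have hζ := isPrimitiveRoot_rootOfUnity 3
  have hζ2 : 1 + ζ + ζ ^ 2 = 0 := by
    have := hζ.geom_sum_eq_zero (by norm_num)
    simpa [Finset.sum_range_succ] using this
  have h3 : ∀ a b c : ℂ⟦X⟧, ((1 + Polynomial.C a * Polynomial.X) *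
      (1 + Polynomial.C b * Polynomial.X) * (1 + Polynomial.C c * Polynomial.X)).coeff 3 =
      a * b * c := by
    intro a b c
    have : (1 + Polynomial.C a * Polynomial.X) *
      (1 + Polynomial.C b * Polynomial.X) * (1 + Polynomial.C c * Polynomial.X) =
      1 + Polynomial.C (a + b + c) * Polynomial.X +
      Polynomial.C (a * b + b * c + c * a) * Polynomial.X ^ 2 +
      Polynomial.C (a * b * c) * Polynomial.X ^ 3 := by
      simp only [map_add, map_mul]; ring
    rw [this]
    simp only [Polynomial.coeff_add, Polynomial.coeff_C_mul, Polynomial.coeff_X_pow,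
      Polynomial.coeff_X, Polynomial.coeff_one]
    simp
  rw [← h2, Finset.prod_range_succ, Finset.prod_range_succ, Finset.prod_range_one, h3] at h
  have hc : ∀ n, coeff n (toC theta) = ((coeff n theta : ℤ) : ℂ) := fun n => by simp [toC]
  have hc0 : coeff 0 theta = 1 := by
    rw [coeff_zero_eq_constantCoeff_apply, constantCoeff_theta]
  simp only [coeff_mul, Finset.Nat.sum_antidiagonal_eq_sum_range_succ_mk, Finset.sum_range_succ,
    Finset.range_zero, Finset.sum_empty, coeff_rescale, hc, Nat.reduceSub,
    hc0, coeff_one_theta, coeff_two_theta, coeff_three_theta] at h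
  have : ((coeff 1 (thetaSymm 3 3) : ℤ) : ℂ) = (12384 : ℤ) := by
    rw [h]
    push_cast
    linear_combination (96 * ζ ^ 4 + 480 * ζ ^ 3 + 576 * ζ ^ 2 + 12864 * ζ - 12288) * hζ2
  exact_mod_cast this

lemma IsForm.eq_C_mul {k : ℕ} {φ : ℤ⟦X⟧} (h : IsForm k φ) (hk : k < 4) :
    φ = C (constantCoeff φ) * theta ^ k := by
  obtain ⟨c, hc⟩ := h.exists_coeffs
  rw [Nat.div_eq_of_lt hk, zero_add, Finset.sum_range_one, mul_zero, Nat.sub_zero, pow_zero,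
    mul_one] at hc
  rw [hc]
  simp [constantCoeff_theta]

lemma IsForm.eq_of_weight_four {φ : ℤ⟦X⟧} (h : IsForm 4 φ) :
    φ = C (constantCoeff φ) * theta ^ 4 + C (coeff 1 φ - 96 * constantCoeff φ) * delta := by
  obtain ⟨c, hc⟩ := h.exists_coeffs
  simp only [Nat.reduceDiv, Nat.reduceAdd, Finset.sum_range_succ, Finset.range_zero,
    Finset.sum_empty, zero_add, mul_zero, Nat.sub_zero, pow_zero, mul_one, Nat.sub_self,
    pow_one] at hc
  have h0 : constantCoeff φ = c 0 := by
    rw [hc]; simp [constantCoeff_theta, constantCoeff_delta]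
  have h1 : coeff 1 φ = 96 * c 0 + c 1 := by
    have h4 : theta ^ 4 = (theta * theta) * (theta * theta) := by ring
    rw [hc, h4]
    simp only [map_add, coeff_one_mul', coeff_one_theta, coeff_one_delta, constantCoeff_theta,
      constantCoeff_delta, constantCoeff_C, map_mul, coeff_C]
    norm_num
    ring
  rw [h0, h1, add_sub_cancel_left]
  exact hc

lemma val_theta_cmPoint_pow : val theta cmPoint ^ 4 = -1024 * val delta cmPoint := by
  have hp2 : (3 : ℕ) ≠ 2 := by norm_num
  obtain ⟨o, ho⟩ := exists_conjugate_cmPoint (p := 3) hp2 (u := 0) (v := 1) (by norm_num)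
  have h := sum_val_coeff_modularPoly cmPoint_im_pos o
  have hC : ∀ n, constantCoeff ((modularPoly 3).coeff (n + 1)) =
      (3 : ℕ).choose (n + 1) + 9 * (3 : ℕ).choose n := fun n => by
    rw [coeff_modularPoly_succ, map_add, map_mul, map_mul, constantCoeff_C, constantCoeff_expand,
      constantCoeff_theta, constantCoeff_thetaSymm, constantCoeff_thetaSymm]
    norm_num
  have hv : ∀ n < 4, val ((modularPoly 3).coeff n) cmPoint =
      (constantCoeff ((modularPoly 3).coeff n) : ℤ) * val theta cmPoint ^ n := fun n hn => by
    rw [(isForm_coeff_modularPoly hp2 n).eq_C_mul hn, val_mul (iconv_C _) (iconv_theta.pow n)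
      cmPoint_im_pos, val_C, val_pow iconv_theta cmPoint_im_pos]
    simp [constantCoeff_theta]
  have h1 : coeff 1 ((modularPoly 3).coeff 4) = 9 * 12384 := by
    rw [coeff_modularPoly_succ 3 3, thetaSymm_eq_zero 3 (by norm_num), zero_add, mul_assoc,
      coeff_C_mul, coeff_one_mul', coeff_expand_of_not_dvd _ _ _ (by norm_num),
      coeff_one_thetaSymm_three, constantCoeff_expand, constantCoeff_theta]
    norm_num
  have hv4 : val ((modularPoly 3).coeff 4) cmPoint =
      9 * val theta cmPoint ^ 4 + 110592 * val delta cmPoint := by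
    have h0 := hC 3
    norm_num at h0
    rw [(isForm_coeff_modularPoly hp2 4).eq_of_weight_four, h0, h1,
      val_add ((iconv_C _).mul (iconv_theta.pow 4)) ((iconv_C _).mul iconv_delta) cmPoint_im_pos,
      val_mul (iconv_C _) (iconv_theta.pow 4) cmPoint_im_pos,
      val_mul (iconv_C _) iconv_delta cmPoint_im_pos, val_C, val_C,
      val_pow iconv_theta cmPoint_im_pos]
    norm_num
  have hv0 := hv 0 (by norm_num)
  have hv1 := hv 1 (by norm_num)
  have hv2 := hv 2 (by norm_num)
  have hv3 := hv 3 (by norm_num)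
  rw [coeff_modularPoly_zero, map_one] at hv0
  rw [hC 0] at hv1
  rw [hC 1] at hv2
  rw [hC 2] at hv3
  have hc : conjugate 3 cmPoint o = (2 * cmPoint + 1) * val theta cmPoint := by
    push_cast at ho
    linear_combination (-1 / 18 : ℂ) * (2 * cmPoint + 1) * ho +
      (1 / 18 : ℂ) * (4 * cmPoint + 6) * conjugate 3 cmPoint o * two_mul_cmPoint_sq
  simp only [Finset.sum_range_succ, Finset.range_zero, Finset.sum_empty, Nat.reduceAdd,
    coeff_modularPoly_zero, hv1, hv2, hv3, hv0, hv4, hc] at h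
  norm_num [Nat.choose] at h
  linear_combination (1 / 108 : ℂ) * h - (1 / 108 : ℂ) * val theta cmPoint ^ 4 *
    (8 * cmPoint ^ 2 - 24 * cmPoint - 36) * two_mul_cmPoint_sq

lemma val_theta_cmPoint_ne_zero : val theta cmPoint ≠ 0 := fun h => by
  have h1 := val_theta_cmPoint_pow
  rw [h, zero_pow four_ne_zero] at h1
  exact val_delta_ne_zero cmPoint_im_pos (by linear_combination (1 / 1024 : ℂ) * h1)

lemma val_delta_div_theta_cmPoint : val delta cmPoint / val theta cmPoint ^ 4 = -1 / 1024 := by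
  rw [div_eq_iff (pow_ne_zero 4 val_theta_cmPoint_ne_zero), val_theta_cmPoint_pow]
  ring

end QuarticHypergeometric

namespace QuarticHypergeometric

open PowerSeries Complex Filter Topology

lemma aeval_eq_zero_of_sq_eq_neg_five {H : Polynomial ℚ}
    (h : Polynomial.aeval (√5 * I : ℂ) H = 0) {K : Type*} [Field K] [Algebra ℚ K] {s : K}
    (hs : s ^ 2 = -5) : Polynomial.aeval s H = 0 := by
  have hm : (Polynomial.X ^ 2 + Polynomial.C 5 : Polynomial ℚ).Monic :=
    Polynomial.monic_X_pow_add_C 5 two_ne_zero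
  have hdeg : (H %ₘ (Polynomial.X ^ 2 + Polynomial.C 5)).natDegree ≤ 1 := by
    refine Nat.lt_succ_iff.1 ((Polynomial.natDegree_modByMonic_lt _ hm fun h1 => ?_).trans_eq
      (Polynomial.natDegree_X_pow_add_C))
    have := congrArg Polynomial.natDegree h1
    rw [Polynomial.natDegree_X_pow_add_C] at this
    simp at this
  obtain ⟨a, b, hab⟩ := Polynomial.exists_eq_X_add_C_of_natDegree_le_one hdeg
  have hH := Polynomial.modByMonic_add_div H (Polynomial.X ^ 2 + Polynomial.C 5)
  rw [hab] at hH
  have h1 : (a * (√5 * I) + b : ℂ) = 0 := by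
    rw [← h, ← hH]
    simp only [map_add, map_mul, map_pow, Polynomial.aeval_X, Polynomial.aeval_C,
      sqrt_five_mul_I_sq]
    simp
  have ha : a = 0 := by simpa using congrArg Complex.im h1
  have hb : b = 0 := by simpa [ha] using h1
  rw [← hH, ha, hb]
  simp [hs]

variable {p : ℕ} [hp : Fact p.Prime]

lemma sum_modular_padic_eq_zero (hp2 : p ≠ 2) {u v : ℤ}
    (huv : (p : ℤ) = 2 * u ^ 2 + 2 * u * v + 3 * v ^ 2) {ε : ℕ → Polynomial ℤ}
    (hε : ∀ k, (modularPoly p).coeff k = theta ^ k * Polynomial.aeval hauptmodul (ε k))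
    {s t : ℤ_[p]} (hs : s ^ 2 = -5) (ht : 1024 * t = -1) :
    ∑ k ∈ Finset.range (p + 2), (-1) ^ k * (-2 * p ^ 2 : ℤ_[p]) ^ (p + 1 - k) *
      (2 * u + v * (1 + s)) ^ (2 * k) * Polynomial.aeval t (ε k) = 0 := by
  set H : Polynomial ℚ := ∑ k ∈ Finset.range (p + 2),
    (-1) ^ k * (-2 * p ^ 2 : Polynomial ℚ) ^ (p + 1 - k) *
      (2 * (u : Polynomial ℚ) + (v : Polynomial ℚ) * (1 + Polynomial.X)) ^ (2 * k) *
      Polynomial.C (Polynomial.aeval (-1 / 1024 : ℚ) (ε k)) with hH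
  have hmap : ∀ {K : Type} [Field K] [Algebra ℚ K] (x : K), Polynomial.aeval x H =
      ∑ k ∈ Finset.range (p + 2), (-1) ^ k * (-2 * p ^ 2 : K) ^ (p + 1 - k) *
        (2 * u + v * (1 + x)) ^ (2 * k) * Polynomial.aeval (-1 / 1024 : K) (ε k) := by
    intro K _ _ x
    rw [hH, map_sum]
    refine Finset.sum_congr rfl fun k _ => ?_
    have : Polynomial.aeval (-1 / 1024 : K) (ε k) =
        algebraMap ℚ K (Polynomial.aeval (-1 / 1024 : ℚ) (ε k)) := by
      rw [← Polynomial.aeval_algebraMap_apply]; simp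
    have h2 : Polynomial.aeval x (2 : Polynomial ℚ) = 2 := map_ofNat _ 2
    rw [this]
    simp [h2]
  have h0 : Polynomial.aeval (√5 * I : ℂ) H = 0 := by
    rw [hmap, ← sum_modular_eq_zero hp2 huv val_theta_cmPoint_ne_zero hε,
      val_delta_div_theta_cmPoint]
    refine Finset.sum_congr rfl fun k _ => ?_
    rw [show (2 * v * cmPoint : ℂ) = v * (1 + √5 * I) by rw [cmPoint]; ring]
  have hsQ : (s : ℚ_[p]) ^ 2 = -5 := by exact_mod_cast congrArg ((↑) : ℤ_[p] → ℚ_[p]) hs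
  have htQ : (t : ℚ_[p]) = -1 / 1024 := by
    rw [eq_div_iff (by norm_num), mul_comm]
    exact_mod_cast congrArg ((↑) : ℤ_[p] → ℚ_[p]) ht
  have h1 := aeval_eq_zero_of_sq_eq_neg_five h0 hsQ
  rw [hmap, ← htQ] at h1
  refine PadicInt.coe_eq_zero.1 ((Eq.trans ?_ h1))
  have hcoe : ∀ k, Polynomial.aeval (t : ℚ_[p]) (ε k) = (Polynomial.aeval t (ε k) : ℤ_[p]) :=
    fun k => Polynomial.aeval_algebraMap_apply ℚ_[p] t (ε k)
  simp only [hcoe]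
  rw [PadicInt.coe_sum]
  push_cast
  rfl

/-- The congruence modulo `p ^ 3`, with the denominators cleared. -/
theorem dvd_two_mul_hypPoly_add_sq (hp2 : p ≠ 2) {u v : ℤ}
    (huv : (p : ℤ) = 2 * u ^ 2 + 2 * u * v + 3 * v ^ 2)
    {s t : ℤ_[p]} (hs : s ^ 2 = -5) (ht : 1024 * t = -1)
    (hunit : IsUnit (2 * u + v * (1 + s) : ℤ_[p])) :
    (p : ℤ_[p]) ^ 3 ∣ 2 * Polynomial.aeval t (hypPoly p) + (2 * u + v * (1 + s)) ^ 2 := by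
  obtain ⟨a, b, e, a', r, ha, hb, he, ha', hr⟩ := exists_modular_congruence hp2
  choose ε₀ hε₀ using fun k => (isForm_coeff_modularPoly hp2 k).exists_polynomial
  set ε : ℕ → Polynomial ℤ := fun k => if k = p + 1 then Polynomial.C ((p : ℤ) ^ 2) * a else
    if k = p then b else if k = p - 1 then Polynomial.C (p : ℤ) * e else ε₀ k with hεdef
  have hε : ∀ k, (modularPoly p).coeff k = theta ^ k * Polynomial.aeval hauptmodul (ε k) := by
    intro k
    simp only [hεdef]
    split_ifs with h1 h2 h3
    · rw [h1, ha, map_mul, Polynomial.aeval_C]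
      change C _ * _ = _ * (C _ * _)
      ring
    · rw [h2, hb]
    · rw [h3, he]
    · exact (hε₀ k).2
  have h := sum_modular_padic_eq_zero hp2 huv hε hs ht
  have hodd : Odd p := hp.out.odd_of_ne_two hp2
  rw [Finset.sum_range_succ, Finset.sum_range_succ] at h
  set π : ℤ_[p] := 2 * u + v * (1 + s)
  obtain ⟨x, hx⟩ : (p : ℤ_[p]) ^ 5 ∣ ∑ k ∈ Finset.range p, (-1) ^ k *
      (-2 * p ^ 2 : ℤ_[p]) ^ (p + 1 - k) * π ^ (2 * k) * Polynomial.aeval t (ε k) := by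
    refine Finset.dvd_sum fun k hk => ?_
    have hk' := Finset.mem_range.1 hk
    rcases eq_or_ne k (p - 1) with rfl | hk1
    · have : ε (p - 1) = Polynomial.C (p : ℤ) * e := by
        simp only [hεdef]
        rw [if_neg (by omega), if_neg (by omega)]
        exact if_pos trivial
      rw [this, map_mul, Polynomial.aeval_C, show p + 1 - (p - 1) = 2 by omega]
      simp only [algebraMap_int_eq, eq_intCast, Int.cast_natCast]
      exact ⟨(-1) ^ (p - 1) * 4 * π ^ (2 * (p - 1)) * Polynomial.aeval t e, by ring⟩
    · refine Dvd.dvd.mul_right (Dvd.dvd.mul_right (Dvd.dvd.mul_left ?_ _) _) _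
      rw [mul_pow, ← pow_mul]
      exact (pow_dvd_pow _ (by omega)).mul_left _
  have hεp : ε p = b := by
    simp only [hεdef]
    rw [if_neg (by omega)]
    exact if_pos trivial
  have hεp1 : ε (p + 1) = Polynomial.C ((p : ℤ) ^ 2) * a := if_pos rfl
  rw [hx, hεp, hεp1, Nat.sub_self, Nat.add_sub_cancel_left, hodd.neg_one_pow,
    hodd.add_one.neg_one_pow, map_mul, Polynomial.aeval_C] at h
  simp only [algebraMap_int_eq, eq_intCast, Int.cast_natCast, Int.cast_pow] at h
  have hp0 : (p : ℤ_[p]) ≠ 0 := by exact_mod_cast hp.out.ne_zero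
  have h1 : (p : ℤ_[p]) ^ 3 * x +
      π ^ (2 * p) * (Polynomial.aeval t a * π ^ 2 + 2 * Polynomial.aeval t b) = 0 := by
    refine (mul_eq_zero.1 ?_).resolve_left (pow_ne_zero 2 hp0)
    rw [← h]
    ring
  have h2 : (p : ℤ_[p]) ^ 3 ∣ Polynomial.aeval t a * π ^ 2 + 2 * Polynomial.aeval t b :=
    (hunit.pow (2 * p)).dvd_mul_left.1 ⟨-x, by linear_combination h1⟩
  have hrt := congrArg (Polynomial.aeval t) hr
  have hat := congrArg (Polynomial.aeval t) ha'
  simp only [map_add, map_mul, map_pow, map_one, map_natCast] at hrt hat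
  have hcop : IsCoprime ((p : ℤ_[p]) ^ 3) (Polynomial.aeval t a) :=
    .pow_left ⟨-Polynomial.aeval t a', 1, by rw [hat]; ring⟩
  refine hcop.dvd_of_dvd_mul_left ?_
  obtain ⟨y, hy⟩ := h2
  exact ⟨y + 2 * Polynomial.aeval t r, by linear_combination hy + 2 * hrt⟩

lemma isUnit_two_padicInt (hp2 : p ≠ 2) : IsUnit (2 : ℤ_[p]) := by
  have h := (PadicInt.norm_natCast_eq_one_iff (p := p) (n := 2)).2
    ((Nat.coprime_primes hp.out Nat.prime_two).2 hp2)
  exact PadicInt.isUnit_iff.2 (by exact_mod_cast h)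

end QuarticHypergeometric

open Finset

/-- For `p ≡ 3, 7 mod 20` with `p = 2u² + 2uv + 3v²` and `2u + v(1+√-5)` a `p`-adic unit,
`∑_{k<p} (4k)!/k!⁴ (-1/1024)^k ≡ -(1/2)(2u + v(1+√-5))² mod p³`. -/
theorem stmt_8 (p : ℕ) [Fact p.Prime] (hp20 : p % 20 = 3 ∨ p % 20 = 7) (u v : ℤ)
    (s : ℤ_[p]) (hs : s ^ 2 = -5)
    (huv : (p : ℤ) = 2 * u ^ 2 + 2 * u * v + 3 * v ^ 2)
    (hunit : IsUnit (2 * (u : ℤ_[p]) + v * (1 + s))) :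
    (p : ℤ_[p]) ^ 3 ∣
      (∑ k ∈ Finset.range p,
          ((Nat.choose (4 * k) k * Nat.choose (3 * k) k * Nat.choose (2 * k) k : ℤ_[p]) *
            (-(Ring.inverse (1024 : ℤ_[p]))) ^ k))
        - (-(Ring.inverse (2 : ℤ_[p]))) * (2 * (u : ℤ_[p]) + v * (1 + s)) ^ 2 := by
  have hp2 : p ≠ 2 := by rintro rfl; norm_num at hp20
  have h2 := QuarticHypergeometric.isUnit_two_padicInt hp2
  have h1024 : Ring.inverse (1024 : ℤ_[p]) * 1024 = 1 := Ring.inverse_mul_cancel _ (by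
    rw [show (1024 : ℤ_[p]) = 2 ^ 10 by norm_num]; exact h2.pow 10)
  have h := QuarticHypergeometric.dvd_two_mul_hypPoly_add_sq hp2 huv hs
    (t := -Ring.inverse 1024) (by linear_combination -h1024) hunit
  obtain ⟨y, hy⟩ := h
  have hsum : Polynomial.aeval (-Ring.inverse (1024 : ℤ_[p])) (QuarticHypergeometric.hypPoly p) =
      ∑ k ∈ Finset.range p, ((Nat.choose (4*k) k * Nat.choose (3*k) k * Nat.choose (2*k) k :
        ℤ_[p]) * (-(Ring.inverse (1024:ℤ_[p])))^k) := by
    rw [QuarticHypergeometric.hypPoly, map_sum]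
    refine Finset.sum_congr rfl fun k _ => ?_
    simp [QuarticHypergeometric.hypCoeff]
  rw [← hsum]
  exact ⟨Ring.inverse 2 * y, by
    linear_combination Ring.inverse 2 * hy -
      Polynomial.aeval (-Ring.inverse (1024 : ℤ_[p])) (QuarticHypergeometric.hypPoly p) *
        Ring.inverse_mul_cancel _ h2⟩
end

section
/- For every odd prime p, \sum_{k=0}^{p-1} (4k+1) \binom{2k}{k}^3 (-1/64)^k \equiv (-1)^{(p-1)/2} p mod p^3 in Z_p. -/
open Finset

/-- The product `1 * 3 * ⋯ * (2 * n - 1)` of the first `n` odd numbers. -/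
def oddProd (n : ℕ) : ℕ := ∏ j ∈ range n, (2 * j + 1)

theorem oddProd_succ (n : ℕ) : oddProd (n + 1) = oddProd n * (2 * n + 1) :=
  prod_range_succ _ n

theorem oddProd_pos (n : ℕ) : 0 < oddProd n := prod_pos fun _ _ => by positivity

theorem oddProd_dvd_of_le {m n : ℕ} (h : m ≤ n) : oddProd m ∣ oddProd n :=
  prod_dvd_prod_of_subset _ _ _ (range_mono h)

theorem centralBinom_mul_factorial (n : ℕ) :
    (2 * n).choose n * n.factorial = 2 ^ n * oddProd n := by
  induction n with
  | zero => simp [oddProd]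
  | succ n ih =>
    have h := Nat.succ_mul_centralBinom_succ n
    rw [Nat.centralBinom_eq_two_mul_choose, Nat.centralBinom_eq_two_mul_choose] at h
    rw [Nat.factorial_succ, oddProd_succ]
    calc (2 * (n + 1)).choose (n + 1) * ((n + 1) * n.factorial)
        = ((n + 1) * (2 * (n + 1)).choose (n + 1)) * n.factorial := by ring
      _ = 2 * (2 * n + 1) * ((2 * n).choose n * n.factorial) := by rw [h]; ring
      _ = _ := by rw [ih]; ring

theorem pow_three_dvd_oddProd_sub (m : ℕ) :
    ((2 * m + 1 : ℕ) : ℤ) ^ 3 ∣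
      (oddProd (2 * m + 1) : ℤ) - (2 * m + 1 : ℕ) * ((-4) ^ m * (m.factorial : ℤ) ^ 2) := by
  have hsplit : (oddProd (2 * m + 1) : ℤ) = (2 * m + 1 : ℕ) *
      ∏ j ∈ range m, (((2 * m + 1 : ℕ) : ℤ) ^ 2 + -4 * ((j + 1 : ℕ) : ℤ) ^ 2) := by
    rw [oddProd, show 2 * m + 1 = m + 1 + m by ring, prod_range_add, prod_range_succ,
      ← prod_range_reflect]
    push_cast
    rw [mul_right_comm, ← prod_mul_distrib, mul_comm]
    congr 1
    · ring
    · refine prod_congr rfl fun j hj => ?_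
      have hj : j + 1 ≤ m := mem_range.1 hj
      rw [Nat.sub_sub, Nat.cast_sub (by omega)]
      push_cast
      ring
  have hfac : (-4) ^ m * (m.factorial : ℤ) ^ 2 =
      ∏ j ∈ range m, (-4 * ((j + 1 : ℕ) : ℤ) ^ 2) := by
    rw [prod_mul_distrib, prod_pow, ← prod_range_add_one_eq_factorial]
    simp only [prod_const, card_range, Nat.cast_prod]
  rw [hsplit, hfac, ← mul_sub, pow_succ']
  refine mul_dvd_mul_left _ (Int.ModEq.dvd (Int.ModEq.prod fun j _ => ?_))
  simp [Int.modEq_iff_dvd]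

section WZ

variable {K : Type*} [Field K]

/-- Zudilin's summand, with `1 / (n - k)!` written as `n.descFactorial k / n!`. -/
def wzF (K : Type*) [Field K] (n k : ℕ) : K :=
  (-1) ^ (n + k) * (4 * n + 1) * oddProd n ^ 2 * oddProd (n + k) * n.descFactorial k * 2 ^ k /
    (8 ^ n * n.factorial ^ 3 * oddProd k ^ 2)

/-- The Wilf–Zeilberger companion of `wzF`. -/
def wzG (K : Type*) [Field K] (n k : ℕ) : K :=
  (-1) ^ (n + k + 1) * 2 ^ (k + 3) * n ^ 2 * oddProd n ^ 2 * oddProd (n + k) *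
    n.descFactorial (k + 1) / (8 ^ n * n.factorial ^ 3 * oddProd (k + 1) ^ 2)

theorem cast_descFactorial_succ (n k : ℕ) :
    (n.descFactorial (k + 1) : K) = ((n : K) - k) * n.descFactorial k := by
  rcases le_or_gt k n with h | h
  · rw [Nat.descFactorial_succ, Nat.cast_mul, Nat.cast_sub h]
  · rw [Nat.descFactorial_of_lt h, Nat.descFactorial_of_lt (by omega)]
    simp

theorem wzF_sub_wzF [CharZero K] (n k : ℕ) :
    wzF K n k - wzF K n (k + 1) = wzG K (n + 1) k - wzG K n k := by
  have hk : (oddProd k : K) ≠ 0 := Nat.cast_ne_zero.2 (oddProd_pos k).ne'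
  have hk' : (2 * k + 1 : K) ≠ 0 := by exact_mod_cast (2 * k).succ_ne_zero
  have hn : (n.factorial : K) ≠ 0 := Nat.cast_ne_zero.2 n.factorial_ne_zero
  have hn' : (n + 1 : K) ≠ 0 := by exact_mod_cast n.succ_ne_zero
  have h8 : (8 : K) ≠ 0 := by norm_num
  simp only [wzF, wzG, Nat.succ_descFactorial_succ, Nat.cast_mul, cast_descFactorial_succ,
    oddProd_succ, Nat.factorial_succ, show n + 1 + k = n + k + 1 by ring,
    show n + (k + 1) = n + k + 1 by ring]
  push_cast
  field_simp
  ring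

theorem sum_wzF_zero [CharZero K] (N m : ℕ) :
    ∑ n ∈ range N, wzF K n 0 = ∑ n ∈ range N, wzF K n m + ∑ k ∈ range m, wzG K N k := by
  induction m with
  | zero => simp
  | succ m ih =>
    have h : ∑ n ∈ range N, wzF K n m - ∑ n ∈ range N, wzF K n (m + 1) = wzG K N m := by
      rw [← sum_sub_distrib, sum_congr rfl fun n _ => wzF_sub_wzF n m,
        sum_range_sub (fun n => wzG K n m)]
      simp [wzG]
    rw [ih, sum_range_succ, ← h]
    ring

theorem wzF_zero [CharZero K] (n : ℕ) :
    wzF K n 0 = (4 * n + 1 : ℕ) * ((2 * n).choose n : K) ^ 3 * (-(64 : K)⁻¹) ^ n := by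
  have hn : (n.factorial : K) ≠ 0 := Nat.cast_ne_zero.2 n.factorial_ne_zero
  have h8 : (8 : K) ≠ 0 := by norm_num
  have h : ((2 * n).choose n : K) = 2 ^ n * oddProd n / n.factorial := by
    rw [eq_div_iff hn]
    exact_mod_cast centralBinom_mul_factorial n
  have h64 : (-(64 : K)⁻¹) ^ n = (-1) ^ n / ((2 ^ n) ^ 3 * 8 ^ n) := by
    rw [← pow_mul, mul_comm n, pow_mul, ← mul_pow, ← div_pow]
    norm_num
  rw [h, h64, wzF]
  have h2 : (2 : K) ≠ 0 := by norm_num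
  simp only [oddProd, prod_range_zero, Nat.descFactorial_zero, add_zero]
  push_cast
  field_simp

theorem sum_wzF_diag [CharZero K] (m : ℕ) :
    ∑ n ∈ range (m + 1), wzF K n m = oddProd (2 * m + 1) / (4 ^ m * (m.factorial : K) ^ 2) := by
  have hm : (m.factorial : K) ≠ 0 := Nat.cast_ne_zero.2 m.factorial_ne_zero
  have hk : (oddProd m : K) ≠ 0 := Nat.cast_ne_zero.2 (oddProd_pos m).ne'
  have h2 : (2 : K) ≠ 0 := by norm_num
  have h4 : (4 : K) ≠ 0 := by norm_num
  rw [sum_range_succ, sum_eq_zero, zero_add, wzF, Nat.descFactorial_self, oddProd_succ,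
    ← two_mul, pow_mul, show (8 : K) ^ m = 2 ^ m * 4 ^ m by rw [← mul_pow]; norm_num]
  · push_cast
    field_simp
    ring
  · intro n hn
    simp [wzF, Nat.descFactorial_of_lt (mem_range.1 hn)]

end WZ

theorem Padic.norm_natCast_eq_one_of_not_dvd {p : ℕ} [Fact p.Prime] {n : ℕ} (h : ¬ p ∣ n) :
    ‖(n : ℚ_[p])‖ = 1 :=
  Padic.norm_natCast_eq_one_iff.2 ((Nat.Prime.coprime_iff_not_dvd Fact.out).2 h)

theorem not_dvd_oddProd {p k : ℕ} (hp : p.Prime) (hk : 2 * k ≤ p) : ¬ p ∣ oddProd k := by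
  rw [oddProd, hp.prime.dvd_finsetProd_iff]
  rintro ⟨j, hj, h⟩
  have := mem_range.1 hj
  have := Nat.le_of_dvd (by omega) h
  omega

theorem norm_wzG_le {p m k : ℕ} [Fact p.Prime] (hp : p = 2 * m + 1) (hk : k < m) :
    ‖wzG ℚ_[p] (m + 1) k‖ ≤ (p : ℝ) ^ (-3 : ℤ) := by
  have hprime : p.Prime := Fact.out
  have h2 : ¬ p ∣ 2 := fun h => by have := Nat.le_of_dvd two_pos h; omega
  have h8 : ‖(8 : ℚ_[p])‖ = 1 := by
    have := Padic.norm_natCast_eq_one_of_not_dvd (p := p) (n := 2 ^ 3)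
      fun h => h2 (hprime.dvd_of_dvd_pow h)
    simpa using this
  have hf : ‖((m + 1).factorial : ℚ_[p])‖ = 1 :=
    Padic.norm_natCast_eq_one_of_not_dvd fun h => by
      have := (hprime.dvd_factorial).1 h
      omega
  have hD : ‖(oddProd (k + 1) : ℚ_[p])‖ = 1 :=
    Padic.norm_natCast_eq_one_of_not_dvd (not_dvd_oddProd hprime (by omega))
  have hdvd (n : ℕ) (hn : m < n) : p ∣ oddProd n :=
    (hp ▸ oddProd_succ m ▸ dvd_mul_left _ _ : p ∣ oddProd (m + 1)).trans (oddProd_dvd_of_le hn)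
  obtain ⟨a, ha⟩ := hdvd (m + 1) (by omega)
  obtain ⟨b, hb⟩ := hdvd (m + 1 + k) (by omega)
  have hden : ‖(8 ^ (m + 1) * (m + 1).factorial ^ 3 * oddProd (k + 1) ^ 2 : ℚ_[p])‖ = 1 := by
    simp [h8, hf, hD]
  rw [wzG, norm_div, hden, div_one, ha, hb]
  have hnum : ((-1) ^ (m + 1 + k + 1) * 2 ^ (k + 3) * ((m + 1 : ℕ) : ℚ_[p]) ^ 2 *
      ((p * a : ℕ) : ℚ_[p]) ^ 2 * ((p * b : ℕ) : ℚ_[p]) * ((m + 1).descFactorial (k + 1) : ℕ)) =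
      (((p : ℤ) ^ 3 * ((-1) ^ (m + 1 + k + 1) * 2 ^ (k + 3) * (m + 1 : ℕ) ^ 2 * a ^ 2 * b *
        (m + 1).descFactorial (k + 1)) : ℤ) : ℚ_[p]) := by
    push_cast
    ring
  rw [hnum]
  exact (Padic.norm_int_le_pow_iff_dvd _ 3).2 (by push_cast; exact dvd_mul_right _ _)

/-- Van Hamme's supercongruence: for every odd prime `p`,
`∑_{k<p} (4k+1) binom(2k,k)³ (-1/64)^k ≡ (-1)^((p-1)/2) p mod p³`. -/
theorem stmt_10 (p : ℕ) [Fact p.Prime] (hodd : Odd p) :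
    (p : ℤ_[p]) ^ 3 ∣
      (∑ k ∈ Finset.range p,
          ((4 * k + 1 : ℕ) * (Nat.choose (2 * k) k : ℤ_[p]) ^ 3 *
            (-(Ring.inverse (64 : ℤ_[p]))) ^ k))
        - (-1 : ℤ_[p]) ^ ((p - 1) / 2) * p := by
  obtain ⟨m, hm⟩ := hodd
  have hprime : p.Prime := Fact.out
  have hunit (q : ℕ) (hq : ∃ i, q = 2 ^ i) : ‖(q : ℚ_[p])‖ = 1 := by
    obtain ⟨i, rfl⟩ := hq
    refine Padic.norm_natCast_eq_one_of_not_dvd fun h => ?_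
    have := Nat.le_of_dvd two_pos (hprime.dvd_of_dvd_pow h)
    have := hprime.two_le
    omega
  have h64 : ‖(64 : ℤ_[p])‖ = 1 := by
    exact_mod_cast PadicInt.norm_natCast_eq_one_iff.2
      (Padic.norm_natCast_eq_one_iff.1 (hunit 64 ⟨6, rfl⟩))
  have hinv : ((Ring.inverse (64 : ℤ_[p]) : ℤ_[p]) : ℚ_[p]) = (64 : ℚ_[p])⁻¹ := by
    refine eq_inv_of_mul_eq_one_left ?_
    have := Ring.inverse_mul_cancel (64 : ℤ_[p]) (PadicInt.isUnit_iff.2 h64)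
    exact_mod_cast congrArg (fun x : ℤ_[p] => (x : ℚ_[p])) this
  rw [← Finset.sum_range_add_sum_Ico _ (show m + 1 ≤ p by omega), add_sub_right_comm]
  refine dvd_add ?_ (dvd_sum fun k hk => ?_)
  · rw [← Ideal.mem_span_singleton, ← PadicInt.norm_le_pow_iff_mem_span_pow, PadicInt.norm_def]
    have hsum : ∑ k ∈ range (m + 1), (4 * k + 1 : ℕ) * (Nat.choose (2 * k) k : ℚ_[p]) ^ 3 *
        (-(64 : ℚ_[p])⁻¹) ^ k = oddProd (2 * m + 1) / (4 ^ m * (m.factorial : ℚ_[p]) ^ 2) +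
          ∑ k ∈ range m, wzG ℚ_[p] (m + 1) k := by
      rw [← sum_wzF_diag, ← sum_wzF_zero]
      exact sum_congr rfl fun k _ => (wzF_zero k).symm
    simp only [PadicInt.coe_sub, PadicInt.coe_sum, PadicInt.coe_mul, PadicInt.coe_pow,
      PadicInt.coe_neg, PadicInt.coe_one, PadicInt.coe_natCast, hinv]
    rw [hsum, add_sub_right_comm]
    refine (Padic.nonarchimedean _ _).trans (max_le ?_ ?_)
    · have h4 : ‖(4 : ℚ_[p])‖ = 1 := by simpa using hunit 4 ⟨2, rfl⟩
      have hf : ‖(m.factorial : ℚ_[p])‖ = 1 :=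
        Padic.norm_natCast_eq_one_of_not_dvd fun h => by
          have := (hprime.dvd_factorial).1 h
          omega
      have hden : ‖(4 ^ m * (m.factorial : ℚ_[p]) ^ 2)‖ = 1 := by simp [h4, hf]
      have hne : (4 ^ m * (m.factorial : ℚ_[p]) ^ 2) ≠ 0 := norm_ne_zero_iff.1 (by simp [hden])
      rw [div_sub' hne, norm_div, hden, div_one]
      have hmod := pow_three_dvd_oddProd_sub m
      rw [← hm] at hmod
      rw [← Nat.cast_pow] at hmod
      refine (congrArg norm ?_).trans_le ((Padic.norm_int_le_pow_iff_dvd _ 3).2 hmod)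
      rw [show (p - 1) / 2 = m by omega, ← hm, neg_pow 4 m]
      push_cast
      ring
    · exact IsUltrametricDist.norm_sum_le_of_forall_le_of_nonneg (by positivity)
        fun k hk => norm_wzG_le hm (mem_range.1 hk)
  · obtain ⟨hk1, hk2⟩ := mem_Ico.1 hk
    have hdvd : p ∣ (2 * k).choose k := by
      refine hprime.dvd_choose hk2 (by omega) (by omega)
    exact dvd_mul_of_dvd_left (dvd_mul_of_dvd_right (pow_dvd_pow_of_dvd
      (Nat.cast_dvd_cast hdvd) 3) _) _
end

section
/- For every prime p with p \equiv 1 mod 4, \sum_{k=0}^{p-1} (1 + 4k) \binom{2k}{k}^3 64^{-k} \equiv 0 mod p^2 in Z_p. -/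
open Finset

section WellPoisedSum

variable {K : Type*} [Field K]

/-- The summand `(1/2)_k (-n)_k (c)_k / (k! (3/2+n)_k (3/2-c)_k)`, without its very-well-poised
factor `4k+1`. -/
def wellPoisedTerm (c : K) (n k : ℕ) : K :=
  ∏ j ∈ range k, ((2 * j + 1) * (2 * j - 2 * n) * (2 * j + 2 * c)) /
    ((2 * j + 2) * (2 * j + 3 + 2 * n) * (2 * j + 3 - 2 * c))

lemma wellPoisedTerm_self_succ (c : K) (n : ℕ) : wellPoisedTerm c n (n + 1) = 0 := by
  simp [wellPoisedTerm, prod_range_succ]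

variable [CharZero K]

lemma two_mul_add_two_ne_zero (k : ℕ) : (2 * k + 2 : K) ≠ 0 := by
  exact_mod_cast (by omega : 2 * k + 2 ≠ 0)

lemma two_mul_add_three_add_ne_zero (k n : ℕ) : (2 * k + 3 + 2 * n : K) ≠ 0 := by
  exact_mod_cast (by omega : 2 * k + 3 + 2 * n ≠ 0)

lemma wellPoisedTerm_succ {c : K} (hc : ∀ j : ℕ, (2 * j + 3 - 2 * c : K) ≠ 0) (n k : ℕ) :
    wellPoisedTerm c n (k + 1) * ((2 * k + 2) * (2 * k + 3 + 2 * n) * (2 * k + 3 - 2 * c)) =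
      wellPoisedTerm c n k * ((2 * k + 1) * (2 * k - 2 * n) * (2 * k + 2 * c)) := by
  rw [wellPoisedTerm, prod_range_succ, ← wellPoisedTerm, mul_assoc, div_mul_cancel₀]
  exact mul_ne_zero (mul_ne_zero (two_mul_add_two_ne_zero k)
    (two_mul_add_three_add_ne_zero k n)) (hc k)

lemma wellPoisedTerm_contiguous {c : K} (hc : ∀ j : ℕ, (2 * j + 3 - 2 * c : K) ≠ 0) (n k : ℕ) :
    wellPoisedTerm c (n + 1) k * ((n + 1 - k) * (2 * n + 3 + 2 * k)) =
      wellPoisedTerm c n k * ((n + 1) * (2 * n + 3)) := by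
  induction k with
  | zero => simp [wellPoisedTerm]
  | succ k ih =>
    have h1 := wellPoisedTerm_succ hc n k
    have h2 := wellPoisedTerm_succ hc (n + 1) k
    have hD : ((2 * k + 2) * (2 * k + 3 + 2 * n) * (2 * k + 3 - 2 * c) : K) ≠ 0 :=
      mul_ne_zero (mul_ne_zero (two_mul_add_two_ne_zero k)
        (two_mul_add_three_add_ne_zero k n)) (hc k)
    apply mul_right_cancel₀ hD
    push_cast at h2 ⊢
    linear_combination (n - k : K) * (2 * k + 3 + 2 * n) * h2 - (n + 1) * (2 * n + 3) * h1
      + (2 * k + 1) * (2 * k - 2 * n) * (2 * k + 2 * c) * ih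

lemma wellPoisedTerm_telescope {c : K} (hc : ∀ j : ℕ, (2 * j + 3 - 2 * c : K) ≠ 0) (n m : ℕ) :
    ∑ k ∈ range m, (4 * k + 1) *
      ((3 - 2 * c + 2 * n) * (3 + 4 * n) * (n + 1) * wellPoisedTerm c (n + 1) k -
        (3 + 2 * n) * (3 - 4 * c + 4 * n) * (n + 1) * wellPoisedTerm c n k) =
      -(wellPoisedTerm c (n + 1) m * (m * (2 * m + 3 + 2 * n) * (2 * m + 1 - 2 * c) *
        (4 * m - 1))) := by
  induction m with
  | zero => simp
  | succ k ih =>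
    rw [sum_range_succ, ih]
    have h1 := wellPoisedTerm_contiguous hc n k
    have h2 := wellPoisedTerm_succ hc (n + 1) k
    push_cast at h2 ⊢
    linear_combination (4 * k + 1) * (3 - 4 * c + 4 * n) * h1 + (4 * k + 3) / 2 * h2

/-- The terminating `₅F₄(1)` summation with parameters `1/2, -n, c, 3/4`. -/
theorem sum_wellPoisedTerm {c : K} (hc : ∀ j : ℕ, (2 * j + 3 - 2 * c : K) ≠ 0) (n : ℕ) :
    (∑ k ∈ range (n + 1), (4 * k + 1) * wellPoisedTerm c n k) *
        ∏ j ∈ range n, ((3 - 2 * c + 2 * j) * (3 + 4 * j)) =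
      ∏ j ∈ range n, ((3 + 2 * j) * (3 - 4 * c + 4 * j)) := by
  induction n with
  | zero => simp [wellPoisedTerm]
  | succ n ih =>
    have h := wellPoisedTerm_telescope hc n (n + 1 + 1)
    rw [wellPoisedTerm_self_succ, zero_mul, neg_zero] at h
    have hn : (n + 1 : K) ≠ 0 := by exact_mod_cast n.succ_ne_zero
    have hrec : (3 - 2 * c + 2 * n) * (3 + 4 * n) *
        (∑ k ∈ range (n + 1 + 1), (4 * k + 1) * wellPoisedTerm c (n + 1) k) =
        (3 + 2 * n) * (3 - 4 * c + 4 * n) *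
          ∑ k ∈ range (n + 1), (4 * k + 1) * wellPoisedTerm c n k := by
      have hext : ∑ k ∈ range (n + 1), (4 * k + 1) * wellPoisedTerm c n k =
          ∑ k ∈ range (n + 1 + 1), (4 * k + 1) * wellPoisedTerm c n k := by
        rw [sum_range_succ _ (n + 1), wellPoisedTerm_self_succ, mul_zero, add_zero]
      rw [hext]
      apply mul_left_cancel₀ hn
      rw [← sub_eq_zero, ← h]
      simp only [mul_sum, ← sum_sub_distrib]
      exact sum_congr rfl fun k _ => by ring
    rw [prod_range_succ, prod_range_succ, ← ih]
    linear_combination (∏ j ∈ range n, ((3 - 2 * c + 2 * j) * (3 + 4 * j) : K)) * hrec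

end WellPoisedSum

section Congruence

variable {p : ℕ}

lemma not_dvd_of_natAbs_lt {m : ℤ} (h0 : m ≠ 0) (h : m.natAbs < p) : ¬ (p : ℤ) ∣ m := by
  intro hd
  have := Nat.le_of_dvd (Int.natAbs_pos.2 h0) (Int.natCast_dvd.1 hd)
  omega

variable [Fact p.Prime]

lemma PadicInt.coe_ofNat (n : ℕ) [n.AtLeastTwo] :
    ((ofNat(n) : ℤ_[p]) : ℚ_[p]) = ofNat(n) :=
  map_ofNat PadicInt.Coe.ringHom n

lemma PadicInt.isUnit_intCast_of_not_dvd {m : ℤ} (h : ¬ (p : ℤ) ∣ m) : IsUnit (m : ℤ_[p]) := by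
  rw [PadicInt.isUnit_iff]
  by_contra hne
  exact h ((PadicInt.norm_int_lt_one_iff_dvd m).1 (lt_of_le_of_ne (PadicInt.norm_le_one _) hne))

lemma PadicInt.coe_prod {ι : Type*} (s : Finset ι) (f : ι → ℤ_[p]) :
    ((∏ i ∈ s, f i : ℤ_[p]) : ℚ_[p]) = ∏ i ∈ s, (f i : ℚ_[p]) :=
  map_prod PadicInt.Coe.ringHom f s

/-- For `p = 2N+1`, the term with parameters `-N, N+1` is `p`-integral and congruent modulo `p²`
to the cube of `binom(2k,k) / 4^k`. -/
lemma exists_padicInt_wellPoisedTerm {N : ℕ} (hN : p = 2 * N + 1) {q : ℤ_[p]} (hq : 4 * q = 1)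
    (hc : ∀ j : ℕ, (2 * j + 3 - 2 * (N + 1) : ℚ_[p]) ≠ 0) (k : ℕ) (hk : k ≤ N) :
    ∃ w : ℤ_[p], (w : ℚ_[p]) = wellPoisedTerm (N + 1 : ℚ_[p]) N k ∧
      (p : ℤ_[p]) ^ 2 ∣ w - ((Nat.choose (2 * k) k : ℤ_[p]) * q ^ k) ^ 3 := by
  have hp : Prime (p : ℤ) := Nat.prime_iff_prime_int.1 Fact.out
  induction k with
  | zero => exact ⟨1, by simp [wellPoisedTerm]⟩
  | succ k ih =>
    obtain ⟨w, hw, d, hd⟩ := ih (by omega)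
    have hndvd : ¬ (p : ℤ) ∣ (2 * k + 2) * ((2 * k + 2) ^ 2 - p ^ 2) := by
      have h0 : ¬ (p : ℤ) ∣ 2 * k + 2 := not_dvd_of_natAbs_lt (by omega) (by omega)
      intro h
      rcases hp.dvd_or_dvd h with h | h
      · exact h0 h
      · exact h0 (hp.dvd_of_dvd_pow ((dvd_sub_left (dvd_pow_self _ two_ne_zero)).1 h))
    have hU := PadicInt.isUnit_intCast_of_not_dvd hndvd
    push_cast at hU
    obtain ⟨r, hr⟩ := hU.exists_right_inv
    have hpN : (p : ℚ_[p]) = 2 * N + 1 := by exact_mod_cast congrArg (Nat.cast : ℕ → ℚ_[p]) hN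
    refine ⟨w * ((2 * k + 1) * ((2 * k + 1) ^ 2 - p ^ 2)) * r, ?_, ?_⟩
    · have hD : ((2 * k + 2) * (2 * k + 3 + 2 * N) * (2 * k + 3 - 2 * (N + 1)) : ℚ_[p]) ≠ 0 :=
        mul_ne_zero (mul_ne_zero (two_mul_add_two_ne_zero k)
          (two_mul_add_three_add_ne_zero k N)) (hc k)
      apply mul_right_cancel₀ hD
      rw [wellPoisedTerm_succ hc, ← hw]
      have hr' := congrArg (fun x : ℤ_[p] => (x : ℚ_[p])) hr
      push_cast [PadicInt.coe_ofNat] at hr' ⊢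
      rw [hpN] at hr' ⊢
      linear_combination (w : ℚ_[p]) * ((2 * k + 1) * ((2 * k + 1) ^ 2 - (2 * N + 1) ^ 2)) * hr'
    · have hb : ((2 * k + 2 : ℤ_[p]) * (Nat.choose (2 * (k + 1)) (k + 1) : ℤ_[p])) =
          4 * (2 * k + 1) * (Nat.choose (2 * k) k : ℤ_[p]) := by
        have h := congrArg (Nat.cast : ℕ → ℤ_[p]) (Nat.succ_mul_centralBinom_succ k)
        simp only [Nat.centralBinom] at h
        push_cast at h
        linear_combination 2 * h
      set b : ℤ_[p] := (Nat.choose (2 * k) k : ℤ_[p]) * q ^ k with hbdef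
      set b' : ℤ_[p] := (Nat.choose (2 * (k + 1)) (k + 1) : ℤ_[p]) * q ^ (k + 1) with hbdef'
      have hbb : (2 * k + 2 : ℤ_[p]) * b' = (2 * k + 1) * b := by
        rw [hbdef, hbdef']
        linear_combination q ^ (k + 1) * hb +
          (2 * k + 1) * (Nat.choose (2 * k) k : ℤ_[p]) * q ^ k * hq
      have hbb3 : (2 * k + 2 : ℤ_[p]) ^ 3 * b' ^ 3 = (2 * k + 1) ^ 3 * b ^ 3 := by
        rw [← mul_pow, hbb, mul_pow]
      rw [← hU.dvd_mul_left]
      refine ⟨d * ((2 * k + 1) * ((2 * k + 1) ^ 2 - p ^ 2)) - (2 * k + 1) * b ^ 3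
        + (2 * k + 2) * b' ^ 3, ?_⟩
      linear_combination (w * ((2 * k + 1) * ((2 * k + 1) ^ 2 - p ^ 2))) * hr
        + ((2 * k + 1) * ((2 * k + 1) ^ 2 - p ^ 2)) * hd - hbb3

end Congruence

/-- Sun–Wang: for every prime `p ≡ 1 mod 4`,
`∑_{k<p} (1+4k) binom(2k,k)³ 64^{-k} ≡ 0 mod p²`. -/
theorem stmt_11 (p : ℕ) [Fact p.Prime] (hp4 : p % 4 = 1) :
    (p : ℤ_[p]) ^ 2 ∣
      ∑ k ∈ Finset.range p,
        ((1 + 4 * k : ℕ) * (Nat.choose (2 * k) k : ℤ_[p]) ^ 3 *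
          (Ring.inverse (64 : ℤ_[p])) ^ k) := by
  have hp : p.Prime := Fact.out
  have hpZ : Prime (p : ℤ) := Nat.prime_iff_prime_int.1 hp
  have hp2 := hp.two_le
  obtain ⟨M, hM⟩ : ∃ M, p = 4 * M + 1 := ⟨p / 4, by omega⟩
  obtain ⟨N, hNM⟩ : ∃ N, N = 2 * M := ⟨_, rfl⟩
  have hN : p = 2 * N + 1 := by omega
  have hU4 : IsUnit (4 : ℤ_[p]) := by
    exact_mod_cast PadicInt.isUnit_intCast_of_not_dvd (p := p) (m := 4)
      (not_dvd_of_natAbs_lt (by norm_num) (by change 4 < p; omega))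
  obtain ⟨q, hq⟩ := hU4.exists_right_inv
  have hinv : Ring.inverse (64 : ℤ_[p]) = q ^ 3 :=
    left_inv_eq_right_inv (Ring.inverse_mul_cancel _ ((by norm_num : (64 : ℤ_[p]) = 4 ^ 3) ▸
      hU4.pow 3)) (by linear_combination (16 * q ^ 2 + 4 * q + 1) * hq)
  have hc : ∀ j : ℕ, (2 * j + 3 - 2 * (N + 1) : ℚ_[p]) ≠ 0 := by
    intro j
    exact_mod_cast (by omega : (2 * j + 3 - 2 * (N + 1) : ℤ) ≠ 0)
  have hex := exists_padicInt_wellPoisedTerm hN hq hc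
  choose! w hw hwd using hex
  have hterm : ∀ k, ((1 + 4 * k : ℕ) * (Nat.choose (2 * k) k : ℤ_[p]) ^ 3 * (q ^ 3) ^ k) =
      (4 * k + 1) * ((Nat.choose (2 * k) k : ℤ_[p]) * q ^ k) ^ 3 := by
    intro k; push_cast; ring
  rw [hinv, ← sum_range_add_sum_Ico _ (by omega : N + 1 ≤ p)]
  apply dvd_add
  · have hsum : (p : ℤ_[p]) ^ 2 ∣ ∑ k ∈ range (N + 1), (4 * k + 1) * w k := by
      have hD : IsUnit (∏ j ∈ range N, ((1 - 2 * N + 2 * j) * (3 + 4 * j) : ℤ_[p])) := by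
        rw [IsUnit.prod_iff]
        intro j hj
        rw [mem_range] at hj
        apply IsUnit.mul
        · exact_mod_cast PadicInt.isUnit_intCast_of_not_dvd (p := p) (m := 1 - 2 * N + 2 * j)
            (not_dvd_of_natAbs_lt (by omega) (by omega))
        · refine (by push_cast; rfl : ((3 + 4 * j : ℤ) : ℤ_[p]) = 3 + 4 * j) ▸
            PadicInt.isUnit_intCast_of_not_dvd ?_
          rintro ⟨t, ht⟩
          have h0 : 0 < t := by
            by_contra! h
            nlinarith [hpZ.ne_zero]
          have h2 : t < 2 := by
            by_contra! h
            nlinarith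
          obtain rfl : t = 1 := by omega
          omega
      have key : (∑ k ∈ range (N + 1), (4 * k + 1) * w k) *
          ∏ j ∈ range N, ((1 - 2 * N + 2 * j) * (3 + 4 * j) : ℤ_[p]) =
          ∏ j ∈ range N, ((3 + 2 * j) * (-1 - 4 * N + 4 * j) : ℤ_[p]) := by
        have h := sum_wellPoisedTerm hc N
        have hS : ∑ k ∈ range (N + 1), (4 * k + 1) * (w k : ℚ_[p]) =
            ∑ k ∈ range (N + 1), (4 * k + 1) * wellPoisedTerm (N + 1 : ℚ_[p]) N k :=
          sum_congr rfl fun k hk => by rw [hw k (by simpa [Nat.lt_succ_iff] using hk)]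
        rw [← hS] at h
        have hA : ∀ j : ℕ, (3 - 2 * (N + 1) + 2 * j : ℚ_[p]) = 1 - 2 * N + 2 * j := by
          intro j; ring
        have hB : ∀ j : ℕ, (3 - 4 * (N + 1) + 4 * j : ℚ_[p]) = -1 - 4 * N + 4 * j := by
          intro j; ring
        simp only [hA, hB] at h
        apply PadicInt.ext
        push_cast [PadicInt.coe_ofNat, PadicInt.coe_prod, PadicInt.coe_sum]
        exact h
      rw [← hD.dvd_mul_right, key, prod_mul_distrib, sq]
      apply mul_dvd_mul
      · refine dvd_trans (dvd_of_eq ?_) (dvd_prod_of_mem _ (mem_range.2 (by omega : N - 1 < N)))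
        exact_mod_cast (by omega : p = 3 + 2 * (N - 1))
      · refine dvd_trans ⟨-1, ?_⟩ (dvd_prod_of_mem _ (mem_range.2 (by omega : M < N)))
        have : (-1 - 4 * N + 4 * M : ℤ) = p * -1 := by omega
        exact_mod_cast congrArg (Int.cast : ℤ → ℤ_[p]) this
    rw [← dvd_sub_right hsum, ← sum_sub_distrib]
    refine dvd_sum fun k hk => ?_
    rw [hterm, ← mul_sub]
    exact (hwd k (by simpa [Nat.lt_succ_iff] using hk)).mul_left _
  · refine dvd_sum fun k hk => ?_
    rw [mem_Ico] at hk
    have hdvd : p ∣ (2 * k).choose k := by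
      rw [two_mul]
      exact hp.dvd_choose_add hk.2 hk.2 (by omega)
    have h1 : (p : ℤ_[p]) ∣ ((2 * k).choose k : ℤ_[p]) := by exact_mod_cast Nat.cast_dvd_cast hdvd
    exact (((pow_dvd_pow_of_dvd h1 2).trans (pow_dvd_pow _ (by norm_num))).mul_left _).mul_right _
end
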